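/- Let F : C ⇄ D : G be a Quillen adjunction, let x be a cofibrant object of C, and let y be a fibrant object of D. Then the collage (C^c+D^f), with its weak equivalences, admits a homotopical three-arrow calculus with respect to x and y: for all i, j ≥ 1, the identity-insertion functor induces a weak homotopy equivalence N(Z_{i,j}((C^c+D^f);x,y)) → N(Z'_{i,j}((C^c+D^f);x,y)). -/

import Mathlib

open CategoryTheory CategoryTheory.Limits

universe w v u

namespace Paper

section

open Simplicial

/-- The map constant at vertex `i` of `Δ[1]`. -/
def constVertex (X : SSet.{w}) (i : Fin 2) : X ⟶ Δ[1] where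
  app m := ↾fun _ => ULift.up (SimplexCategory.const m.unop ⦋1⦌ i)
  naturality _ _ _ := rfl

/-- Elementary simplicial homotopy between two maps of simplicial sets,
given by a map out of the cylinder `X ⨯ Δ[1]`. -/
def SHomotopy {X Y : SSet.{w}} (f g : X ⟶ Y) : Prop :=
  ∃ H : X ⨯ Δ[1] ⟶ Y,
    prod.lift (𝟙 X) (constVertex X 0) ≫ H = f ∧
    prod.lift (𝟙 X) (constVertex X 1) ≫ H = g

/-- A *Kan complex* is a simplicial set `S` if it satisfies the following horn-filling condition:
for every `n : ℕ` and `0 ≤ i ≤ n`, every map of simplicial sets `σ₀ : Λ[n, i] → S` can be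
extended to a map `σ : Δ[n] → S`. (This is the older Mathlib's `SSet.KanComplex`.) -/
class KanComplex (S : SSet.{w}) : Prop where
  hornFilling : ∀ ⦃n : ℕ⦄ ⦃i : Fin (n + 1)⦄ (σ₀ : (Λ[n, i] : SSet.{w}) ⟶ S),
    ∃ σ : Δ[n] ⟶ S, σ₀ = Λ[n, i].ι ≫ σ

end

/-- The relation of being simplicially homotopic: the equivalence relation
generated by elementary simplicial homotopies. -/
def Htpy {X Y : SSet.{w}} (f g : X ⟶ Y) : Prop := Relation.EqvGen SHomotopy f g

/-- A map of simplicial sets is a weak homotopy equivalence (in the Kan–Quillen sense)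
iff for every Kan complex `K` the induced map on simplicial homotopy classes of maps
into `K` is a bijection. -/
def IsWeakHomotopyEquiv {X Y : SSet.{w}} (f : X ⟶ Y) : Prop :=
  ∀ (K : SSet.{w}), KanComplex K →
    (∀ g : X ⟶ K, ∃ h : Y ⟶ K, Htpy (f ≫ h) g) ∧
    (∀ h h' : Y ⟶ K, Htpy (f ≫ h) (f ≫ h') → Htpy h h')

/-- A simplicial set is weakly contractible if its map to the terminal object
is a weak homotopy equivalence. -/
def WeaklyContractible (X : SSet.{w}) : Prop := IsWeakHomotopyEquiv (terminal.from X)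

/-- The map on nerves induced by a functor. -/
def nerveMap {C : Type u} {D : Type u} [Category.{v} C] [Category.{v} D] (F : C ⥤ D) :
    nerve C ⟶ nerve D where
  app _ := ↾fun G => G ⋙ F
  naturality _ _ _ := rfl



/-- `f` is a retract of `g` in the arrow category. -/
def IsRetractOf {C : Type u} [Category.{v} C] {X Y X' Y' : C} (f : X ⟶ Y) (g : X' ⟶ Y') : Prop :=
  ∃ (i : X ⟶ X') (r : X' ⟶ X) (j : Y ⟶ Y') (s : Y' ⟶ Y),
    i ≫ r = 𝟙 X ∧ j ≫ s = 𝟙 Y ∧ i ≫ g = f ≫ j ∧ r ≫ f = g ≫ s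

/-- A (Quillen) model structure on a category: three wide subcategories of weak
equivalences, cofibrations and fibrations, satisfying the two-out-of-three, retract,
lifting and factorization axioms.  (No functorial factorizations are assumed; a model
category is a finitely bicomplete category equipped with such a structure.) -/
structure ModelStructure (C : Type u) [Category.{v} C] where
  W : MorphismProperty C
  Cof : MorphismProperty C
  Fib : MorphismProperty C
  W_id : ∀ X : C, W (𝟙 X)
  Cof_id : ∀ X : C, Cof (𝟙 X)
  Fib_id : ∀ X : C, Fib (𝟙 X)
  W_comp : ∀ {X Y Z : C} (f : X ⟶ Y) (g : Y ⟶ Z), W f → W g → W (f ≫ g)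
  Cof_comp : ∀ {X Y Z : C} (f : X ⟶ Y) (g : Y ⟶ Z), Cof f → Cof g → Cof (f ≫ g)
  Fib_comp : ∀ {X Y Z : C} (f : X ⟶ Y) (g : Y ⟶ Z), Fib f → Fib g → Fib (f ≫ g)
  W_of_precomp : ∀ {X Y Z : C} (f : X ⟶ Y) (g : Y ⟶ Z), W f → W (f ≫ g) → W g
  W_of_postcomp : ∀ {X Y Z : C} (f : X ⟶ Y) (g : Y ⟶ Z), W g → W (f ≫ g) → W f
  W_retract : ∀ {X Y X' Y' : C} {f : X ⟶ Y} {g : X' ⟶ Y'}, IsRetractOf f g → W g → W f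
  Cof_retract : ∀ {X Y X' Y' : C} {f : X ⟶ Y} {g : X' ⟶ Y'}, IsRetractOf f g → Cof g → Cof f
  Fib_retract : ∀ {X Y X' Y' : C} {f : X ⟶ Y} {g : X' ⟶ Y'}, IsRetractOf f g → Fib g → Fib f
  lifting_acof_fib : ∀ {A B X Y : C} (i : A ⟶ B) (p : X ⟶ Y),
    Cof i → W i → Fib p → HasLiftingProperty i p
  lifting_cof_afib : ∀ {A B X Y : C} (i : A ⟶ B) (p : X ⟶ Y),
    Cof i → Fib p → W p → HasLiftingProperty i p
  fact_acof_fib : ∀ {X Y : C} (f : X ⟶ Y),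
    ∃ (Z : C) (i : X ⟶ Z) (p : Z ⟶ Y), Cof i ∧ W i ∧ Fib p ∧ i ≫ p = f
  fact_cof_afib : ∀ {X Y : C} (f : X ⟶ Y),
    ∃ (Z : C) (i : X ⟶ Z) (p : Z ⟶ Y), Cof i ∧ Fib p ∧ W p ∧ i ≫ p = f

/-- An object is cofibrant if the map from an initial object is a cofibration. -/
def Cofibrant {C : Type u} [Category.{v} C] [HasInitial C] (M : ModelStructure C) (X : C) :
    Prop := M.Cof (initial.to X)

/-- An object is fibrant if the map to a terminal object is a fibration. -/
def Fibrant {C : Type u} [Category.{v} C] [HasTerminal C] (M : ModelStructure C) (X : C) :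
    Prop := M.Fib (terminal.from X)

/-- A category with a wide subcategory of weak equivalences (a relative category
whose weak equivalences form a wide subcategory). -/
structure RelCatStruct (R : Type u) [Category.{v} R] where
  W : MorphismProperty R
  W_id : ∀ X : R, W (𝟙 X)
  W_comp : ∀ {X Y Z : R} (f : X ⟶ Y) (g : Y ⟶ Z), W f → W g → W (f ≫ g)

/-- The underlying relative category of a model structure. -/
def ModelStructure.relcat {C : Type u} [Category.{v} C] (M : ModelStructure C) :
    RelCatStruct C :=
  ⟨M.W, M.W_id, M.W_comp⟩

/-- A Quillen adjunction between model categories: an adjunction `F ⊣ G` such that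
`F` preserves cofibrations and acyclic cofibrations. -/
structure QuillenAdjunction {C : Type u} {D : Type u} [Category.{v} C] [Category.{v} D]
    (MC : ModelStructure C) (MD : ModelStructure D) where
  F : C ⥤ D
  G : D ⥤ C
  adj : F ⊣ G
  F_cof : ∀ {X Y : C} (f : X ⟶ Y), MC.Cof f → MD.Cof (F.map f)
  F_acof : ∀ {X Y : C} (f : X ⟶ Y), MC.Cof f → MC.W f → MD.W (F.map f)

variable {R : Type u} [Category.{v} R]

/-- The category `Z_{i,j}(R;x,y)` (with `m = i + j`) of zigzags
`x ⟵ c₀ → c₁ → ⋯ → c_m ⟵ y` whose two backwards maps are weak equivalences;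
morphisms are families of weak equivalences commuting with all structure maps and
restricting to identities on `x` and `y`. -/
structure ZigZag (ρ : RelCatStruct R) (x y : R) (m : ℕ) where
  c : Fin (m + 1) → R
  l : c 0 ⟶ x
  hl : ρ.W l
  arr : ∀ k : Fin m, c k.castSucc ⟶ c k.succ
  r : y ⟶ c (Fin.last m)
  hr : ρ.W r

@[ext]
structure ZigZagHom {ρ : RelCatStruct R} {x y : R} {m : ℕ} (A B : ZigZag ρ x y m) where
  u : ∀ k, A.c k ⟶ B.c k
  hu : ∀ k, ρ.W (u k)
  comm_l : u 0 ≫ B.l = A.l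
  comm_arr : ∀ k : Fin m, u k.castSucc ≫ B.arr k = A.arr k ≫ u k.succ
  comm_r : A.r ≫ u (Fin.last m) = B.r

instance {ρ : RelCatStruct R} {x y : R} {m : ℕ} : Category (ZigZag ρ x y m) where
  Hom := ZigZagHom
  id A := ⟨fun _ => 𝟙 _, fun _ => ρ.W_id _, by simp, fun k => by simp, by simp⟩
  comp φ ψ := ⟨fun k => φ.u k ≫ ψ.u k, fun k => ρ.W_comp _ _ (φ.hu k) (ψ.hu k),
    by rw [Category.assoc, ψ.comm_l, φ.comm_l],
    fun k => by rw [Category.assoc, ψ.comm_arr, ← Category.assoc, φ.comm_arr,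
      Category.assoc],
    by rw [← Category.assoc, φ.comm_r, ψ.comm_r]⟩
  id_comp _ := by apply ZigZagHom.ext; funext k; simp
  comp_id _ := by apply ZigZagHom.ext; funext k; simp
  assoc _ _ _ := by apply ZigZagHom.ext; funext k; simp

/-- The category `Z'_{i,j}(R;x,y)` of zigzags
`x ⟵ c₀ → ⋯ → c_i ⟵ d₀ → ⋯ → d_j ⟵ y` whose three backwards maps are weak
equivalences; morphisms are families of weak equivalences commuting with all structure
maps and restricting to identities on `x` and `y`. -/
structure ZigZag' (ρ : RelCatStruct R) (x y : R) (i j : ℕ) where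
  c : Fin (i + 1) → R
  d : Fin (j + 1) → R
  l : c 0 ⟶ x
  hl : ρ.W l
  arrc : ∀ k : Fin i, c k.castSucc ⟶ c k.succ
  mid : d 0 ⟶ c (Fin.last i)
  hmid : ρ.W mid
  arrd : ∀ k : Fin j, d k.castSucc ⟶ d k.succ
  r : y ⟶ d (Fin.last j)
  hr : ρ.W r

@[ext]
structure ZigZag'Hom {ρ : RelCatStruct R} {x y : R} {i j : ℕ} (A B : ZigZag' ρ x y i j) where
  uc : ∀ k, A.c k ⟶ B.c k
  ud : ∀ k, A.d k ⟶ B.d k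
  huc : ∀ k, ρ.W (uc k)
  hud : ∀ k, ρ.W (ud k)
  comm_l : uc 0 ≫ B.l = A.l
  comm_arrc : ∀ k : Fin i, uc k.castSucc ≫ B.arrc k = A.arrc k ≫ uc k.succ
  comm_mid : ud 0 ≫ B.mid = A.mid ≫ uc (Fin.last i)
  comm_arrd : ∀ k : Fin j, ud k.castSucc ≫ B.arrd k = A.arrd k ≫ ud k.succ
  comm_r : A.r ≫ ud (Fin.last j) = B.r

instance {ρ : RelCatStruct R} {x y : R} {i j : ℕ} : Category (ZigZag' ρ x y i j) where
  Hom := ZigZag'Hom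
  id A := ⟨fun _ => 𝟙 _, fun _ => 𝟙 _, fun _ => ρ.W_id _, fun _ => ρ.W_id _,
    by simp, fun k => by simp, by simp, fun k => by simp, by simp⟩
  comp φ ψ := ⟨fun k => φ.uc k ≫ ψ.uc k, fun k => φ.ud k ≫ ψ.ud k,
    fun k => ρ.W_comp _ _ (φ.huc k) (ψ.huc k), fun k => ρ.W_comp _ _ (φ.hud k) (ψ.hud k),
    by rw [Category.assoc, ψ.comm_l, φ.comm_l],
    fun k => by rw [Category.assoc, ψ.comm_arrc, ← Category.assoc, φ.comm_arrc,
      Category.assoc],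
    by rw [Category.assoc, ψ.comm_mid, ← Category.assoc, φ.comm_mid, Category.assoc],
    fun k => by rw [Category.assoc, ψ.comm_arrd, ← Category.assoc, φ.comm_arrd,
      Category.assoc],
    by rw [← Category.assoc, φ.comm_r, ψ.comm_r]⟩
  id_comp _ := by apply ZigZag'Hom.ext <;> (funext k; simp)
  comp_id _ := by apply ZigZag'Hom.ext <;> (funext k; simp)
  assoc _ _ _ := by apply ZigZag'Hom.ext <;> (funext k; simp)

/-- The identity-insertion functor `Z_{i,j}(R;x,y) ⥤ Z'_{i,j}(R;x,y)`, viewing a zigzag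
`x ⟵ c₀ → ⋯ → c_{i+j} ⟵ y` as a zigzag of the second kind by inserting the identity
of `c_i` as the middle backwards map. -/
def insertFunctor (ρ : RelCatStruct R) (x y : R) (i j : ℕ) :
    ZigZag ρ x y (i + j) ⥤ ZigZag' ρ x y i j where
  obj A :=
    { c := fun k => A.c ⟨k.val, by omega⟩
      d := fun k => A.c ⟨i + k.val, by omega⟩
      l := A.l
      hl := A.hl
      arrc := fun k => A.arr ⟨k.val, by omega⟩
      mid := 𝟙 _
      hmid := ρ.W_id _
      arrd := fun k => A.arr ⟨i + k.val, by omega⟩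
      r := A.r
      hr := A.hr }
  map {A B} φ :=
    { uc := fun k => φ.u ⟨k.val, by omega⟩
      ud := fun k => φ.u ⟨i + k.val, by omega⟩
      huc := fun k => φ.hu _
      hud := fun k => φ.hu _
      comm_l := φ.comm_l
      comm_arrc := fun k => φ.comm_arr ⟨k.val, by omega⟩
      comm_mid := (Category.comp_id _).trans (Category.id_comp _).symm
      comm_arrd := fun k => φ.comm_arr ⟨i + k.val, by omega⟩
      comm_r := φ.comm_r }
  map_id _ := rfl
  map_comp _ _ := rfl

section Collage

variable {C : Type u} {D : Type u} [Category.{v} C] [Category.{v} D]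

/-- The objects of the collage of an adjunction `F ⊣ G` relative to predicates `PC`, `PD`:
the objects of `C` satisfying `PC` together with the objects of `D` satisfying `PD`. -/
def Collage (_ : D ⥤ C) (PC : C → Prop) (PD : D → Prop) : Type u :=
  {x : C // PC x} ⊕ {y : D // PD y}

/-- Hom-sets of the collage: morphisms of `C` on the left, morphisms of `D` on the right,
bridge morphisms `hom(x,y) = hom_C(x, G(y))` from left to right, and no morphisms from
right to left. -/
def CollageHom (G : D ⥤ C) (PC : C → Prop) (PD : D → Prop) :
    Collage G PC PD → Collage G PC PD → Type v
  | Sum.inl x, Sum.inl x' => x.1 ⟶ x'.1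
  | Sum.inl x, Sum.inr y => x.1 ⟶ G.obj y.1
  | Sum.inr y, Sum.inr y' => y.1 ⟶ y'.1
  | Sum.inr _, Sum.inl _ => PEmpty.{v + 1}

instance {G : D ⥤ C} {PC : C → Prop} {PD : D → Prop} : Category (Collage G PC PD) where
  Hom := CollageHom G PC PD
  id a := match a with
    | Sum.inl x => (𝟙 x.1 : x.1 ⟶ x.1)
    | Sum.inr y => (𝟙 y.1 : y.1 ⟶ y.1)
  comp {a b c} f g := match a, b, c, f, g with
    | Sum.inl _, Sum.inl _, Sum.inl _, f, g => f ≫ g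
    | Sum.inl _, Sum.inl _, Sum.inr _, f, g => f ≫ g
    | Sum.inl _, Sum.inr _, Sum.inr _, f, g => f ≫ G.map g
    | Sum.inr _, Sum.inr _, Sum.inr _, f, g => f ≫ g
    | Sum.inl _, Sum.inr _, Sum.inl _, _, g => g.elim
    | Sum.inr _, Sum.inl _, _, f, _ => f.elim
    | Sum.inr _, Sum.inr _, Sum.inl _, _, g => g.elim
  id_comp {a b} f := by
    rcases a with x|y <;> rcases b with x'|y' <;> first | exact f.elim | exact Category.id_comp _
  comp_id {a b} f := by
    rcases a with x|y <;> rcases b with x'|y' <;>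
      first
        | exact f.elim | exact Category.comp_id _
        | exact (congrArg (CategoryStruct.comp _) (G.map_id _)).trans (Category.comp_id _)
  assoc {a b c d} f g h := by
    rcases a with xa|ya <;> rcases b with xb|yb <;> rcases c with xc|yc <;>
      rcases d with xd|yd <;>
      first
        | exact f.elim | exact g.elim | exact h.elim
        | exact Category.assoc _ _ _
        | exact (Category.assoc _ _ _).trans
            (congrArg (CategoryStruct.comp _) (G.map_comp _ _).symm)

/-- The weak equivalences of the collage: those of the two fibers; no bridge morphism is
a weak equivalence. -/
def collW (G : D ⥤ C) (PC : C → Prop) (PD : D → Prop)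
    (WC : MorphismProperty C) (WD : MorphismProperty D) :
    MorphismProperty (Collage G PC PD) := fun a b f =>
  match a, b, f with
  | Sum.inl _, Sum.inl _, f => WC f
  | Sum.inr _, Sum.inr _, f => WD f
  | Sum.inl _, Sum.inr _, _ => False
  | Sum.inr _, Sum.inl _, _ => False

/-- The collage of a Quillen adjunction as a relative category. -/
def collageRel {MC : ModelStructure C} {MD : ModelStructure D}
    (Q : QuillenAdjunction MC MD) (PC : C → Prop) (PD : D → Prop) :
    RelCatStruct (Collage Q.G PC PD) where
  W := collW Q.G PC PD MC.W MD.W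
  W_id X := by
    rcases X with x|y
    · exact MC.W_id x.1
    · exact MD.W_id y.1
  W_comp {X Y Z} f g hf hg := by
    rcases X with x|y <;> rcases Y with x'|y' <;> rcases Z with x''|y'' <;>
      first
        | exact f.elim | exact g.elim | exact hf.elim | exact hg.elim
        | exact MC.W_comp f g hf hg
        | exact MD.W_comp f g hf hg

end Collage

section Simplicial

open Simplicial MonoidalCategory HomotopicalAlgebra SSet.modelCategoryQuillen

/-- The inclusion of an end of the cylinder `X ⊗ Δ[1]`. -/
noncomputable def cyl (X : SSet.{w}) (e : Fin 2) : X ⟶ X ⊗ Δ[1] :=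
  CartesianMonoidalCategory.lift (𝟙 X) (constVertex X e)

lemma cyl_naturality {X Y : SSet.{w}} (f : X ⟶ Y) (e : Fin 2) :
    cyl X e ≫ f ▷ Δ[1] = f ≫ cyl Y e := rfl

lemma sHomotopy_iff {X Y : SSet.{w}} {f g : X ⟶ Y} :
    SHomotopy f g ↔ ∃ H : X ⊗ Δ[1] ⟶ Y, cyl X 0 ≫ H = f ∧ cyl X 1 ≫ H = g := by
  constructor
  · rintro ⟨H, h0, h1⟩
    have key : ∀ e, cyl X e ≫ prod.lift (CartesianMonoidalCategory.fst X Δ[1])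
        (CartesianMonoidalCategory.snd X Δ[1]) = prod.lift (𝟙 X) (constVertex X e) := by
      intro e
      apply Limits.prod.hom_ext
      · rw [Category.assoc, prod.lift_fst, prod.lift_fst]; rfl
      · rw [Category.assoc, prod.lift_snd, prod.lift_snd]; rfl
    refine ⟨prod.lift (CartesianMonoidalCategory.fst X Δ[1])
        (CartesianMonoidalCategory.snd X Δ[1]) ≫ H, ?_, ?_⟩
    · rw [← Category.assoc, key, h0]
    · rw [← Category.assoc, key, h1]
  · rintro ⟨H, h0, h1⟩
    have key : ∀ e, prod.lift (𝟙 X) (constVertex X e) ≫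
        CartesianMonoidalCategory.lift (prod.fst : X ⨯ Δ[1] ⟶ X) prod.snd = cyl X e := by
      intro e
      apply CartesianMonoidalCategory.hom_ext
      · rw [Category.assoc, CartesianMonoidalCategory.lift_fst, prod.lift_fst]; rfl
      · rw [Category.assoc, CartesianMonoidalCategory.lift_snd, prod.lift_snd]; rfl
    refine ⟨CartesianMonoidalCategory.lift prod.fst prod.snd ≫ H, ?_, ?_⟩
    · rw [← Category.assoc, key, h0]
    · rw [← Category.assoc, key, h1]

lemma KanComplex.isFibrant {K : SSet.{w}} (hK : KanComplex K) : SSet.KanComplex K := by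
  refine (HomotopicalAlgebra.isFibrant_iff K).2 ?_
  rw [SSet.modelCategoryQuillen.fibration_iff]
  intro _ _ _ hf
  simp only [SSet.modelCategoryQuillen.J, MorphismProperty.iSup_iff] at hf
  obtain ⟨n, ⟨i⟩⟩ := hf
  refine ⟨fun {t _} _ ↦ ?_⟩
  obtain ⟨φ, hφ⟩ := hK.hornFilling t
  exact ⟨⟨{ l := φ, fac_left := hφ.symm, fac_right := by subsingleton }⟩⟩

/-- Solving a lifting problem against a pushout-product. -/
lemma exists_lift_pushoutProduct {B C S T E X : SSet.{w}} (k : B ⟶ C) (j : S ⟶ T) (p : E ⟶ X)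
    [Fibration p] [Mono k] [Mono j]
    (h : SSet.anodyneExtensions k ∨ SSet.anodyneExtensions j)
    (H : B ⊗ T ⟶ E) (f : C ⊗ S ⟶ E) (K : C ⊗ T ⟶ X)
    (h₁ : B ◁ j ≫ H = k ▷ S ≫ f) (h₂ : k ▷ T ≫ K = H ≫ p) (h₃ : C ◁ j ≫ K = f ≫ p) :
    ∃ L : C ⊗ T ⟶ E, k ▷ T ≫ L = H ∧ C ◁ j ≫ L = f ∧ L ≫ p = K := by
  let sq := Functor.PushoutObjObj.ofHasPushout (curriedTensor SSet.{w}) k j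
  have ha : SSet.anodyneExtensions sq.ι := by
    rcases h with h | h
    · exact SSet.anodyneExtensions_pushoutObjObjι' sq h
    · exact SSet.anodyneExtensions_pushoutObjObjι sq h
  have hl : HasLiftingProperty sq.ι p := ha _ (by rwa [← HomotopicalAlgebra.fibration_iff])
  let t : sq.pt ⟶ E := sq.isPushout.desc f H h₁.symm
  have ht₁ : sq.inl ≫ t = f := sq.isPushout.inl_desc _ _ _
  have ht₂ : sq.inr ≫ t = H := sq.isPushout.inr_desc _ _ _
  have hsq : CommSq t sq.ι p K := ⟨by
    apply sq.hom_ext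
    · rw [← Category.assoc, ht₁, sq.inl_ι_assoc]; exact h₃.symm
    · rw [← Category.assoc, ht₂, sq.inr_ι_assoc]; exact h₂.symm⟩
  refine ⟨hsq.lift, ?_, ?_, hsq.fac_right⟩
  · refine Eq.trans ?_ ht₂
    have := congrArg (sq.inr ≫ ·) hsq.fac_left
    refine Eq.trans ?_ this
    exact (sq.inr_ι_assoc hsq.lift).symm
  · refine Eq.trans ?_ ht₁
    have := congrArg (sq.inl ≫ ·) hsq.fac_left
    refine Eq.trans ?_ this
    exact (sq.inl_ι_assoc hsq.lift).symm

lemma horn_one_eq (e : Fin 2) {n : SimplexCategoryᵒᵖ} (s : (Λ[1, e] : SSet.{w}).obj n) :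
    s.1 = (constVertex (Λ[1, e] : SSet.{w}) e).app n s := by
  have h := s.2
  rw [SSet.mem_horn_iff] at h
  apply ULift.ext
  apply SimplexCategory.Hom.ext
  ext a : 2
  by_contra hc
  apply h
  rw [Set.eq_univ_iff_forall]
  intro b
  by_cases hb : b = e
  · exact Or.inr hb
  · refine Or.inl ⟨a, ?_⟩
    have h1 : (SSet.stdSimplex.asOrderHom s.1) a ≠ e := hc
    omega

lemma whiskerLeft_horn_one (B : SSet.{w}) (e : Fin 2) :
    B ◁ (SSet.horn.{w} 1 e).ι =
      CartesianMonoidalCategory.fst B _ ≫ cyl B e := by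
  apply CartesianMonoidalCategory.hom_ext
  · rfl
  · ext n ⟨b, s⟩
    exact horn_one_eq e s

/-- The relative homotopy extension and lifting property. -/
lemma exists_homotopy_lift {B C E X : SSet.{w}} (k : B ⟶ C) [Mono k] (p : E ⟶ X) [Fibration p]
    (e : Fin 2) (H : B ⊗ Δ[1] ⟶ E) (f : C ⟶ E) (K : C ⊗ Δ[1] ⟶ X)
    (h₁ : cyl B e ≫ H = k ≫ f) (h₂ : k ▷ Δ[1] ≫ K = H ≫ p) (h₃ : cyl C e ≫ K = f ≫ p) :
    ∃ L : C ⊗ Δ[1] ⟶ E, k ▷ Δ[1] ≫ L = H ∧ cyl C e ≫ L = f ∧ L ≫ p = K := by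
  obtain ⟨L, hL, hL', hL''⟩ := exists_lift_pushoutProduct k (SSet.horn.{w} 1 e).ι p
    (Or.inr (SSet.anodyneExtensions.horn_ι e)) H (CartesianMonoidalCategory.fst C _ ≫ f) K
    (by rw [whiskerLeft_horn_one, Category.assoc, h₁]; rfl) h₂
    (by rw [whiskerLeft_horn_one, Category.assoc, h₃]; rfl)
  refine ⟨L, hL, ?_, hL''⟩
  rw [whiskerLeft_horn_one, Category.assoc] at hL'
  ext n c
  have hm : (constVertex C e).app n c ∈ (SSet.horn.{w} 1 e).obj n := by
    rw [SSet.mem_horn_iff]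
    intro h
    have := Set.eq_univ_iff_forall.1 h (1 - e)
    rcases this with ⟨a, ha⟩ | ha
    · have h2 : e = 1 - e := ha
      omega
    · have h2 : 1 - e = e := ha
      omega
  exact ConcreteCategory.congr_hom (NatTrans.congr_app hL' n)
    (show (C ⊗ (SSet.horn.{w} 1 e : SSet.{w})).obj n from (c, ⟨_, hm⟩))

/-- Two lifts which agree on an anodyne subobject are homotopic relative to it,
over the base. -/
lemma exists_homotopy_of_anodyne {B C E X : SSet.{w}} (k : B ⟶ C) [Mono k]
    (hk : SSet.anodyneExtensions k) (p : E ⟶ X) [Fibration p]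
    (H : B ⊗ Δ[1] ⟶ E) (f : Fin 2 → (C ⟶ E)) (K : C ⊗ Δ[1] ⟶ X)
    (h₁ : ∀ e, cyl B e ≫ H = k ≫ f e) (h₂ : k ▷ Δ[1] ≫ K = H ≫ p)
    (h₃ : ∀ e, cyl C e ≫ K = f e ≫ p) :
    ∃ L : C ⊗ Δ[1] ⟶ E, k ▷ Δ[1] ≫ L = H ∧ (∀ e, cyl C e ≫ L = f e) ∧ L ≫ p = K := by
  let S : SSet.{w} := (Functor.const _).obj (ULift.{w} (Fin 2))
  let j : S ⟶ Δ[1] :=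
    { app n := ↾fun t => ULift.up (SimplexCategory.const n.unop ⦋1⦌ t.down)
      naturality _ _ _ := rfl }
  have hj : Mono j := by
    rw [NatTrans.mono_iff_mono_app]
    intro n
    rw [mono_iff_injective]
    intro a b hab
    have h2 := congrArg (fun z : (Δ[1] : SSet.{w}).obj n =>
      (SimplexCategory.Hom.toOrderHom z.down) 0) hab
    exact ULift.ext _ _ h2
  let f' : C ⊗ S ⟶ E :=
    { app n := ↾fun z => (f z.2.down).app n z.1
      naturality a b g := by
        ext ⟨c, t⟩
        exact ConcreteCategory.congr_hom ((f t.down).naturality g) c }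
  obtain ⟨L, hL, hL', hL''⟩ := exists_lift_pushoutProduct k j p (Or.inl hk) H f' K
    (by
      ext n ⟨b, t⟩
      exact ConcreteCategory.congr_hom (NatTrans.congr_app (h₁ t.down) n) b) h₂
    (by
      ext n ⟨b, t⟩
      exact ConcreteCategory.congr_hom (NatTrans.congr_app (h₃ t.down) n) b)
  refine ⟨L, hL, fun e => ?_, hL''⟩
  ext n c
  exact ConcreteCategory.congr_hom (NatTrans.congr_app hL' n)
    (show (C ⊗ S).obj n from (c, ULift.up e))

lemma anodyne_iff {A B : SSet.{w}} {f : A ⟶ B} : SSet.anodyneExtensions f ↔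
    ∀ ⦃E X : SSet.{w}⦄ (p : E ⟶ X), Fibration p → ∀ (a : A ⟶ E) (b : B ⟶ X),
      a ≫ p = f ≫ b → ∃ l : B ⟶ E, f ≫ l = a ∧ l ≫ p = b := by
  constructor
  · intro h E X p hp a b hab
    have : HasLiftingProperty f p := h _ (by rwa [← HomotopicalAlgebra.fibration_iff])
    have sq : CommSq a f p b := ⟨hab⟩
    exact ⟨sq.lift, sq.fac_left, sq.fac_right⟩
  · intro h E X p hp
    rw [← HomotopicalAlgebra.fibration_iff] at hp
    refine ⟨fun {a b} sq => ?_⟩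
    obtain ⟨l, h1, h2⟩ := h p hp a b sq.w
    exact ⟨⟨⟨l, h1, h2⟩⟩⟩

lemma cyl_fst_comp {X Y : SSet.{w}} (f : X ⟶ Y) (e : Fin 2) :
    cyl X e ≫ CartesianMonoidalCategory.fst X Δ[1] ≫ f = f := rfl

/-- Right cancellation for anodyne extensions. -/
lemma anodyne_of_comp {A B C : SSet.{w}} (j : A ⟶ B) (k : B ⟶ C) [Mono j] [Mono k]
    (hj : SSet.anodyneExtensions j) (hjk : SSet.anodyneExtensions (j ≫ k)) :
    SSet.anodyneExtensions k := by
  rw [anodyne_iff]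
  intro E X p hp b c hbc
  obtain ⟨f, hf, hf'⟩ := anodyne_iff.1 hjk p hp (j ≫ b) c (by rw [Category.assoc, hbc]; simp)
  obtain ⟨H, -, hH, hHp⟩ := exists_homotopy_of_anodyne j hj p
    (CartesianMonoidalCategory.fst A Δ[1] ≫ j ≫ b) ![k ≫ f, b]
    (CartesianMonoidalCategory.fst B Δ[1] ≫ b ≫ p)
    (by
      intro e
      rw [cyl_fst_comp]
      fin_cases e
      · simpa using hf.symm
      · rfl)
    rfl
    (by
      intro e
      rw [cyl_fst_comp]
      fin_cases e
      · simp [hbc, hf']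
      · rfl)
  obtain ⟨L, hL, -, hLp⟩ := exists_homotopy_lift k p 0 H f
    (CartesianMonoidalCategory.fst C Δ[1] ≫ c)
    (hH 0) (by rw [hHp, hbc]; rfl) (by rw [cyl_fst_comp, hf'])
  refine ⟨cyl C 1 ≫ L, ?_, ?_⟩
  · rw [← Category.assoc, ← cyl_naturality, Category.assoc, hL]
    exact hH 1
  · rw [Category.assoc, hLp, cyl_fst_comp]

/-- A pair of compatible endomorphisms along which lifting problems against fibrations can be
solved. -/
def LiftableAlong {A C : SSet.{w}} (k : A ⟶ C) (a : A ⟶ A) (c : C ⟶ C) : Prop :=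
  ∀ ⦃E X : SSet.{w}⦄ (p : E ⟶ X), Fibration p → ∀ (φ : A ⟶ E) (ψ : C ⟶ X),
    φ ≫ p = k ≫ ψ → ∃ l : C ⟶ E, k ≫ l = a ≫ φ ∧ l ≫ p = c ≫ ψ

lemma LiftableAlong.of_homotopy {A C : SSet.{w}} (k : A ⟶ C) [Mono k]
    (HA : A ⊗ Δ[1] ⟶ A) (HC : C ⊗ Δ[1] ⟶ C) (hk : k ▷ Δ[1] ≫ HC = HA ≫ k) (e e' : Fin 2)
    (h : LiftableAlong k (cyl A e ≫ HA) (cyl C e ≫ HC)) :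
    LiftableAlong k (cyl A e' ≫ HA) (cyl C e' ≫ HC) := by
  intro E X p hp φ ψ hφ
  obtain ⟨l, hl, hl'⟩ := h p hp φ ψ hφ
  obtain ⟨L, hL, -, hLp⟩ := exists_homotopy_lift k p e (HA ≫ φ) l (HC ≫ ψ)
    (by rw [hl, Category.assoc])
    (by rw [← Category.assoc, hk, Category.assoc, Category.assoc, hφ])
    (by rw [hl', Category.assoc])
  refine ⟨cyl C e' ≫ L, ?_, ?_⟩
  · rw [← Category.assoc, ← cyl_naturality, Category.assoc, hL, Category.assoc]
  · rw [Category.assoc, hLp, Category.assoc]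

lemma LiftableAlong.of_const {A C : SSet.{w}} (k : A ⟶ C) {a : A ⟶ A} {c : C ⟶ C} (s : C ⟶ A)
    (ha : a = k ≫ s) (hc : c = s ≫ k) : LiftableAlong k a c := by
  intro E X p _ φ ψ hφ
  exact ⟨s ≫ φ, by rw [ha, Category.assoc], by rw [hc, Category.assoc, hφ, Category.assoc]⟩

lemma LiftableAlong.anodyne {A C : SSet.{w}} {k : A ⟶ C} (h : LiftableAlong k (𝟙 A) (𝟙 C)) :
    SSet.anodyneExtensions k := by
  rw [anodyne_iff]
  intro E X p hp a b hab
  simpa using h p hp a b hab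

end Simplicial

section Homotopy

open Simplicial MonoidalCategory HomotopicalAlgebra SSet.modelCategoryQuillen

lemma Htpy.refl {X Y : SSet.{w}} (f : X ⟶ Y) : Htpy f f := Relation.EqvGen.refl f

lemma Htpy.symm {X Y : SSet.{w}} {f g : X ⟶ Y} (h : Htpy f g) : Htpy g f :=
  Relation.EqvGen.symm _ _ h

lemma Htpy.trans {X Y : SSet.{w}} {f g h : X ⟶ Y} (h₁ : Htpy f g) (h₂ : Htpy g h) : Htpy f h :=
  Relation.EqvGen.trans _ _ _ h₁ h₂

lemma SHomotopy.htpy {X Y : SSet.{w}} {f g : X ⟶ Y} (h : SHomotopy f g) : Htpy f g :=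
  Relation.EqvGen.rel _ _ h

lemma Htpy.comp_left {X Y Z : SSet.{w}} {f g : Y ⟶ Z} (k : X ⟶ Y) (h : Htpy f g) :
    Htpy (k ≫ f) (k ≫ g) := by
  induction h with
  | rel f g h =>
    obtain ⟨H, rfl, rfl⟩ := sHomotopy_iff.1 h
    exact (sHomotopy_iff.2 ⟨k ▷ Δ[1] ≫ H, rfl, rfl⟩).htpy
  | refl f => exact Htpy.refl _
  | symm f g _ ih => exact ih.symm
  | trans f g h _ _ ih₁ ih₂ => exact ih₁.trans ih₂

lemma Htpy.comp_right {X Y Z : SSet.{w}} {f g : X ⟶ Y} (h : Htpy f g) (k : Y ⟶ Z) :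
    Htpy (f ≫ k) (g ≫ k) := by
  induction h with
  | rel f g h =>
    obtain ⟨H, rfl, rfl⟩ := sHomotopy_iff.1 h
    exact (sHomotopy_iff.2 ⟨H ≫ k, rfl, rfl⟩).htpy
  | refl f => exact Htpy.refl _
  | symm f g _ ih => exact ih.symm
  | trans f g h _ _ ih₁ ih₂ => exact ih₁.trans ih₂

/-- The inclusion of both ends of the cylinder. -/
noncomputable def twoEnds (X : SSet.{w}) :
    X ⊗ ((Functor.const _).obj (ULift.{w} (Fin 2)) : SSet.{w}) ⟶ X ⊗ Δ[1] where
  app n := ↾fun z => (z.1, ULift.up (SimplexCategory.const n.unop ⦋1⦌ z.2.down))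
  naturality _ _ _ := rfl

instance (X : SSet.{w}) : Mono (twoEnds X) := by
  rw [NatTrans.mono_iff_mono_app]
  intro n
  rw [mono_iff_injective]
  rintro ⟨a, s⟩ ⟨b, t⟩ hab
  have h1 : a = b := congrArg (fun z : (X ⊗ Δ[1] : SSet.{w}).obj n => z.1) hab
  have h2 := congrArg (fun z : (X ⊗ Δ[1] : SSet.{w}).obj n =>
    (SimplexCategory.Hom.toOrderHom z.2.down) 0) hab
  exact Prod.ext h1 (ULift.ext _ _ h2)

lemma SHomotopy.euclidean {X K : SSet.{w}} (hK : KanComplex K) {f g h : X ⟶ K}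
    (h₁ : SHomotopy f g) (h₂ : SHomotopy f h) : SHomotopy g h := by
  have := hK.isFibrant
  obtain ⟨H₁, e₁, e₁'⟩ := sHomotopy_iff.1 h₁
  obtain ⟨H₂, e₂, e₂'⟩ := sHomotopy_iff.1 h₂
  let S : SSet.{w} := (Functor.const _).obj (ULift.{w} (Fin 2))
  let HH : Fin 2 → (X ⊗ Δ[1] ⟶ K) := ![H₁, H₂]
  let H : (X ⊗ S) ⊗ Δ[1] ⟶ K :=
    { app n := ↾fun z => (HH z.1.2.down).app n (z.1.1, z.2)
      naturality a b q := by
        ext ⟨⟨c, t⟩, s⟩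
        exact ConcreteCategory.congr_hom ((HH t.down).naturality q)
          (show (X ⊗ Δ[1]).obj a from (c, s)) }
  obtain ⟨L, hL, -, -⟩ := exists_homotopy_lift (twoEnds X) (terminal.from K) 0 H
    (CartesianMonoidalCategory.fst X Δ[1] ≫ f) (terminal.from _)
    (by
      ext n ⟨c, ⟨t⟩⟩
      fin_cases t
      · exact ConcreteCategory.congr_hom (NatTrans.congr_app e₁ n) c
      · exact ConcreteCategory.congr_hom (NatTrans.congr_app e₂ n) c)
    (by subsingleton) (by subsingleton)
  refine sHomotopy_iff.2 ⟨cyl _ 1 ≫ L, ?_, ?_⟩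
  · ext n c
    exact (ConcreteCategory.congr_hom (NatTrans.congr_app hL n)
      (show ((X ⊗ S) ⊗ Δ[1]).obj n from ((c, ⟨0⟩), (constVertex X 1).app n c))).trans
      (ConcreteCategory.congr_hom (NatTrans.congr_app e₁' n) c)
  · ext n c
    exact (ConcreteCategory.congr_hom (NatTrans.congr_app hL n)
      (show ((X ⊗ S) ⊗ Δ[1]).obj n from ((c, ⟨1⟩), (constVertex X 1).app n c))).trans
      (ConcreteCategory.congr_hom (NatTrans.congr_app e₂' n) c)

lemma SHomotopy.refl {X Y : SSet.{w}} (f : X ⟶ Y) : SHomotopy f f :=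
  sHomotopy_iff.2 ⟨CartesianMonoidalCategory.fst X Δ[1] ≫ f, rfl, rfl⟩

lemma Htpy.sHomotopy {X K : SSet.{w}} (hK : KanComplex K) {f g : X ⟶ K} (h : Htpy f g) :
    SHomotopy f g := by
  induction h with
  | rel f g h => exact h
  | refl f => exact SHomotopy.refl f
  | symm f g _ ih => exact ih.euclidean hK (SHomotopy.refl f)
  | trans f g h _ _ ih₁ ih₂ => exact (ih₁.euclidean hK (SHomotopy.refl f)).euclidean hK ih₂

/-- Homotopy classes of maps. -/
def HtpyClass (X K : SSet.{w}) : Type w := Quot (Htpy (X := X) (Y := K))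

/-- Precomposition on homotopy classes of maps. -/
def HtpyClass.pre {X Y : SSet.{w}} (f : X ⟶ Y) (K : SSet.{w}) : HtpyClass Y K → HtpyClass X K :=
  Quot.map (fun h => f ≫ h) fun _ _ h => h.comp_left f

lemma htpyClass_mk_eq_iff {X K : SSet.{w}} {f g : X ⟶ K} :
    (Quot.mk _ f : HtpyClass X K) = Quot.mk _ g ↔ Htpy f g :=
  ⟨fun h => (Equivalence.eqvGen_iff ⟨Htpy.refl, Htpy.symm, Htpy.trans⟩).1
    (Quot.eqvGen_exact h), Quot.sound⟩

lemma isWeakHomotopyEquiv_iff {X Y : SSet.{w}} {f : X ⟶ Y} :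
    IsWeakHomotopyEquiv f ↔
      ∀ K : SSet.{w}, KanComplex K → Function.Bijective (HtpyClass.pre f K) := by
  refine forall₂_congr fun K _ => ?_
  rw [Function.Bijective, and_comm]
  refine and_congr ⟨?_, ?_⟩ ⟨?_, ?_⟩
  · rintro h ⟨a⟩ ⟨b⟩ hab
    exact Quot.sound (h a b (htpyClass_mk_eq_iff.1 hab))
  · intro h a b hab
    exact htpyClass_mk_eq_iff.1 (@h (Quot.mk _ a) (Quot.mk _ b) (Quot.sound hab))
  · rintro h ⟨g⟩
    obtain ⟨k, hk⟩ := h g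
    exact ⟨Quot.mk _ k, Quot.sound hk⟩
  · intro h g
    obtain ⟨⟨k⟩, hk⟩ := h (Quot.mk _ g)
    exact ⟨k, htpyClass_mk_eq_iff.1 hk⟩

lemma HtpyClass.pre_comp {X Y Z : SSet.{w}} (f : X ⟶ Y) (g : Y ⟶ Z) (K : SSet.{w}) :
    HtpyClass.pre (f ≫ g) K = HtpyClass.pre f K ∘ HtpyClass.pre g K := by
  funext x
  induction x using Quot.ind
  exact congrArg (Quot.mk _) (Category.assoc f g _)

lemma HtpyClass.pre_congr {X Y : SSet.{w}} {f g : X ⟶ Y} (h : Htpy f g) (K : SSet.{w}) :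
    HtpyClass.pre f K = HtpyClass.pre g K := by
  funext x
  induction x using Quot.ind with | mk k => ?_
  exact Quot.sound (h.comp_right k)

namespace IsWeakHomotopyEquiv

variable {X Y Z T : SSet.{w}} {f : X ⟶ Y} {g : Y ⟶ Z} {h : Z ⟶ T}

lemma congr {f' : X ⟶ Y} (hf : IsWeakHomotopyEquiv f) (hff' : Htpy f f') :
    IsWeakHomotopyEquiv f' := by
  rw [isWeakHomotopyEquiv_iff] at hf ⊢
  intro K hK
  rw [← HtpyClass.pre_congr hff']
  exact hf K hK

lemma comp (hf : IsWeakHomotopyEquiv f) (hg : IsWeakHomotopyEquiv g) :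
    IsWeakHomotopyEquiv (f ≫ g) := by
  rw [isWeakHomotopyEquiv_iff] at *
  intro K hK
  rw [HtpyClass.pre_comp]
  exact (hf K hK).comp (hg K hK)

lemma of_precomp (hf : IsWeakHomotopyEquiv f) (hfg : IsWeakHomotopyEquiv (f ≫ g)) :
    IsWeakHomotopyEquiv g := by
  rw [isWeakHomotopyEquiv_iff] at *
  intro K hK
  have h1 := hfg K hK
  rw [HtpyClass.pre_comp] at h1
  exact (Function.Bijective.of_comp_iff' (hf K hK) _).1 h1

lemma of_postcomp (hg : IsWeakHomotopyEquiv g) (hfg : IsWeakHomotopyEquiv (f ≫ g)) :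
    IsWeakHomotopyEquiv f := by
  rw [isWeakHomotopyEquiv_iff] at *
  intro K hK
  have h1 := hfg K hK
  rw [HtpyClass.pre_comp] at h1
  exact (Function.Bijective.of_comp_iff _ (hg K hK)).1 h1

lemma two_of_six (hfg : IsWeakHomotopyEquiv (f ≫ g)) (hgh : IsWeakHomotopyEquiv (g ≫ h)) :
    IsWeakHomotopyEquiv h := by
  refine of_precomp (f := g) ?_ hgh
  rw [isWeakHomotopyEquiv_iff] at *
  intro K hK
  have h1 := hfg K hK
  have h2 := hgh K hK
  rw [HtpyClass.pre_comp] at h1 h2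
  exact ⟨h1.1.of_comp, h2.2.of_comp⟩

end IsWeakHomotopyEquiv

variable {A B : Type u} [Category.{v} A] [Category.{v} B]

/-- The map out of a cylinder on a nerve induced by a functor out of `Fin 2 × A`. -/
def nerveCyl (Φ : Fin 2 × A ⥤ B) : nerve A ⊗ Δ[1] ⟶ nerve B where
  app _ := ↾fun z =>
    ((SimplexCategory.Hom.toOrderHom z.2.down).monotone.functor.prod' z.1) ⋙ Φ
  naturality _ _ _ := rfl

/-- The functor out of `Fin 2 × A` induced by a natural transformation. -/
def cylFunctor {F G : A ⥤ B} (α : F ⟶ G) : Fin 2 × A ⥤ B :=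
  Functor.uncurry.obj (ComposableArrows.mk₁ α)

lemma cyl_zero_nerveCyl {F G : A ⥤ B} (α : F ⟶ G) :
    cyl (nerve A) 0 ≫ nerveCyl (cylFunctor α) = nerveMap F := by
  ext n x
  refine CategoryTheory.Functor.ext (fun _ => rfl) fun i j f => ?_
  exact (Category.id_comp _).trans ((Category.id_comp _).trans (Category.comp_id _)).symm

lemma cyl_one_nerveCyl {F G : A ⥤ B} (α : F ⟶ G) :
    cyl (nerve A) 1 ≫ nerveCyl (cylFunctor α) = nerveMap G := by
  ext n x
  refine CategoryTheory.Functor.ext (fun _ => rfl) fun i j f => ?_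
  exact (Category.id_comp _).trans ((Category.id_comp _).trans (Category.comp_id _)).symm

lemma htpy_of_natTrans {F G : A ⥤ B} (α : F ⟶ G) : Htpy (nerveMap F) (nerveMap G) :=
  (sHomotopy_iff.2 ⟨_, cyl_zero_nerveCyl α, cyl_one_nerveCyl α⟩).htpy

end Homotopy

section Strings

universe w' a b a' b' a'' b'' w''

/-- Strings of composable morphisms of a category. -/
structure Str (A : Type a) [Category.{b} A] : Type (max a b w) where
  /-- the length of the string -/
  n : ℕ
  /-- the string -/
  fn : Fin (n + 1) ⥤ A

namespace Str

variable {A : Type a} [Category.{b} A]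

/-- Morphisms of strings are injective face inclusions. -/
@[ext]
structure Hom (σ : Str.{w} A) (τ : Str.{w} A) : Type w where
  /-- the order embedding underlying a face inclusion -/
  emb : Fin (σ.n + 1) ↪o Fin (τ.n + 1)
  fac : σ.fn = emb.monotone.functor ⋙ τ.fn

instance : Category.{w} (Str.{w} A) where
  Hom σ τ := Hom.{w} σ τ
  id σ := ⟨RelEmbedding.refl _, rfl⟩
  comp f g := ⟨f.emb.trans g.emb, by rw [f.fac, g.fac]; rfl⟩

@[ext]
lemma hom_ext {σ τ : Str.{w} A} {f g : σ ⟶ τ} (h : Hom.emb f = Hom.emb g) : f = g :=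
  Hom.ext h

/-- The comparison of last vertices along a face inclusion. -/
def Hom.last {σ τ : Str.{w} A} (f : Hom σ τ) :
    σ.fn.obj (Fin.last _) ⟶ τ.fn.obj (Fin.last _) :=
  (eqToHom f.fac).app _ ≫ τ.fn.map (homOfLE (Fin.le_last _))

lemma last_comp {l m n : ℕ} {σ : Fin (l + 1) ⥤ A} {τ : Fin (m + 1) ⥤ A} {υ : Fin (n + 1) ⥤ A}
    (f : Fin (l + 1) ↪o Fin (m + 1)) (g : Fin (m + 1) ↪o Fin (n + 1))
    (hf : σ = f.monotone.functor ⋙ τ) (hg : τ = g.monotone.functor ⋙ υ) :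
    (eqToHom (hf.trans (congrArg (f.monotone.functor ⋙ ·) hg))).app _ ≫
        υ.map (homOfLE (Fin.le_last (g (f (Fin.last l))))) =
      ((eqToHom hf).app (Fin.last l) ≫ τ.map (homOfLE (Fin.le_last (f (Fin.last l))))) ≫
        (eqToHom hg).app (Fin.last m) ≫ υ.map (homOfLE (Fin.le_last (g (Fin.last m)))) := by
  subst hf hg
  refine (Category.id_comp _).trans ?_
  refine Eq.trans ?_ (congrArg₂ (· ≫ ·) (Category.id_comp _).symm (Category.id_comp _).symm)
  exact υ.map_comp (homOfLE (g.monotone (Fin.le_last _))) (homOfLE (Fin.le_last _))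

/-- The last vertex functor. -/
def lv (A : Type a) [Category.{b} A] : Str.{w} A ⥤ A where
  obj σ := σ.fn.obj (Fin.last _)
  map f := Hom.last f
  map_id σ := (Category.id_comp _).trans (σ.fn.map_id _)
  map_comp f g := last_comp (Hom.emb f) (Hom.emb g) (Hom.fac f) (Hom.fac g)

/-- Strings are functorial. -/
@[simps]
def map {B : Type a'} [Category.{b'} B] (F : A ⥤ B) : Str.{w} A ⥤ Str.{w'} B where
  obj σ := ⟨σ.n, σ.fn ⋙ F⟩
  map {σ τ} f := ⟨Hom.emb (σ := σ) (τ := τ) f, congrArg (· ⋙ F) (Hom.fac f)⟩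

end Str

/-- The collage of a poset and its category of strings, along the last vertex. -/
inductive Cyl (P : Type) [PartialOrder P] : Type w where
  | pt (i : P) : Cyl P
  | st (σ : Str.{w} P) : Cyl P

namespace Cyl

variable {P : Type} [PartialOrder P]

/-- Morphisms of `Cyl P`. -/
def Hom : Cyl.{w} P → Cyl.{w} P → Type w
  | pt i, pt j => ULift (PLift (i ≤ j))
  | pt i, st σ => ULift (PLift (i ≤ (Str.lv P).obj σ))
  | st _, pt _ => PEmpty
  | st σ, st τ => σ ⟶ τ

lemma lv_le {σ τ : Str.{w} P} (f : σ ⟶ τ) : (Str.lv P).obj σ ≤ (Str.lv P).obj τ :=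
  leOfHom ((Str.lv P).map f)

instance : Category.{w} (Cyl.{w} P) where
  Hom := Hom
  id
    | pt _ => ⟨⟨le_rfl⟩⟩
    | st σ => 𝟙 σ
  comp {x y z} f g := match x, y, z, f, g with
    | pt _, pt _, pt _, f, g => ⟨⟨f.down.down.trans g.down.down⟩⟩
    | pt _, pt _, st _, f, g => ⟨⟨f.down.down.trans g.down.down⟩⟩
    | pt _, st _, st _, f, g => ⟨⟨f.down.down.trans (lv_le g)⟩⟩
    | st _, st _, st _, f, g => f ≫ g
    | pt _, st _, pt _, _, g => g.elim
    | st _, pt _, _, f, _ => f.elim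
    | st _, st _, pt _, _, g => g.elim
  id_comp {x y} f := by
    rcases x with x | x <;> rcases y with y | y <;>
      first | rfl | exact f.elim
  comp_id {x y} f := by
    rcases x with x | x <;> rcases y with y | y <;>
      first | rfl | exact f.elim
  assoc {x y z t} f g h := by
    rcases x with x | x <;> rcases y with y | y <;> rcases z with z | z <;> rcases t with t | t <;>
      first | rfl | exact f.elim | exact g.elim | exact h.elim

instance (i : P) (x : Cyl.{w} P) : Subsingleton (pt i ⟶ x) := by
  rcases x with j | σ
  · exact inferInstanceAs (Subsingleton (ULift (PLift _)))
  · exact inferInstanceAs (Subsingleton (ULift (PLift _)))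

instance (i : P) (σ : Str.{w} P) : IsEmpty (st σ ⟶ pt i) :=
  inferInstanceAs (IsEmpty PEmpty)

/-- The morphism between points. -/
def ptHom {i j : P} (h : i ≤ j) : (pt i : Cyl.{w} P) ⟶ pt j := ⟨⟨h⟩⟩

/-- The morphism from a point to a string. -/
def ptSt {i : P} {σ : Str.{w} P} (h : i ≤ (Str.lv P).obj σ) : pt i ⟶ st σ := ⟨⟨h⟩⟩

/-- The inclusion of strings. -/
@[simps]
def inc (P : Type) [PartialOrder P] : Str.{w} P ⥤ Cyl.{w} P where
  obj := st
  map f := f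

/-- The inclusion of points. -/
@[simps]
def pts (P : Type) [PartialOrder P] : P ⥤ Cyl.{w} P where
  obj := pt
  map f := ptHom (leOfHom f)

/-- A functor out of `Cyl P`. -/
def desc {D : Type u} [Category.{v} D] (F : P → D) (G : Str.{w} P ⥤ D)
    (hF : ∀ i j, i ≤ j → (F i ⟶ F j)) (h : ∀ i σ, i ≤ (Str.lv P).obj σ → (F i ⟶ G.obj σ))
    (hF_id : ∀ i, hF i i le_rfl = 𝟙 _)
    (hF_comp : ∀ i j k (hij : i ≤ j) (hjk : j ≤ k),
      hF i j hij ≫ hF j k hjk = hF i k (hij.trans hjk))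
    (h_left : ∀ i j σ (hij : i ≤ j) (hj : j ≤ (Str.lv P).obj σ),
      hF i j hij ≫ h j σ hj = h i σ (hij.trans hj))
    (h_right : ∀ i σ τ (hi : i ≤ (Str.lv P).obj σ) (f : σ ⟶ τ),
      h i σ hi ≫ G.map f = h i τ (hi.trans (lv_le f))) : Cyl.{w} P ⥤ D where
  obj
    | pt i => F i
    | st σ => G.obj σ
  map {x y} f := match x, y, f with
    | pt _, pt _, f => hF _ _ f.down.down
    | pt _, st _, f => h _ _ f.down.down
    | st _, st _, f => G.map f
    | st _, pt _, f => f.elim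
  map_id x := by
    rcases x with i | σ
    · exact hF_id i
    · exact G.map_id σ
  map_comp {x y z} f g := by
    rcases x with x | x <;> rcases y with y | y <;> rcases z with z | z <;>
      first
      | exact f.elim | exact g.elim
      | exact (hF_comp _ _ _ f.down.down g.down.down).symm
      | exact (h_left _ _ _ f.down.down g.down.down).symm
      | exact (h_right _ _ _ f.down.down g).symm
      | exact G.map_comp f g

/-- `Cyl` is functorial. -/
def map {P' : Type} [PartialOrder P'] (F : P ⥤ P') : Cyl.{w} P ⥤ Cyl.{w} P' :=
  desc (fun i => pt (F.obj i)) (Str.map.{w, w} F ⋙ inc P')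
    (fun _ _ h => ptHom (leOfHom (F.map (homOfLE h))))
    (fun _ _ h => ptSt (leOfHom (F.map (homOfLE h))))
    (fun _ => Subsingleton.elim _ _) (fun _ _ _ _ _ => Subsingleton.elim _ _)
    (fun _ _ _ _ _ => Subsingleton.elim _ _) (fun _ _ _ _ _ => Subsingleton.elim _ _)

lemma map_id : map (𝟭 P) = 𝟭 (Cyl.{w} P) := by
  refine CategoryTheory.Functor.ext (fun x => ?_) (fun x y f => ?_)
  · rcases x with i | σ <;> rfl
  · rcases x with x | x <;> rcases y with y | y <;>
      first | exact f.elim | exact Subsingleton.elim _ _ |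
        exact ((Category.id_comp _).trans (Category.comp_id _)).symm

lemma map_comp {P' P'' : Type} [PartialOrder P'] [PartialOrder P''] (F : P ⥤ P') (G : P' ⥤ P'') :
    map.{w} (F ⋙ G) = map F ⋙ map G := by
  refine CategoryTheory.Functor.ext (fun x => ?_) (fun x y f => ?_)
  · rcases x with i | σ <;> rfl
  · rcases x with x | x <;> rcases y with y | y <;>
      first | exact f.elim | exact Subsingleton.elim _ _ |
        exact ((Category.id_comp _).trans (Category.comp_id _)).symm

/-- The objects of `Cyl P` supported on a subset. -/
def In (S : Set P) : Cyl.{w} P → Prop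
  | pt i => i ∈ S
  | st σ => ∀ t, σ.fn.obj t ∈ S

/-- The objects of `Cyl P` which are strings. -/
def IsSt : Cyl.{w} P → Prop
  | pt _ => False
  | st _ => True

end Cyl
end Strings

section FullSubcomplexes

open Simplicial MonoidalCategory HomotopicalAlgebra SSet.modelCategoryQuillen

variable {M : Type u} [Category.{v} M]

/-- The subcomplex of the nerve consisting of the chains all of whose objects satisfy `p`. -/
def fullSub (p : M → Prop) : (nerve M).Subcomplex where
  obj n := {s | ∀ i : Fin (n.unop.len + 1), p (CategoryTheory.Functor.obj s i)}
  map _ _ hs _ := hs _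

/-- A natural transformation between endofunctors, as a homotopy restricted to a subcomplex. -/
def resCyl (L : (nerve M).Subcomplex) (Φ : Fin 2 × M ⥤ M)
    (h : ∀ n (s : (nerve M).obj n) (t : (Δ[1] : SSet.{max u v}).obj n), s ∈ L.obj n →
      (nerveCyl Φ).app n (s, t) ∈ L.obj n) : L.toSSet ⊗ Δ[1] ⟶ L.toSSet where
  app n := ↾fun z => ⟨(nerveCyl Φ).app n (z.1.1, z.2), h n _ _ z.1.2⟩
  naturality _ _ _ := rfl

/-- A functor restricted to a subcomplex. -/
def resMap (L L' : (nerve M).Subcomplex) (F : M ⥤ M)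
    (h : ∀ n (s : (nerve M).obj n), s ∈ L.obj n → (nerveMap F).app n s ∈ L'.obj n) :
    L.toSSet ⟶ L'.toSSet where
  app n := ↾fun z => ⟨(nerveMap F).app n z.1, h n _ z.2⟩
  naturality _ _ _ := rfl

lemma cyl_resCyl {L : (nerve M).Subcomplex} {F G : M ⥤ M} (α : F ⟶ G) (h) (e : Fin 2) (h') :
    cyl L.toSSet e ≫ resCyl L (cylFunctor α) h = resMap L L (![F, G] e) h' := by
  ext n z
  apply Subtype.ext
  fin_cases e
  · exact ConcreteCategory.congr_hom (NatTrans.congr_app (cyl_zero_nerveCyl α) n) z.1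
  · exact ConcreteCategory.congr_hom (NatTrans.congr_app (cyl_one_nerveCyl α) n) z.1

/-- The objects of chains in a subcomplex are preserved by a functor. -/
def Pres (F : M ⥤ M) (p : M → Prop) : Prop := ∀ x, p x → p (F.obj x)

variable {ι : Type*}

/-- The union of full subcomplexes. -/
def fullUnion (p : M → Prop) (q : ι → M → Prop) : (nerve M).Subcomplex :=
  fullSub p ⊔ ⨆ i, fullSub (q i)

lemma mem_fullUnion {p : M → Prop} {q : ι → M → Prop} {n} {s : (nerve M).obj n} :
    s ∈ (fullUnion p q).obj n ↔ (∀ i : Fin (n.unop.len + 1), p (CategoryTheory.Functor.obj s i)) ∨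
      ∃ a, ∀ i : Fin (n.unop.len + 1), q a (CategoryTheory.Functor.obj s i) := by
  simp [fullUnion, fullSub]

/-- `fullSub p` as a subcomplex of `fullUnion p q`. -/
abbrev fullIncl (p : M → Prop) (q : ι → M → Prop) :
    (fullSub p).toSSet ⟶ (fullUnion p q).toSSet :=
  SSet.Subcomplex.homOfLE le_sup_left

instance (p : M → Prop) (q : ι → M → Prop) : Mono (fullIncl p q) :=
  SSet.Subcomplex.mono_homOfLE _

lemma Pres.sub {F : M ⥤ M} {p : M → Prop} (h : Pres F p) (n) (s : (nerve M).obj n)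
    (hs : s ∈ (fullSub p).obj n) : (nerveMap F).app n s ∈ (fullSub p).obj n :=
  fun i => h _ (hs i)

lemma Pres.union {F : M ⥤ M} {p : M → Prop} {q : ι → M → Prop} (h : Pres F p)
    (h' : ∀ a, Pres F (q a)) (n) (s : (nerve M).obj n)
    (hs : s ∈ (fullUnion p q).obj n) : (nerveMap F).app n s ∈ (fullUnion p q).obj n := by
  rw [mem_fullUnion] at hs ⊢
  exact hs.imp (fun hs i => h _ (hs i)) fun ⟨a, hs⟩ => ⟨a, fun i => h' a _ (hs i)⟩

lemma cylFunctor_obj {F G : M ⥤ M} (α : F ⟶ G) (x : Fin 2 × M) :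
    (cylFunctor α).obj x = (![F, G] x.1).obj x.2 := by
  obtain ⟨e, x⟩ := x
  fin_cases e <;> rfl

lemma Pres.cyl {F G : M ⥤ M} (α : F ⟶ G) {p : M → Prop} (hF : Pres F p) (hG : Pres G p)
    (x : Fin 2 × M) (hx : p x.2) : p ((cylFunctor α).obj x) := by
  rw [cylFunctor_obj]
  obtain ⟨e, x⟩ := x
  fin_cases e
  · exact hF _ hx
  · exact hG _ hx

lemma LiftableAlong.of_natTrans {F G : M ⥤ M} (α : F ⟶ G) (p : M → Prop) (q : ι → M → Prop)
    (e e' : Fin 2) (hF : Pres F p) (hF' : ∀ a, Pres F (q a)) (hG : Pres G p)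
    (hG' : ∀ a, Pres G (q a)) {X Y : M ⥤ M} (hX : X = ![F, G] e) (hY : Y = ![F, G] e')
    (hXp hXq hYp hYq)
    (h : LiftableAlong (fullIncl p q) (resMap _ _ X hXp) (resMap _ _ X hXq)) :
    LiftableAlong (fullIncl p q) (resMap _ _ Y hYp) (resMap _ _ Y hYq) := by
  subst hX hY
  have h1 : ∀ n (s : (nerve M).obj n) (t : (Δ[1] : SSet.{max u v}).obj n),
      s ∈ (fullSub p).obj n → (nerveCyl (cylFunctor α)).app n (s, t) ∈ (fullSub p).obj n :=
    fun n s t hs i => Pres.cyl α hF hG _ (hs i)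
  have h2 : ∀ n (s : (nerve M).obj n) (t : (Δ[1] : SSet.{max u v}).obj n),
      s ∈ (fullUnion p q).obj n →
        (nerveCyl (cylFunctor α)).app n (s, t) ∈ (fullUnion p q).obj n := by
    intro n s t hs
    rw [mem_fullUnion] at hs ⊢
    exact hs.imp (fun hs i => Pres.cyl α hF hG _ (hs i))
      fun ⟨a, hs⟩ => ⟨a, fun i => Pres.cyl α (hF' a) (hG' a) _ (hs i)⟩
  have := LiftableAlong.of_homotopy (fullIncl p q) (resCyl _ (cylFunctor α) h1)
    (resCyl _ (cylFunctor α) h2) rfl e e'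
  rw [cyl_resCyl α h1 e hXp, cyl_resCyl α h2 e hXq, cyl_resCyl α h1 e' hYp,
    cyl_resCyl α h2 e' hYq] at this
  exact this h

end FullSubcomplexes

section CylAnodyne

open Simplicial MonoidalCategory HomotopicalAlgebra SSet.modelCategoryQuillen

namespace Cyl

variable {P : Type} [PartialOrder P]

lemma functor_ext_of_obj {J : Type*} [Category J] {F G : J ⥤ P}
    (h : ∀ j, F.obj j = G.obj j) : F = G :=
  CategoryTheory.Functor.ext h fun _ _ _ => Subsingleton.elim _ _

lemma pt_hom_ext {i : P} {x : Cyl.{w} P} (f g : pt i ⟶ x) : f = g :=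
  Subsingleton.elim f g

variable [OrderTop P]

/-- Extension of an order embedding by a new top element. -/
def snocEmb {m n : ℕ} (f : Fin (m + 1) ↪o Fin (n + 1)) : Fin (m + 1 + 1) ↪o Fin (n + 1 + 1) :=
  OrderEmbedding.ofStrictMono
    (Fin.snoc (α := fun _ => Fin (n + 1 + 1)) (fun i => (f i).castSucc) (Fin.last _)) (by
      intro i j hij
      induction i using Fin.lastCases with
      | last => exact absurd hij (Fin.le_last j).not_gt
      | cast i =>
        induction j using Fin.lastCases with
        | last => simp
        | cast j => simpa using hij)

@[simp] lemma snocEmb_castSucc {m n : ℕ} (f : Fin (m + 1) ↪o Fin (n + 1)) (i : Fin (m + 1)) :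
    snocEmb f i.castSucc = (f i).castSucc :=
  Fin.snoc_castSucc (α := fun _ => Fin (n + 1 + 1)) (Fin.last _) (fun i => (f i).castSucc) i

@[simp] lemma snocEmb_last {m n : ℕ} (f : Fin (m + 1) ↪o Fin (n + 1)) :
    snocEmb f (Fin.last _) = Fin.last _ :=
  Fin.snoc_last (α := fun _ => Fin (n + 1 + 1)) (Fin.last _) (fun i => (f i).castSucc)

lemma snocEmb_refl {m : ℕ} (j : Fin (m + 1 + 1)) :
    snocEmb (RelEmbedding.refl (α := Fin (m + 1)) (· ≤ ·)) j = j := by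
  induction j using Fin.lastCases with
  | last => simp
  | cast j => exact snocEmb_castSucc _ _

lemma snocEmb_trans {l m n : ℕ} (f : Fin (l + 1) ↪o Fin (m + 1)) (g : Fin (m + 1) ↪o Fin (n + 1))
    (j : Fin (l + 1 + 1)) : snocEmb (f.trans g) j = snocEmb g (snocEmb f j) := by
  induction j using Fin.lastCases with
  | last => simp
  | cast j => simp

/-- The string obtained by appending the top element. -/
def snocFun {m : ℕ} (σ : Fin (m + 1) ⥤ P) : Fin (m + 1 + 1) ⥤ P :=
  Monotone.functor (f := Fin.snoc (α := fun _ => P) σ.obj ⊤) (by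
      intro i j hij
      induction j using Fin.lastCases with
      | last => simp
      | cast j =>
        induction i using Fin.lastCases with
        | last => exact absurd hij (Fin.castSucc_lt_last j).not_ge
        | cast i => simpa using leOfHom (σ.map (homOfLE (by simpa using hij))))

@[simp] lemma snocFun_castSucc {m : ℕ} (σ : Fin (m + 1) ⥤ P) (i : Fin (m + 1)) :
    (snocFun σ).obj i.castSucc = σ.obj i :=
  Fin.snoc_castSucc (α := fun _ => P) _ _ _

@[simp] lemma snocFun_last {m : ℕ} (σ : Fin (m + 1) ⥤ P) :
    (snocFun σ).obj (Fin.last _) = ⊤ :=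
  Fin.snoc_last (α := fun _ => P) _ _

/-- Appending the top element, as a functor. -/
def snoc (P : Type) [PartialOrder P] [OrderTop P] : Str.{w} P ⥤ Str.{w} P where
  obj σ := ⟨σ.n + 1, snocFun σ.fn⟩
  map {σ τ} f := ⟨snocEmb (Str.Hom.emb (σ := σ) (τ := τ) f), by
    have hf := f.fac
    refine functor_ext_of_obj fun j => ?_
    induction j using Fin.lastCases with
    | last => simp
    | cast j => simp [hf]⟩
  map_id σ := by
    apply Str.hom_ext
    ext j : 1
    exact snocEmb_refl j
  map_comp f g := by
    apply Str.hom_ext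
    ext j : 1
    exact snocEmb_trans _ _ j

/-- The functor appending the top element to all strings. -/
def snocCyl (P : Type) [PartialOrder P] [OrderTop P] : Cyl.{w} P ⥤ Cyl.{w} P :=
  desc pt (snoc P ⋙ inc P) (fun _ _ h => ptHom h)
    (fun _ σ _ => ptSt (le_top.trans (snocFun_last σ.fn).ge))
    (fun _ => Subsingleton.elim _ _) (fun _ _ _ _ _ => Subsingleton.elim _ _)
    (fun _ _ _ _ _ => Subsingleton.elim _ _) (fun _ _ _ _ _ => Subsingleton.elim _ _)

/-- The string consisting of the top element. -/
def topStr (P : Type) [PartialOrder P] [OrderTop P] : Str.{w} P :=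
  ⟨0, (Functor.const _).obj ⊤⟩

/-- The functor sending all strings to the string consisting of the top element. -/
def topCyl (P : Type) [PartialOrder P] [OrderTop P] : Cyl.{w} P ⥤ Cyl.{w} P :=
  desc pt ((Functor.const _).obj (st (topStr P))) (fun _ _ h => ptHom h)
    (fun _ _ _ => ptSt le_top)
    (fun _ => Subsingleton.elim _ _) (fun _ _ _ _ _ => Subsingleton.elim _ _)
    (fun _ _ _ _ _ => Subsingleton.elim _ _) (fun _ _ _ _ _ => Subsingleton.elim _ _)

/-- The inclusion of a string into its extension. -/
def toSnoc (σ : Str.{w} P) : σ ⟶ (snoc P).obj σ :=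
  ⟨Fin.castSuccOrderEmb, functor_ext_of_obj fun j => (snocFun_castSucc σ.fn j).symm⟩

/-- The inclusion of the last vertex into the extension of a string. -/
def topToSnoc (σ : Str.{w} P) : topStr P ⟶ (snoc P).obj σ :=
  ⟨OrderEmbedding.ofStrictMono (fun _ => Fin.last _) (fun i j h => by
      have : i = j := Subsingleton.elim (α := Fin 1) _ _
      exact absurd this h.ne),
    functor_ext_of_obj fun j => (snocFun_last σ.fn).symm⟩

/-- The inclusion of the identity into the appending functor. -/
def idToSnoc : 𝟭 (Cyl.{w} P) ⟶ snocCyl P where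
  app
    | pt _ => 𝟙 _
    | st σ => toSnoc σ
  naturality x y f := by
    rcases x with x | x <;> rcases y with y | y
    · exact pt_hom_ext (i := x) _ _
    · exact pt_hom_ext (i := x) _ _
    · exact f.elim
    · apply Str.hom_ext
      ext j : 1
      exact (snocEmb_castSucc _ _).symm

/-- The inclusion of the last vertex into the appending functor. -/
def topCylToSnoc : topCyl.{w} P ⟶ snocCyl P where
  app
    | pt _ => 𝟙 _
    | st σ => topToSnoc σ
  naturality x y f := by
    rcases x with x | x <;> rcases y with y | y
    · exact pt_hom_ext (i := x) _ _
    · exact pt_hom_ext (i := x) _ _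
    · exact f.elim
    · apply Str.hom_ext
      ext j : 1
      exact (snocEmb_last _).symm

/-- The contraction of all objects to the top string. -/
def topCylToConst : topCyl.{w} P ⟶ (Functor.const _).obj (st (topStr P)) where
  app
    | pt _ => ptSt le_top
    | st σ => 𝟙 _
  naturality x y f := by
    rcases x with x | x <;> rcases y with y | y
    · exact pt_hom_ext (i := x) _ _
    · exact pt_hom_ext (i := x) _ _
    · exact f.elim
    · rfl

lemma anodyne_fullIncl {ι : Type*} (S : ι → Set P) (hS : ∀ a, ⊤ ∈ S a) :
    SSet.anodyneExtensions (fullIncl (IsSt.{w} (P := P)) fun a => In (S a)) := by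
  have h₁ : Pres (snocCyl P) (IsSt.{w} (P := P)) := by
    rintro (i | σ) h
    · exact h
    · trivial
  have h₂ : Pres (topCyl P) (IsSt.{w} (P := P)) := by
    rintro (i | σ) h
    · exact h
    · trivial
  have h₃ : Pres ((Functor.const _).obj (st (topStr P))) (IsSt.{w} (P := P)) :=
    fun x _ => trivial
  have h₁' (a : ι) : Pres (snocCyl P) (In.{w} (S a)) := by
    rintro (i | σ) h
    · exact h
    · intro t
      induction t using Fin.lastCases with
      | last => exact (snocFun_last σ.fn).symm ▸ hS a
      | cast t => exact (snocFun_castSucc σ.fn t).symm ▸ h t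
  have h₂' (a : ι) : Pres (topCyl P) (In.{w} (S a)) := by
    rintro (i | σ) h
    · exact h
    · exact fun _ => hS a
  have h₃' (a : ι) : Pres ((Functor.const _).obj (st (topStr P))) (In.{w} (S a)) :=
    fun x _ _ => hS a
  apply LiftableAlong.anodyne
  refine LiftableAlong.of_natTrans idToSnoc _ _ 1 0 (fun _ h => h) (fun _ _ h => h) h₁ h₁' rfl rfl
    (h₁.sub) (h₁.union h₁') (fun _ _ h => h) (fun _ _ h => h) ?_
  refine LiftableAlong.of_natTrans topCylToSnoc _ _ 0 1 h₂ h₂' h₁ h₁' rfl rfl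
    (h₂.sub) (h₂.union h₂') _ _ ?_
  refine LiftableAlong.of_natTrans topCylToConst _ _ 1 0 h₂ h₂' h₃ h₃' rfl rfl
    (h₃.sub) (h₃.union h₃') _ _ ?_
  exact LiftableAlong.of_const _ (resMap _ _ ((Functor.const _).obj (st (topStr P)))
    (fun _ _ _ _ => trivial)) rfl rfl

end Cyl
end CylAnodyne

section Boundary

open Simplicial MonoidalCategory HomotopicalAlgebra SSet.modelCategoryQuillen

lemma exists_lift_functor {J : Type*} [Category J] {E F : Type*} [Category E] [Category F]
    (G : E ⥤ F) [G.Full] [G.Faithful] (K : J ⥤ F) (h : ∀ j, ∃ e, G.obj e = K.obj j) :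
    ∃ L : J ⥤ E, L ⋙ G = K := by
  choose o ho using h
  refine ⟨{ obj := o
            map f := G.preimage (eqToHom (ho _) ≫ K.map f ≫ eqToHom (ho _).symm)
            map_id j := G.map_injective (by simp)
            map_comp f g := G.map_injective (by simp) }, ?_⟩
  exact CategoryTheory.Functor.ext ho fun _ _ f => by simp

lemma functor_comp_injective {J : Type*} [Category J] {E F : Type*} [Category E] [Category F]
    (G : E ⥤ F) [G.Faithful] (hG : Function.Injective G.obj) {K L : J ⥤ E}
    (h : K ⋙ G = L ⋙ G) : K = L := by
  have h' (j : J) : K.obj j = L.obj j := hG (Functor.congr_obj h j)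
  refine CategoryTheory.Functor.ext h' fun i j f => G.map_injective ?_
  have := Functor.congr_hom h f
  simpa [eqToHom_map] using this

namespace Cyl

variable {P Q : Type} [PartialOrder P] [PartialOrder Q] (θ : P ↪o Q)

/-- The functor induced by an order embedding. -/
abbrev mapEmb : Cyl.{w} P ⥤ Cyl.{w} Q := map θ.monotone.functor

lemma mapEmb_injective : Function.Injective (mapEmb.{w} θ).obj := by
  rintro (i | ⟨m, σ⟩) (j | ⟨n, τ⟩) h
  · exact congrArg pt (θ.injective (Cyl.pt.inj h))
  · cases h
  · cases h
  · have h1 := Cyl.st.inj h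
    obtain rfl : m = n := congrArg Str.n h1
    have h2 : σ ⋙ θ.monotone.functor = τ ⋙ θ.monotone.functor := eq_of_heq (Str.mk.inj h1).2
    rw [functor_ext_of_obj (F := σ) (G := τ) fun j => θ.injective (Functor.congr_obj h2 j)]

instance : (mapEmb.{w} θ).Faithful where
  map_injective {x y} f g h := by
    rcases x with x | x <;> rcases y with y | y
    · exact pt_hom_ext (i := x) _ _
    · exact pt_hom_ext (i := x) _ _
    · exact f.elim
    · exact Str.hom_ext (congrArg (fun k : st ((Str.map.{w, w} θ.monotone.functor).obj x) ⟶
        st ((Str.map θ.monotone.functor).obj y) => Str.Hom.emb k) h)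

instance : (mapEmb.{w} θ).Full where
  map_surjective {x y} f := by
    rcases x with x | x <;> rcases y with y | y
    · exact ⟨ptHom (θ.le_iff_le.1 f.down.down), pt_hom_ext (i := θ x) _ _⟩
    · exact ⟨ptSt (θ.le_iff_le.1 f.down.down), pt_hom_ext (i := θ x) _ _⟩
    · exact f.elim
    · exact ⟨⟨Str.Hom.emb (σ := (Str.map.{w, w} θ.monotone.functor).obj x)
        (τ := (Str.map θ.monotone.functor).obj y) f, functor_ext_of_obj fun j =>
        θ.injective (Functor.congr_obj (Str.Hom.fac (σ := (Str.map.{w, w} θ.monotone.functor).obj x)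
          (τ := (Str.map θ.monotone.functor).obj y) f) j)⟩, rfl⟩

lemma exists_map_eq {x : Cyl.{w} Q} (hx : In (Set.range θ) x) :
    ∃ y, (mapEmb.{w} θ).obj y = x := by
  rcases x with i | ⟨n, σ⟩
  · obtain ⟨j, rfl⟩ := hx
    exact ⟨pt j, rfl⟩
  · choose o ho using hx
    refine ⟨st ⟨n, Monotone.functor (f := o) fun i j hij => ?_⟩, ?_⟩
    · rw [← θ.le_iff_le, ho, ho]
      exact leOfHom (σ.map (homOfLE hij))
    · exact congrArg (fun f => st ⟨n, f⟩) (functor_ext_of_obj ho)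

lemma in_map (x : Cyl.{w} P) : In (Set.range θ) ((mapEmb.{w} θ).obj x) := by
  rcases x with i | σ
  · exact ⟨i, rfl⟩
  · exact fun t => ⟨_, rfl⟩

lemma in_map_iff (S : Set Q) (x : Cyl.{w} P) :
    In S ((mapEmb.{w} θ).obj x) ↔ In (θ ⁻¹' S) x := by
  rcases x with i | σ <;> rfl

lemma isSt_map_iff (x : Cyl.{w} P) : IsSt ((mapEmb.{w} θ).obj x) ↔ IsSt x := by
  rcases x with i | σ <;> rfl

lemma exists_nerveMap_eq {n} {s : (nerve (Cyl.{w} Q)).obj n}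
    (hs : s ∈ (fullSub (In (Set.range θ))).obj n) :
    ∃ t, (nerveMap (mapEmb.{w} θ)).app n t = s :=
  exists_lift_functor (mapEmb.{w} θ) (K := s) fun j => exists_map_eq θ (hs j)

lemma nerveMap_injective (n) : Function.Injective ((nerveMap (mapEmb.{w} θ)).app n) :=
  fun _ _ h => functor_comp_injective _ (mapEmb_injective θ) h

end Cyl

lemma anodyne_homOfLE_of_preimage {X Y : SSet.{w}} (g : Y ⟶ X)
    (hg : ∀ n, Function.Injective (g.app n)) {A : Y.Subcomplex} {B V : X.Subcomplex} (h : B ≤ V)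
    (hV : ∀ n (x : X.obj n), x ∈ V.obj n ↔ ∃ y, g.app n y = x)
    (hA : ∀ n (y : Y.obj n), y ∈ A.obj n ↔ g.app n y ∈ B.obj n)
    (hanod : SSet.anodyneExtensions A.ι) :
    SSet.anodyneExtensions (SSet.Subcomplex.homOfLE h) := by
  let e₁ : A.toSSet ⟶ B.toSSet :=
    { app n := ↾fun y => ⟨g.app n y.1, (hA n _).1 y.2⟩
      naturality a b f := by
        ext y
        have := ConcreteCategory.congr_hom (g.naturality f) y.1
        exact Subtype.ext this }
  let e₂ : Y ⟶ V.toSSet :=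
    { app n := ↾fun y => ⟨g.app n y, (hV n _).2 ⟨y, rfl⟩⟩
      naturality a b f := by
        ext y
        have := ConcreteCategory.congr_hom (g.naturality f) y
        exact Subtype.ext this }
  have h₁ : IsIso e₁ := by
    rw [NatTrans.isIso_iff_isIso_app]
    intro n
    rw [isIso_iff_bijective]
    refine ⟨fun x y hxy => Subtype.ext (hg n (congrArg Subtype.val hxy)), ?_⟩
    rintro ⟨x, hx⟩
    obtain ⟨y, rfl⟩ := (hV n x).1 (h n hx)
    exact ⟨⟨y, (hA n y).2 hx⟩, rfl⟩
  have h₂ : IsIso e₂ := by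
    rw [NatTrans.isIso_iff_isIso_app]
    intro n
    rw [isIso_iff_bijective]
    refine ⟨fun x y hxy => hg n (congrArg Subtype.val hxy), ?_⟩
    rintro ⟨x, hx⟩
    obtain ⟨y, rfl⟩ := (hV n x).1 hx
    exact ⟨y, rfl⟩
  exact (MorphismProperty.arrow_mk_iso_iff SSet.anodyneExtensions
    (Arrow.isoMk (f := Arrow.mk A.ι) (g := Arrow.mk (SSet.Subcomplex.homOfLE h))
      (asIso e₁) (asIso e₂) rfl)).1 hanod

namespace Cyl

/-- The union of the strings and of the faces of `Cyl (Fin (n + 1))`. -/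
def bdry (n : ℕ) : (nerve (Cyl.{w} (Fin (n + 1)))).Subcomplex :=
  fullUnion IsSt fun j : Fin (n + 1) => In {j}ᶜ

lemma anodyne_bdry_aux (n : ℕ)
    (ih : ∀ m, n = m + 1 → SSet.anodyneExtensions (bdry.{w} m).ι) :
    SSet.anodyneExtensions (bdry.{w} n).ι := by
  let L : (nerve (Cyl.{w} (Fin (n + 1)))).Subcomplex :=
    fullUnion IsSt fun j : Fin n => In {j.castSucc}ᶜ
  have hL : SSet.anodyneExtensions (fullIncl (IsSt.{w} (P := Fin (n + 1)))
      fun j : Fin n => In {j.castSucc}ᶜ) :=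
    anodyne_fullIncl _ fun j => (Fin.castSucc_lt_last j).ne'
  have htop : SSet.anodyneExtensions (fullSub (IsSt.{w} (P := Fin (n + 1)))).ι := by
    have h := anodyne_fullIncl.{w} (P := Fin (n + 1)) (fun _ : Unit => Set.univ) fun _ => trivial
    have h' : fullUnion (IsSt.{w} (P := Fin (n + 1)))
        (fun _ : Unit => In (Set.univ : Set (Fin (n + 1)))) = ⊤ := by
      ext k s
      refine iff_of_true (mem_fullUnion.2 (Or.inr ⟨(), fun i => ?_⟩)) trivial
      generalize CategoryTheory.Functor.obj s i = x
      rcases x with x | x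
      · trivial
      · exact fun _ => trivial
    have : IsIso (fullUnion (IsSt.{w} (P := Fin (n + 1)))
        (fun _ : Unit => In (Set.univ : Set (Fin (n + 1))))).ι := by
      rw [h']
      exact inferInstanceAs (IsIso (SSet.Subcomplex.topIso _).hom)
    exact MorphismProperty.comp_mem _ _ _ h (SSet.anodyneExtensions.of_isIso (fullUnion _ _).ι)
  have hV : bdry.{w} n = L ⊔ fullSub (In {Fin.last n}ᶜ) := by
    ext k s
    simp [bdry, L, fullUnion, fullSub, Fin.exists_fin_succ']
    tauto
  have hLA : SSet.anodyneExtensions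
      (SSet.Subcomplex.homOfLE (hV ▸ le_sup_left : L ≤ bdry.{w} n)) := by
    have sq : SSet.Subcomplex.BicartSq (L ⊓ fullSub (In {Fin.last n}ᶜ)) L
        (fullSub (In {Fin.last n}ᶜ)) (bdry.{w} n) := ⟨hV.symm, rfl⟩
    refine MorphismProperty.of_isPushout sq.isPushout ?_
    rcases n with _ | n
    · have h' : fullSub (In {Fin.last 0}ᶜ) = (⊥ : (nerve (Cyl.{w} (Fin 1))).Subcomplex) := by
        ext k s
        refine iff_of_false (fun hs => ?_) id
        have h0 := hs 0
        generalize CategoryTheory.Functor.obj s 0 = x at h0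
        rcases x with x | x
        · exact h0 (Subsingleton.elim (α := Fin 1) _ _)
        · exact h0 0 (Subsingleton.elim (α := Fin 1) _ _)
      have h0 : fullSub (In {Fin.last 0}ᶜ) ≤ L ⊓ fullSub (In {Fin.last 0}ᶜ) := by
        rw [h']
        exact bot_le
      have : IsIso (SSet.Subcomplex.homOfLE sq.le₁₃) := ⟨SSet.Subcomplex.homOfLE h0, rfl, rfl⟩
      exact SSet.anodyneExtensions.of_isIso _
    · have hr : Set.range (Fin.castSuccOrderEmb (n := n + 1)) = {Fin.last (n + 1)}ᶜ := by
        ext b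
        exact Fin.exists_castSucc_eq
      refine anodyne_homOfLE_of_preimage (nerveMap (mapEmb Fin.castSuccOrderEmb))
        (nerveMap_injective _) sq.le₁₃ ?_ ?_ (ih n rfl)
      · intro k s
        rw [← hr]
        refine ⟨exists_nerveMap_eq _, ?_⟩
        rintro ⟨y, rfl⟩ i
        exact in_map _ _
      · intro k y
        have h1 : (nerveMap (mapEmb Fin.castSuccOrderEmb)).app k y ∈
            (fullSub (In {Fin.last (n + 1)}ᶜ)).obj k := by
          rw [← hr]
          exact fun i => in_map _ _
        refine Iff.trans ?_ (and_iff_left h1).symm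
        refine mem_fullUnion.trans (Iff.trans ?_ mem_fullUnion.symm)
        refine or_congr (forall_congr' fun i => (isSt_map_iff _ _).symm)
          (exists_congr fun a => forall_congr' fun i => ?_)
        refine Iff.trans ?_ (in_map_iff _ _ _).symm
        have : (Fin.castSuccOrderEmb (n := n + 1)) ⁻¹' {a.castSucc}ᶜ = {a}ᶜ := by
          ext b
          simp
        rw [this]
  refine anodyne_of_comp (SSet.Subcomplex.homOfLE (hV ▸ le_sup_of_le_left le_sup_left :
    fullSub IsSt ≤ bdry.{w} n)) _ ?_ htop
  exact MorphismProperty.comp_mem _ _ _ hL hLA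

lemma anodyne_bdry (n : ℕ) : SSet.anodyneExtensions (bdry.{w} n).ι := by
  induction n with
  | zero => exact anodyne_bdry_aux 0 fun m h => absurd h (by omega)
  | succ n ih =>
    refine anodyne_bdry_aux (n + 1) fun m h => ?_
    obtain rfl : n = m := by omega
    exact ih

end Cyl

end Boundary

section LastVertex

open Simplicial MonoidalCategory HomotopicalAlgebra SSet.modelCategoryQuillen Opposite

namespace Cyl

/-- The retraction of `Cyl P` onto points given by the last vertex. -/
def ret (P : Type) [PartialOrder P] : Cyl.{w} P ⥤ P :=
  desc _root_.id (Str.lv P) (fun _ _ h => homOfLE h) (fun _ _ h => homOfLE h)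
    (fun _ => Subsingleton.elim _ _) (fun _ _ _ _ _ => Subsingleton.elim _ _)
    (fun _ _ _ _ _ => Subsingleton.elim _ _) (fun _ _ _ _ _ => Subsingleton.elim _ _)

lemma map_ret {P P' : Type} [PartialOrder P] [PartialOrder P'] (F : P ⥤ P') :
    map.{w} F ⋙ ret P' = ret P ⋙ F :=
  functor_ext_of_obj fun x => by rcases x with x | x <;> rfl

lemma inc_ret (P : Type) [PartialOrder P] : inc.{w} P ⋙ ret P = Str.lv P :=
  functor_ext_of_obj fun _ => rfl

lemma pts_ret (P : Type) [PartialOrder P] : pts.{w} P ⋙ ret P = 𝟭 P :=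
  functor_ext_of_obj fun _ => rfl

lemma pts_comp_map {P P' : Type} [PartialOrder P] [PartialOrder P'] (F : P ⥤ P') :
    pts.{w} P ⋙ map.{w} F = F ⋙ pts P' :=
  CategoryTheory.Functor.ext (fun _ => rfl) fun i _ _ => pt_hom_ext (i := F.obj i) _ _

/-- The natural transformation from last vertices to strings. -/
def lvToSt (P : Type) [PartialOrder P] : Str.lv P ⋙ pts.{w} P ⟶ inc P where
  app σ := ptSt (i := (Str.lv P).obj σ) le_rfl
  naturality σ _ _ := pt_hom_ext (i := (Str.lv P).obj σ) _ _

instance (P : Type) [PartialOrder P] : (inc.{w} P).Faithful where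
  map_injective h := h

lemma inc_injective (P : Type) [PartialOrder P] : Function.Injective (inc.{w} P).obj :=
  fun _ _ h => Cyl.st.inj h

instance (P : Type) [PartialOrder P] : (inc.{w} P).Full where
  map_surjective f := ⟨f, rfl⟩

end Cyl

namespace Str

universe w' a b

variable {A : Type a} [Category.{b} A]

lemma eq_conj {m n : ℕ} {f f' : Fin (m + 1) ⥤ A} {g g' : Fin (n + 1) ⥤ A} (hf : f = f')
    (hg : g = g') (φ : (⟨m, f⟩ : Str.{w} A) ⟶ ⟨n, g⟩) (ψ : (⟨m, f'⟩ : Str.{w} A) ⟶ ⟨n, g'⟩)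
    (h : Hom.emb φ = Hom.emb ψ) :
    φ = eqToHom (congrArg (Str.mk _) hf) ≫ ψ ≫ eqToHom (congrArg (Str.mk _) hg.symm) := by
  subst hf hg
  exact (hom_ext h).trans (by simp)

/-- A chain of strings, seen as a chain of faces of its last string. -/
def faces {n : ℕ} (S : Fin (n + 1) ⥤ Str.{w} A) :
    Fin (n + 1) ⥤ Str.{w'} (Fin ((S.obj (Fin.last n)).n + 1)) where
  obj i := ⟨(S.obj i).n, (Hom.emb (S.map (homOfLE (Fin.le_last i)))).monotone.functor⟩
  map {i j} f := ⟨Hom.emb (σ := S.obj i) (τ := S.obj j) (S.map f), by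
    have h : S.map (homOfLE (Fin.le_last i)) = S.map f ≫ S.map (homOfLE (Fin.le_last j)) := by
      rw [← S.map_comp]
      rfl
    rw [h]
    rfl⟩
  map_id i := hom_ext (congrArg (Hom.emb (σ := S.obj i) (τ := S.obj i)) (S.map_id i))
  map_comp f g := hom_ext (congrArg (Hom.emb (σ := S.obj _) (τ := S.obj _)) (S.map_comp f g))

lemma faces_map {n : ℕ} (S : Fin (n + 1) ⥤ Str.{w} A) :
    faces.{w, w'} S ⋙ map (S.obj (Fin.last n)).fn = S := by
  have h (i : Fin (n + 1)) : (Hom.emb (S.map (homOfLE (Fin.le_last i)))).monotone.functor ⋙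
      (S.obj (Fin.last n)).fn = (S.obj i).fn :=
    (Hom.fac (S.map (homOfLE (Fin.le_last i)))).symm
  exact CategoryTheory.Functor.ext (fun i => congrArg (Str.mk _) (h i)) fun i j f =>
    eq_conj (h i) (h j) _ _ rfl

lemma faces_comp {m n : ℕ} (S : Fin (n + 1) ⥤ Str.{w} A) (θ : Fin (m + 1) ⥤ Fin (n + 1)) :
    faces.{w, w'} (θ ⋙ S) ⋙ map (Hom.emb (S.map
      (homOfLE (Fin.le_last (θ.obj (Fin.last m)))))).monotone.functor = θ ⋙ faces S := by
  have h (i : Fin (m + 1)) : (Hom.emb (S.map (θ.map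
      (homOfLE (Fin.le_last i))))).monotone.functor ⋙ (Hom.emb (S.map
      (homOfLE (Fin.le_last (θ.obj (Fin.last m)))))).monotone.functor =
      (Hom.emb (S.map (homOfLE (Fin.le_last (θ.obj i))))).monotone.functor := by
    have : S.map (homOfLE (Fin.le_last (θ.obj i))) = S.map (θ.map (homOfLE (Fin.le_last i))) ≫
        S.map (homOfLE (Fin.le_last (θ.obj (Fin.last m)))) := by
      rw [← S.map_comp]
      rfl
    rw [this]
    rfl
  exact CategoryTheory.Functor.ext (fun i => congrArg (Str.mk _) (h i)) fun i j f =>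
    eq_conj (h i) (h j) _ _ rfl

lemma map_lv {A' : Type*} [Category A'] (F : A ⥤ A') :
    map.{w, w'} F ⋙ lv A' = lv A ⋙ F := by
  refine CategoryTheory.Functor.ext (fun _ => rfl) ?_
  rintro ⟨m, σ⟩ ⟨n, τ⟩ ⟨e, h⟩
  revert e
  intro (e : Fin (m + 1) ↪o Fin (n + 1)) (h : σ = e.monotone.functor ⋙ τ)
  subst h
  refine Eq.trans ?_ ((Category.id_comp _).trans (Category.comp_id _)).symm
  refine (Category.id_comp _).trans ?_
  exact (F.congr_map (Category.id_comp (τ.map (homOfLE (Fin.le_last (e (Fin.last m))))))).symm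

end Str

end LastVertex

section LiftData

open Simplicial MonoidalCategory HomotopicalAlgebra SSet.modelCategoryQuillen Opposite

/-- The action of a functor on simplices of nerves, for categories of arbitrary sizes. -/
def pushN {C : Type*} {D : Type*} [Category C] [Category D] (F : C ⥤ D) {k : SimplexCategoryᵒᵖ}
    (s : (nerve C).obj k) : (nerve D).obj k :=
  CategoryTheory.Functor.comp s F

lemma nerveMap_id_comp {C : Type u} [Category.{v} C] {F : C ⥤ C} (hF : F = 𝟭 C) {X : SSet.{max u v}}
    (f : nerve C ⟶ X) : nerveMap F ≫ f = f := by
  subst hF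
  exact Category.id_comp f

/-- The functor underlying a morphism of the simplex category. -/
abbrev toFun {m n : SimplexCategory} (θ : m ⟶ n) : Fin (m.len + 1) ⥤ Fin (n.len + 1) :=
  (SimplexCategory.Hom.toOrderHom θ).monotone.functor

variable {B : Type (max u v)} [Category.{v} B] {P Q : SSet.{max u v}} (t : P ⟶ Q)
  (g : nerve (Str.{v} B) ⟶ P) (q : nerve B ⟶ Q)

/-- A lift over the cylinder of a simplex of the nerve. -/
structure LiftData (n : ℕ) where
  /-- the simplex of the nerve -/
  α : Fin (n + 1) ⥤ B
  /-- the map out of the cylinder -/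
  l : nerve (Cyl.{max u v} (Fin (n + 1))) ⟶ P
  str (k) (s : (nerve (Str.{max u v} (Fin (n + 1)))).obj k) :
    l.app k (pushN (Cyl.inc _) s) = g.app k (pushN (Str.map α) s)
  lift (k) (s : (nerve (Cyl.{max u v} (Fin (n + 1)))).obj k) :
    t.app k (l.app k s) = q.app k (pushN (Cyl.ret _ ⋙ α) s)

namespace LiftData

variable {t g q}

lemma ext' {n : ℕ} {x y : LiftData t g q n} (h : x.α = y.α) (h' : x.l = y.l) : x = y := by
  cases x
  cases y
  cases h
  cases h'
  rfl

/-- Restriction of lifts. -/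
def pull {m n : ℕ} (F : Fin (m + 1) ⥤ Fin (n + 1)) (x : LiftData t g q n) : LiftData t g q m where
  α := F ⋙ x.α
  l := nerveMap (Cyl.map F) ≫ x.l
  str k s := x.str k (pushN (Str.map F) s)
  lift k s := by
    refine (x.lift k (pushN (Cyl.map F) s)).trans (congrArg (q.app k) ?_)
    exact congrArg (fun G => pushN (G ⋙ x.α) s) (Cyl.map_ret F)

lemma pull_id {n : ℕ} (x : LiftData t g q n) : x.pull (𝟭 _) = x :=
  ext' rfl (nerveMap_id_comp Cyl.map_id _)

lemma pull_comp {l m n : ℕ} (F : Fin (l + 1) ⥤ Fin (m + 1)) (G : Fin (m + 1) ⥤ Fin (n + 1))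
    (x : LiftData t g q n) : x.pull (F ⋙ G) = (x.pull G).pull F :=
  ext' rfl (by
    change nerveMap (Cyl.map (F ⋙ G)) ≫ x.l = _
    rw [Cyl.map_comp]
    rfl)

end LiftData

/-- The simplicial set of lifts. -/
def liftSSet : SSet.{max u v} where
  obj n := LiftData t g q n.unop.len
  map θ := ↾fun x => x.pull (toFun θ.unop)
  map_id n := by
    apply ConcreteCategory.hom_ext
    exact LiftData.pull_id
  map_comp θ θ' := by
    apply ConcreteCategory.hom_ext
    exact LiftData.pull_comp (toFun θ'.unop) (toFun θ.unop)

/-- The projection from lifts to the nerve. -/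
def liftProj : liftSSet t g q ⟶ nerve B where
  app _ := ↾fun x => x.α
  naturality _ _ _ := rfl

section Extension

variable {t g q} {n : ℕ} (α : Fin (n + 1) ⥤ B)
  (b : ∀ {m : ℕ} (θ : Fin (m + 1) →o Fin (n + 1)), ¬ Function.Surjective θ → LiftData t g q m)

/-- The relation defining a map on the boundary of a cylinder. -/
def BdryRel {k : SimplexCategoryᵒᵖ} (s : (nerve (Cyl.{max u v} (Fin (n + 1)))).obj k)
    (p : P.obj k) : Prop :=
  (∃ s' : (nerve (Str.{max u v} (Fin (n + 1)))).obj k, s = pushN (Cyl.inc _) s' ∧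
    p = g.app k (pushN (Str.map α) s')) ∨
  ∃ (m : ℕ) (θ : Fin (m + 1) ↪o Fin (n + 1)) (h : ¬ Function.Surjective θ.toOrderHom)
    (c : (nerve (Cyl.{max u v} (Fin (m + 1)))).obj k), s = pushN (Cyl.mapEmb θ) c ∧
      p = (b θ.toOrderHom h).l.app k c

variable {α b}

lemma BdryRel.map {k k' : SimplexCategoryᵒᵖ} (f : k ⟶ k')
    {s : (nerve (Cyl.{max u v} (Fin (n + 1)))).obj k} {p : P.obj k} (h : BdryRel α b s p) :
    BdryRel α b ((nerve _).map f s) (P.map f p) := by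
  rcases h with ⟨s', rfl, rfl⟩ | ⟨m, θ, h, c, rfl, rfl⟩
  · refine Or.inl ⟨(nerve _).map f s', rfl, ?_⟩
    exact (ConcreteCategory.congr_hom (g.naturality f) _).symm
  · refine Or.inr ⟨m, θ, h, (nerve _).map f c, rfl, ?_⟩
    exact (ConcreteCategory.congr_hom ((b θ.toOrderHom h).l.naturality f) _).symm

lemma exists_orderEmbedding_range {n : ℕ} (S : Set (Fin (n + 1))) (hS : S.Nonempty) :
    ∃ (m : ℕ) (θ : Fin (m + 1) ↪o Fin (n + 1)), Set.range θ = S := by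
  classical
  have h : S.toFinset.card ≠ 0 := by
    obtain ⟨x, hx⟩ := hS
    exact Finset.card_ne_zero_of_mem (Set.mem_toFinset.2 hx)
  obtain ⟨m, hm⟩ := Nat.exists_eq_succ_of_ne_zero h
  exact ⟨m, S.toFinset.orderEmbOfFin hm, by simp⟩

lemma exists_orderEmbedding_comp {l m n : ℕ} (η : Fin (l + 1) ↪o Fin (n + 1))
    (θ : Fin (m + 1) ↪o Fin (n + 1)) (h : Set.range η ⊆ Set.range θ) :
    ∃ ζ : Fin (l + 1) ↪o Fin (m + 1), ∀ i, θ (ζ i) = η i := by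
  choose f hf using fun i => h ⟨i, rfl⟩
  exact ⟨OrderEmbedding.ofMapLEIff f fun i j => by
    rw [← θ.le_iff_le, hf, hf, η.le_iff_le], hf⟩

lemma Cyl.In.exists_mem {A : Type} [PartialOrder A] {S : Set A} {x : Cyl.{w} A} (h : Cyl.In S x) :
    S.Nonempty := by
  rcases x with i | σ
  · exact ⟨i, h⟩
  · exact ⟨_, h 0⟩

lemma Cyl.In.inter {A : Type} [PartialOrder A] {S T : Set A} {x : Cyl.{w} A} (h : Cyl.In S x)
    (h' : Cyl.In T x) : Cyl.In (S ∩ T) x := by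
  rcases x with i | σ
  · exact ⟨h, h'⟩
  · exact fun i => ⟨h i, h' i⟩

lemma Cyl.In.mono {A : Type} [PartialOrder A] {S T : Set A} (hST : S ⊆ T) {x : Cyl.{w} A}
    (h : Cyl.In S x) : Cyl.In T x := by
  rcases x with i | σ
  · exact hST h
  · exact fun i => hST (h i)

lemma exists_pushN_inc {A : Type} [PartialOrder A] {k : SimplexCategoryᵒᵖ}
    {s : (nerve (Cyl.{w} A)).obj k}
    (h : ∀ i : Fin (k.unop.len + 1), Cyl.IsSt (CategoryTheory.Functor.obj s i)) :
    ∃ s' : (nerve (Str.{w} A)).obj k, s = pushN (Cyl.inc _) s' := by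
  obtain ⟨s', hs'⟩ := exists_lift_functor (Cyl.inc.{w} A) (K := s) fun j => by
    have := h j
    generalize CategoryTheory.Functor.obj s j = x at this
    rcases x with x | x
    · exact this.elim
    · exact ⟨x, rfl⟩
  exact ⟨s', hs'.symm⟩

lemma BdryRel.unique
    (hα : ∀ {m : ℕ} (θ : Fin (m + 1) →o Fin (n + 1)) (h), (b θ h).α = θ.monotone.functor ⋙ α)
  (hb : ∀ {l m : ℕ} (η : Fin (l + 1) →o Fin (m + 1)) (θ : Fin (m + 1) →o Fin (n + 1)) (h h'),
    b (θ.comp η) h = (b θ h').pull η.monotone.functor)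
    {k : SimplexCategoryᵒᵖ} {s : (nerve (Cyl.{max u v} (Fin (n + 1)))).obj k}
    {p p' : P.obj k} (h : BdryRel α b s p) (h' : BdryRel α b s p') : p = p' := by
  have key {s' : (nerve (Str.{max u v} (Fin (n + 1)))).obj k} {m : ℕ}
      {θ : Fin (m + 1) ↪o Fin (n + 1)} (h : ¬ Function.Surjective θ.toOrderHom)
      {c : (nerve (Cyl.{max u v} (Fin (m + 1)))).obj k}
      (e : pushN (Cyl.inc _) s' = pushN (Cyl.mapEmb θ) c) :
      g.app k (pushN (Str.map α) s') = (b θ.toOrderHom h).l.app k c := by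
    obtain ⟨c', rfl⟩ := exists_pushN_inc (s := c) fun i => by
      rw [← Cyl.isSt_map_iff θ]
      have := Functor.congr_obj e i
      change Cyl.IsSt ((pushN (Cyl.mapEmb θ) c).obj i)
      rw [← this]
      trivial
    obtain rfl : s' = pushN (Str.map θ.monotone.functor) c' :=
      functor_comp_injective (Cyl.inc.{max u v} (Fin (n + 1))) (Cyl.inc_injective _) e
    rw [(b θ.toOrderHom h).str, hα]
    rfl
  rcases h with ⟨s', rfl, rfl⟩ | ⟨m, θ, h, c, rfl, rfl⟩ <;>
    rcases h' with ⟨s'', hs'', rfl⟩ | ⟨m', θ', h', c', hc', rfl⟩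
  · obtain rfl : s' = s'' :=
      functor_comp_injective (Cyl.inc.{max u v} (Fin (n + 1))) (Cyl.inc_injective _) hs''
    rfl
  · exact key h' hc'
  · exact (key h hs''.symm).symm
  · have hs (i : Fin (k.unop.len + 1)) : Cyl.In (Set.range θ ∩ Set.range θ')
        (CategoryTheory.Functor.obj (pushN (Cyl.mapEmb θ) c) i) := by
      refine Cyl.In.inter (Cyl.in_map _ _) ?_
      rw [hc']
      exact Cyl.in_map _ _
    obtain ⟨l, η, hη⟩ := exists_orderEmbedding_range _ (hs 0).exists_mem
    obtain ⟨ζ, hζ⟩ := exists_orderEmbedding_comp η θ (hη ▸ Set.inter_subset_left)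
    obtain ⟨ζ', hζ'⟩ := exists_orderEmbedding_comp η θ' (hη ▸ Set.inter_subset_right)
    rw [← hη] at hs
    obtain ⟨d, hd⟩ := Cyl.exists_nerveMap_eq η (s := pushN (Cyl.mapEmb θ) c) hs
    have hns : ¬ Function.Surjective η.toOrderHom := fun hsur => h fun x => by
      obtain ⟨y, hy⟩ := hsur x
      exact ⟨ζ y, (hζ y).trans hy⟩
    have aux {m : ℕ} {θ : Fin (m + 1) ↪o Fin (n + 1)} (h : ¬ Function.Surjective θ.toOrderHom)
        {c : (nerve (Cyl.{max u v} (Fin (m + 1)))).obj k} {ζ : Fin (l + 1) ↪o Fin (m + 1)}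
        (hζ : ∀ i, θ (ζ i) = η i) (e : pushN (Cyl.mapEmb η) d = pushN (Cyl.mapEmb θ) c) :
        (b θ.toOrderHom h).l.app k c = (b η.toOrderHom hns).l.app k d := by
      have h1 : η.toOrderHom = θ.toOrderHom.comp ζ.toOrderHom :=
        OrderHom.ext _ _ (funext fun i => (hζ i).symm)
      have h2 : Cyl.mapEmb.{max u v} η = Cyl.mapEmb ζ ⋙ Cyl.mapEmb θ := by
        rw [← Cyl.map_comp]
        refine congrArg Cyl.map ?_
        exact Cyl.functor_ext_of_obj (F := η.monotone.functor)
          (G := ζ.monotone.functor ⋙ θ.monotone.functor) fun i => (hζ i).symm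
      obtain rfl : c = pushN (Cyl.mapEmb ζ) d := by
        refine Cyl.nerveMap_injective θ k (Eq.trans e.symm ?_)
        exact congrArg (fun F => pushN F d) h2
      have h3 : b η.toOrderHom hns = (b θ.toOrderHom h).pull ζ.monotone.functor := by
        have := hb ζ.toOrderHom θ.toOrderHom (h1 ▸ hns) h
        refine Eq.trans ?_ this
        congr 1
      rw [h3]
      rfl
    exact (aux h hζ hd).trans (aux h' hζ' (Eq.trans hd hc')).symm

lemma BdryRel.exists {k : SimplexCategoryᵒᵖ} {s : (nerve (Cyl.{max u v} (Fin (n + 1)))).obj k}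
    (hs : s ∈ (Cyl.bdry n).obj k) : ∃ p, BdryRel α b s p := by
  rcases mem_fullUnion.1 hs with hs | ⟨j, hj⟩
  · obtain ⟨s', rfl⟩ := exists_pushN_inc hs
    exact ⟨_, Or.inl ⟨s', rfl, rfl⟩⟩
  · obtain ⟨m, θ, hθ⟩ := exists_orderEmbedding_range _ (hj 0).exists_mem
    rw [← hθ] at hj
    obtain ⟨d, hd⟩ := Cyl.exists_nerveMap_eq θ (s := s) hj
    refine ⟨_, Or.inr ⟨m, θ, fun hsur => ?_, d, hd.symm, rfl⟩⟩
    obtain ⟨y, hy⟩ := hsur j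
    have : j ∈ ({j}ᶜ : Set (Fin (n + 1))) := hθ ▸ ⟨y, hy⟩
    exact this rfl

lemma BdryRel.lift (hg : g ≫ t = nerveMap (Str.lv B) ≫ q)
    (hα : ∀ {m : ℕ} (θ : Fin (m + 1) →o Fin (n + 1)) (h), (b θ h).α = θ.monotone.functor ⋙ α)
    {k : SimplexCategoryᵒᵖ} {s : (nerve (Cyl.{max u v} (Fin (n + 1)))).obj k} {p : P.obj k}
    (h : BdryRel α b s p) : t.app k p = q.app k (pushN (Cyl.ret _ ⋙ α) s) := by
  rcases h with ⟨s', rfl, rfl⟩ | ⟨m, θ, h, c, rfl, rfl⟩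
  · refine (ConcreteCategory.congr_hom (NatTrans.congr_app hg k) _).trans ?_
    refine congrArg (q.app k) ?_
    change pushN (Str.map.{max u v, v} α ⋙ Str.lv.{v} B) s' = pushN ((Cyl.inc _ ⋙ Cyl.ret _) ⋙ α) s'
    rw [Str.map_lv, Cyl.inc_ret]
  · rw [(b θ.toOrderHom h).lift, hα]
    refine congrArg (q.app k) ?_
    change _ = pushN ((Cyl.mapEmb θ ⋙ Cyl.ret _) ⋙ α) c
    rw [Cyl.mapEmb, Cyl.map_ret]
    rfl

lemma exists_liftData (hg : g ≫ t = nerveMap (Str.lv B) ≫ q)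
    (hα : ∀ {m : ℕ} (θ : Fin (m + 1) →o Fin (n + 1)) (h), (b θ h).α = θ.monotone.functor ⋙ α)
  (hb : ∀ {l m : ℕ} (η : Fin (l + 1) →o Fin (m + 1)) (θ : Fin (m + 1) →o Fin (n + 1)) (h h'),
    b (θ.comp η) h = (b θ h').pull η.monotone.functor)
    [Fibration t] :
    ∃ x : LiftData t g q n, x.α = α ∧
      ∀ {m : ℕ} (θ : Fin (m + 1) ↪o Fin (n + 1)) (h : ¬ Function.Surjective θ.toOrderHom),
        x.pull θ.monotone.functor = b θ.toOrderHom h := by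
  choose f hf using fun (k : SimplexCategoryᵒᵖ) (s : (Cyl.bdry.{max u v} n).toSSet.obj k) =>
    BdryRel.exists (α := α) (b := b) s.2
  have hbb := fun {k} {s : (nerve (Cyl.{max u v} (Fin (n + 1)))).obj k} {p p' : P.obj k} =>
    BdryRel.unique hα hb (s := s) (p := p) (p' := p')
  let l₀ : (Cyl.bdry.{max u v} n).toSSet ⟶ P :=
    { app k := ↾f k
      naturality k k' φ := by
        ext s
        exact hbb (hf k' _) ((hf k s).map φ) }
  let Q₀ : nerve (Cyl.{max u v} (Fin (n + 1))) ⟶ Q :=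
    { app k := ↾fun s => q.app k (pushN (Cyl.ret _ ⋙ α) s)
      naturality k k' φ := by
        ext s
        exact ConcreteCategory.congr_hom (q.naturality φ) (pushN (Cyl.ret _ ⋙ α) s) }
  have hsq : l₀ ≫ t = (Cyl.bdry.{max u v} n).ι ≫ Q₀ := by
    ext k s
    exact BdryRel.lift hg hα (hf k s)
  obtain ⟨l, hl, hl'⟩ := anodyne_iff.1 (Cyl.anodyne_bdry.{max u v} n) t inferInstance l₀ Q₀ hsq
  have hl₁ {k} {s : (nerve (Cyl.{max u v} (Fin (n + 1)))).obj k} {p : P.obj k}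
      (hs : s ∈ (Cyl.bdry n).obj k) (hp : BdryRel α b s p) : l.app k s = p :=
    (ConcreteCategory.congr_hom (NatTrans.congr_app hl k) ⟨s, hs⟩).trans (hbb (hf k ⟨s, hs⟩) hp)
  refine ⟨⟨α, l, fun k s => hl₁ (mem_fullUnion.2 (Or.inl fun i => trivial))
    (Or.inl ⟨s, rfl, rfl⟩), fun k s => ConcreteCategory.congr_hom (NatTrans.congr_app hl' k) s⟩,
    rfl, fun {m} θ h => LiftData.ext' (hα _ h).symm ?_⟩
  ext k c
  refine hl₁ (mem_fullUnion.2 (Or.inr ?_)) (Or.inr ⟨m, θ, h, c, rfl, rfl⟩)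
  obtain ⟨j, hj⟩ := not_forall.1 h
  refine ⟨j, fun i => (Cyl.in_map θ _).mono ?_⟩
  rintro _ ⟨y, rfl⟩ hy
  exact hj ⟨y, hy⟩

end Extension

end LiftData

section LiftProj

open Simplicial MonoidalCategory HomotopicalAlgebra SSet.modelCategoryQuillen Opposite

variable {B : Type (max u v)} [Category.{v} B] {P Q : SSet.{max u v}} {t : P ⟶ Q}
  {g : nerve (Str.{v} B) ⟶ P} {q : nerve B ⟶ Q}

lemma exists_embedding_factorization {m n : ℕ} (θ : Fin (m + 1) →o Fin (n + 1)) :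
    ∃ (l : ℕ) (ζ : Fin (l + 1) ↪o Fin (n + 1)) (η : Fin (m + 1) →o Fin (l + 1)),
      ζ.toOrderHom.comp η = θ ∧ Set.range ζ = Set.range θ := by
  obtain ⟨l, ζ, hζ⟩ := exists_orderEmbedding_range (Set.range θ) ⟨_, 0, rfl⟩
  have h (i : Fin (m + 1)) : ∃ j, ζ j = θ i := by
    change θ i ∈ Set.range ζ
    rw [hζ]
    exact ⟨i, rfl⟩
  choose f hf using h
  refine ⟨l, ζ, ⟨f, fun i j hij => ?_⟩, OrderHom.ext _ _ (funext hf), hζ⟩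
  rw [← ζ.le_iff_le, hf, hf]
  exact θ.monotone hij

lemma liftProj_rlp (hg : g ≫ t = nerveMap (Str.lv B) ≫ q) [Fibration t] :
    (MorphismProperty.monomorphisms SSet.{max u v}).rlp (liftProj t g q) := by
  rw [SSet.rlp_monomorphisms]
  rintro _ _ _ ⟨n⟩
  refine ⟨fun {top bot} sq => ?_⟩
  let mk {m : ℕ} (θ : Fin (m + 1) →o Fin (n + 1)) (h : ¬ Function.Surjective θ) :
      (∂Δ[n] : SSet.{max u v}).obj (op ⦋m⦌) :=
    ⟨ULift.up (SimplexCategory.Hom.mk θ), h⟩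
  let b {m : ℕ} (θ : Fin (m + 1) →o Fin (n + 1)) (h : ¬ Function.Surjective θ) :
      LiftData t g q m := top.app (op ⦋m⦌) (mk θ h)
  let α : Fin (n + 1) ⥤ B := SSet.yonedaEquiv bot
  have hα {m : ℕ} (θ : Fin (m + 1) →o Fin (n + 1)) (h) :
      (b θ h).α = θ.monotone.functor ⋙ α := by
    refine (ConcreteCategory.congr_hom (NatTrans.congr_app sq.w (op ⦋m⦌)) (mk θ h)).trans ?_
    exact ConcreteCategory.congr_hom (bot.naturality (SimplexCategory.mkHom θ).op)
      (SSet.stdSimplex.objEquiv.symm (𝟙 ⦋n⦌))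
  have hb {l m : ℕ} (η : Fin (l + 1) →o Fin (m + 1)) (θ : Fin (m + 1) →o Fin (n + 1)) (h) (h') :
      b (θ.comp η) h = (b θ h').pull η.monotone.functor :=
    ConcreteCategory.congr_hom (top.naturality (SimplexCategory.mkHom η).op) (mk θ h')
  obtain ⟨x, hx, hx'⟩ := exists_liftData hg hα hb
  have hx'' {m : ℕ} (θ : Fin (m + 1) →o Fin (n + 1)) (h : ¬ Function.Surjective θ) :
      x.pull θ.monotone.functor = b θ h := by
    obtain ⟨l, ζ, η, rfl, hζ⟩ := exists_embedding_factorization θ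
    have hs : ¬ Function.Surjective ζ.toOrderHom := by
      rw [← Set.range_eq_univ] at h ⊢
      exact fun h' => h (hζ.symm.trans h')
    rw [hb η ζ.toOrderHom h hs, ← hx' ζ hs]
    exact LiftData.pull_comp η.monotone.functor ζ.monotone.functor x
  refine ⟨⟨⟨(SSet.yonedaEquiv (X := liftSSet t g q) (n := ⦋n⦌)).symm x, ?_, ?_⟩⟩⟩
  · ext ⟨m⟩ ⟨⟨θ⟩, h⟩
    exact hx'' (SimplexCategory.Hom.toOrderHom θ) h
  · apply SSet.yonedaEquiv.injective
    refine Eq.trans ?_ hx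
    exact congrArg LiftData.α (LiftData.pull_id x)

lemma exists_liftProj_section (hg : g ≫ t = nerveMap (Str.lv B) ≫ q) [Fibration t] :
    ∃ s : nerve B ⟶ liftSSet t g q, s ≫ liftProj t g q = 𝟙 _ := by
  have : HasLiftingProperty (initial.to (nerve B)) (liftProj t g q) :=
    liftProj_rlp hg _ (MorphismProperty.monomorphisms.infer_property _)
  have sq : CommSq (initial.to _) (initial.to (nerve B)) (liftProj t g q)
    (𝟙 _) := ⟨initial.hom_ext _ _⟩
  exact ⟨sq.lift, sq.fac_right⟩

/-- The cylinder on strings inside `Cyl P`. -/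
def strCyl (P : Type) [PartialOrder P] : Fin 2 × Str.{w} P ⥤ Cyl.{w} P :=
  cylFunctor (Cyl.lvToSt P)

lemma strCyl_map {P P' : Type} [PartialOrder P] [PartialOrder P'] (F : P ⥤ P') :
    strCyl.{w} P ⋙ Cyl.map F = (𝟭 (Fin 2)).prod (Str.map.{w, w} F) ⋙ strCyl P' := by
  refine CategoryTheory.Functor.ext (fun x => ?_) (fun x y f => ?_)
  · obtain ⟨e, σ⟩ := x
    fin_cases e <;> rfl
  · obtain ⟨e, σ⟩ := x
    obtain ⟨e', σ'⟩ := y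
    obtain ⟨f₁, f₂⟩ := f
    obtain rfl | rfl : e = 0 ∨ e = 1 := by lia
    · exact Cyl.pt_hom_ext (i := F.obj ((Str.lv P).obj σ)) _ _
    · obtain rfl | rfl : e' = 0 ∨ e' = 1 := by lia
      · exact absurd (leOfHom f₁) (by decide : ¬ (1 : Fin 2) ≤ 0)
      · have key {P : Type} [PartialOrder P] {σ σ' : Str.{w} P} (f : σ ⟶ σ') :
            (strCyl P).map (X := ((1 : Fin 2), σ)) (Y := ((1 : Fin 2), σ')) (f₁, f) =
              (Cyl.inc P).map f :=
          Category.id_comp _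
        refine (congrArg (Cyl.map F).map (key f₂)).trans ((key ((Str.map F).map f₂)).symm.trans ?_)
        exact ((Category.id_comp _).trans (Category.comp_id _)).symm

end LiftProj

section LastVertexEquiv

open Simplicial MonoidalCategory HomotopicalAlgebra SSet.modelCategoryQuillen Opposite

variable {B : Type (max u v)} [Category.{v} B] {P Q : SSet.{max u v}} {t : P ⟶ Q}
  {g : nerve (Str.{v} B) ⟶ P} {q : nerve B ⟶ Q}

lemma cyl_zero_strCyl (P : Type) [PartialOrder P] {n : ℕ} (S : Fin (n + 1) ⥤ Str.{w} P) :
    (((SimplexCategory.Hom.toOrderHom (SimplexCategory.const ⦋n⦌ ⦋1⦌ 0)).monotone.functor.prod' S) ⋙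
      strCyl P) = (S ⋙ Str.lv P) ⋙ Cyl.pts P :=
  CategoryTheory.Functor.ext (fun _ => rfl) fun i _ _ =>
    Cyl.pt_hom_ext (i := (Str.lv P).obj (S.obj i)) _ _

lemma cyl_one_strCyl (P : Type) [PartialOrder P] {n : ℕ} (S : Fin (n + 1) ⥤ Str.{w} P) :
    (((SimplexCategory.Hom.toOrderHom (SimplexCategory.const ⦋n⦌ ⦋1⦌ 1)).monotone.functor.prod' S) ⋙
      strCyl P) = S ⋙ Cyl.inc P :=
  CategoryTheory.Functor.ext (fun _ => rfl) fun _ _ _ =>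
    (Category.id_comp _).trans ((Category.id_comp _).trans (Category.comp_id _)).symm

/-- The map out of the nerve given by a section of the simplicial set of lifts. -/
def sectionMap (s : nerve B ⟶ liftSSet t g q) : nerve B ⟶ P where
  app k := ↾fun α => (s.app k α).l.app k (Cyl.pts (Fin (k.unop.len + 1)))
  naturality k k' θ := by
    ext α
    have h : s.app k' ((nerve B).map θ α) = (s.app k α).pull (toFun θ.unop) :=
      ConcreteCategory.congr_hom (s.naturality θ) α
    refine (congrArg (fun x => (LiftData.l x).app k' (Cyl.pts (Fin (k'.unop.len + 1)))) h).trans ?_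
    refine Eq.trans ?_ (ConcreteCategory.congr_hom ((s.app k α).l.naturality θ) (Cyl.pts _))
    exact congrArg ((s.app k α).l.app k') (Cyl.pts_comp_map (toFun θ.unop))

lemma app_α {s : nerve B ⟶ liftSSet t g q} (hs : s ≫ liftProj t g q = 𝟙 _) {k : SimplexCategoryᵒᵖ}
    (α : (nerve B).obj k) : (s.app k α).α = α :=
  (ConcreteCategory.congr_hom (NatTrans.congr_app hs k) α :)

lemma sectionMap_comp {s : nerve B ⟶ liftSSet t g q} (hs : s ≫ liftProj t g q = 𝟙 _) :
    sectionMap s ≫ t = q := by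
  ext k α
  refine ((s.app k α).lift k (Cyl.pts (Fin (k.unop.len + 1)))).trans (congrArg (q.app k) ?_)
  rw [app_α hs]
  exact congrArg (fun F => F ⋙ α) (Cyl.pts_ret.{max u v} _)

/-- The homotopy between the composite of `sectionMap` with the last vertex map and the given
map. -/
def sectionHomotopy (s : nerve B ⟶ liftSSet t g q) : nerve (Str.{v} B) ⊗ Δ[1] ⟶ P where
  app k := ↾fun z => (s.app (op ⦋(z.1.obj (Fin.last _)).n⦌) (z.1.obj (Fin.last _)).fn).l.app k
    (((SimplexCategory.Hom.toOrderHom z.2.down).monotone.functor.prod' (Str.faces z.1)) ⋙ strCyl _)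
  naturality k k' θ := by
    ext z
    obtain ⟨S, ε⟩ := z
    let F := toFun θ.unop
    let e := S.map (homOfLE (Fin.le_last (F.obj (Fin.last _))))
    let G := (Str.Hom.emb e).monotone.functor
    let x := s.app (op ⦋(S.obj (Fin.last _)).n⦌) (S.obj (Fin.last _)).fn
    have h : s.app (op ⦋(S.obj (F.obj (Fin.last _))).n⦌) (S.obj (F.obj (Fin.last _))).fn =
        x.pull G :=
      (congrArg (s.app _) (Str.Hom.fac e)).trans
        (ConcreteCategory.congr_hom (s.naturality
          (SimplexCategory.mkHom (Str.Hom.emb e).toOrderHom).op) _)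
    let E := (SimplexCategory.Hom.toOrderHom ε.down).monotone.functor
    refine (congrArg (fun x : LiftData t g q _ => (LiftData.l x).app k'
      (((F ⋙ E).prod' (Str.faces (F ⋙ S))) ⋙ strCyl _)) h).trans ?_
    refine Eq.trans ?_ (ConcreteCategory.congr_hom (x.l.naturality θ) _)
    refine congrArg (x.l.app k') ?_
    refine Eq.trans (congrArg
      (fun K => (F ⋙ E).prod' (Str.faces.{v, max u v} (F ⋙ S)) ⋙ K) (strCyl_map.{max u v} G)) ?_
    exact congrArg (fun K => (F ⋙ E).prod' K ⋙ strCyl.{max u v} _) (Str.faces_comp.{v, max u v} S F)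

lemma cyl_one_sectionHomotopy {s : nerve B ⟶ liftSSet t g q} (hs : s ≫ liftProj t g q = 𝟙 _) :
    cyl _ 1 ≫ sectionHomotopy s = g := by
  ext k S
  refine (congrArg ((s.app (op ⦋(S.obj (Fin.last _)).n⦌) (S.obj (Fin.last _)).fn).l.app k)
    (cyl_one_strCyl _ (Str.faces S))).trans ?_
  refine ((s.app (op ⦋(S.obj (Fin.last _)).n⦌) (S.obj (Fin.last _)).fn).str k
    (Str.faces S)).trans (congrArg (g.app k) ?_)
  exact (congrArg (fun a => pushN (Str.map a) (Str.faces S)) (app_α hs _)).trans (Str.faces_map S)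

lemma cyl_zero_sectionHomotopy (s : nerve B ⟶ liftSSet t g q) :
    cyl _ 0 ≫ sectionHomotopy s = nerveMap (Str.lv B) ≫ sectionMap s := by
  ext k S
  refine (congrArg ((s.app (op ⦋(S.obj (Fin.last _)).n⦌) (S.obj (Fin.last _)).fn).l.app k)
    (cyl_zero_strCyl _ (Str.faces S))).trans ?_
  let K := Str.faces.{v, max u v} S ⋙ Str.lv.{max u v} _
  let x := s.app (op ⦋(S.obj (Fin.last _)).n⦌) (S.obj (Fin.last _)).fn
  have hK : K ⋙ (S.obj (Fin.last _)).fn = S ⋙ Str.lv B := by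
    refine Eq.trans ?_ (congrArg (fun S => S ⋙ Str.lv B) (Str.faces_map.{v, max u v} S))
    exact congrArg (fun F : Str.{max u v} _ ⥤ B => Str.faces.{v, max u v} S ⋙ F)
      (Str.map_lv.{max u v, v} (S.obj (Fin.last _)).fn).symm
  have h : s.app k (S ⋙ Str.lv B) = x.pull K :=
    (congrArg (s.app k) hK.symm).trans (ConcreteCategory.congr_hom (s.naturality
      (SimplexCategory.mkHom ⟨K.obj, K.monotone⟩ : k.unop ⟶ ⦋(S.obj (Fin.last _)).n⦌).op) _)
  refine Eq.trans ?_ (congrArg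
    (fun x : LiftData t g q _ => (LiftData.l x).app k (Cyl.pts _)) h.symm)
  exact congrArg (x.l.app k) (Cyl.pts_comp_map K).symm

end LastVertexEquiv

section LastVertexEquiv

open Simplicial MonoidalCategory HomotopicalAlgebra SSet.modelCategoryQuillen Opposite

lemma exists_extension_along_lv {B : Type (max u v)} [Category.{v} B] {P Q : SSet.{max u v}}
    (t : P ⟶ Q) [Fibration t] (g : nerve (Str.{v} B) ⟶ P) (q : nerve B ⟶ Q)
    (hg : g ≫ t = nerveMap (Str.lv B) ≫ q) :
    ∃ h : nerve B ⟶ P, h ≫ t = q ∧ SHomotopy (nerveMap (Str.lv B) ≫ h) g := by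
  obtain ⟨s, hs⟩ := exists_liftProj_section hg
  exact ⟨sectionMap s, sectionMap_comp hs, sHomotopy_iff.2
    ⟨sectionHomotopy s, cyl_zero_sectionHomotopy s, cyl_one_sectionHomotopy hs⟩⟩

/-- The path object of a simplicial set. -/
noncomputable abbrev pathObj (K : SSet.{w}) : SSet.{w} := (ihom (Δ[1] : SSet.{w})).obj K

/-- The homotopy corresponding to a map to the path object. -/
noncomputable def pathToHtpy {Y K : SSet.{w}} (φ : Y ⟶ pathObj K) : Y ⊗ Δ[1] ⟶ K :=
  (β_ Y Δ[1]).hom ≫ MonoidalClosed.uncurry φ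

/-- The map to the path object corresponding to a homotopy. -/
noncomputable def pathOfHtpy {Y K : SSet.{w}} (H : Y ⊗ Δ[1] ⟶ K) : Y ⟶ pathObj K :=
  MonoidalClosed.curry ((β_ Y Δ[1]).inv ≫ H)

lemma pathToHtpy_pathOfHtpy {Y K : SSet.{w}} (H : Y ⊗ Δ[1] ⟶ K) :
    pathToHtpy (pathOfHtpy H) = H := by
  simp [pathToHtpy, pathOfHtpy]

lemma pathToHtpy_injective {Y K : SSet.{w}} {φ ψ : Y ⟶ pathObj K}
    (h : pathToHtpy φ = pathToHtpy ψ) : φ = ψ := by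
  simpa [pathToHtpy, MonoidalClosed.uncurry_injective.eq_iff] using h

lemma comp_pathToHtpy {X Y K : SSet.{w}} (f : X ⟶ Y) (φ : Y ⟶ pathObj K) :
    pathToHtpy (f ≫ φ) = f ▷ Δ[1] ≫ pathToHtpy φ := by
  simp [pathToHtpy, MonoidalClosed.uncurry_natural_left]

/-- The endpoints of a path. -/
noncomputable def pathEnds (K : SSet.{w}) : pathObj K ⟶ K ⊗ K :=
  CartesianMonoidalCategory.lift (cyl _ 0 ≫ pathToHtpy (𝟙 _)) (cyl _ 1 ≫ pathToHtpy (𝟙 _))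

lemma comp_pathEnds {Y K : SSet.{w}} (φ : Y ⟶ pathObj K) :
    φ ≫ pathEnds K =
      CartesianMonoidalCategory.lift (cyl _ 0 ≫ pathToHtpy φ) (cyl _ 1 ≫ pathToHtpy φ) := by
  have h : pathToHtpy φ = φ ▷ Δ[1] ≫ pathToHtpy (𝟙 _) := by
    rw [← comp_pathToHtpy, Category.comp_id]
  rw [h, pathEnds, CartesianMonoidalCategory.comp_lift]
  rfl

instance {K : SSet.{w}} [SSet.KanComplex K] : Fibration (pathEnds K) := by
  rw [SSet.modelCategoryQuillen.fibration_iff]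
  intro A B k hk
  simp only [SSet.modelCategoryQuillen.J, MorphismProperty.iSup_iff] at hk
  obtain ⟨n, ⟨i⟩⟩ := hk
  have hk' := SSet.anodyneExtensions.horn_ι.{w} i
  refine ⟨fun {a b} sq => ?_⟩
  have h := sq.w
  rw [comp_pathEnds] at h
  have h0 : cyl _ 0 ≫ pathToHtpy a = (SSet.horn.{w} _ i).ι ≫ b ≫
      CartesianMonoidalCategory.fst _ _ := by
    rw [← Category.assoc, ← h, CartesianMonoidalCategory.lift_fst]
  have h1 : cyl _ 1 ≫ pathToHtpy a = (SSet.horn.{w} _ i).ι ≫ b ≫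
      CartesianMonoidalCategory.snd _ _ := by
    rw [← Category.assoc, ← h, CartesianMonoidalCategory.lift_snd]
  obtain ⟨L, hL, hL', -⟩ := exists_homotopy_of_anodyne _ hk' (terminal.from K) (pathToHtpy a)
    ![b ≫ CartesianMonoidalCategory.fst _ _, b ≫ CartesianMonoidalCategory.snd _ _]
    (terminal.from _) (by intro e; fin_cases e; exacts [h0, h1])
    (terminal.hom_ext _ _) (fun _ => terminal.hom_ext _ _)
  refine ⟨⟨⟨pathOfHtpy L, pathToHtpy_injective ?_, ?_⟩⟩⟩
  · rw [comp_pathToHtpy, pathToHtpy_pathOfHtpy, hL]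
  · rw [comp_pathEnds, pathToHtpy_pathOfHtpy, hL', hL']
    exact CartesianMonoidalCategory.hom_ext _ _ (by simp) (by simp)

/-- The last vertex map from the nerve of the category of strings of a category is a weak
homotopy equivalence. -/
theorem isWeakHomotopyEquiv_lv (B : Type (max u v)) [Category.{v} B] :
    IsWeakHomotopyEquiv (nerveMap (Str.lv.{v} B)) := by
  intro K hK
  have := hK.isFibrant
  refine ⟨fun g => ?_, fun h h' hh => ?_⟩
  · obtain ⟨h, -, hh⟩ := exists_extension_along_lv (terminal.from K) g (terminal.from _)
      (terminal.hom_ext _ _)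
    exact ⟨h, hh.htpy⟩
  · obtain ⟨H, h0, h1⟩ := sHomotopy_iff.1 (hh.sHomotopy hK)
    obtain ⟨φ, hφ, -⟩ := exists_extension_along_lv (pathEnds K) (pathOfHtpy H)
      (CartesianMonoidalCategory.lift h h') (by
        rw [comp_pathEnds, pathToHtpy_pathOfHtpy, h0, h1, CartesianMonoidalCategory.comp_lift])
    rw [comp_pathEnds] at hφ
    refine (sHomotopy_iff.2 ⟨pathToHtpy φ, ?_, ?_⟩).htpy
    · simpa using congrArg (fun f => f ≫ CartesianMonoidalCategory.fst _ _) hφ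
    · simpa using congrArg (fun f => f ≫ CartesianMonoidalCategory.snd _ _) hφ

end LastVertexEquiv

section Reedy

universe a b c d

variable {T : Type a} [Category.{b} T] {E : Type c} [Category.{d} E]

/-- The arrows with target `t` and source in `S`. -/
abbrev ArrowsFrom (S : Set T) (t : T) : Type max a b := Σ s : S, s.1 ⟶ t

instance [∀ t : T, Finite (Over t)] (S : Set T) (t : T) : Finite (ArrowsFrom S t) :=
  Finite.of_injective (fun d => (Over.mk d.2 : Over t)) fun d d' h => by
    obtain ⟨⟨s, hs⟩, f⟩ := d
    obtain ⟨⟨s', hs'⟩, f'⟩ := d'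
    obtain rfl : s = s' := congrArg (fun x : Over t => x.left) h
    simp only [Over.mk] at h
    injection h with _ _ h
    subst h
    rfl

variable [HasFiniteCoproducts E] [∀ t : T, Finite (Over t)] {S : Set T}

/-- The values of the free diagram on a family of objects. -/
noncomputable def freeObj (M : S → E) (t : T) : E := ∐ fun d : ArrowsFrom S t => M d.1

/-- The inclusion of a summand of a free diagram. -/
noncomputable def freeι (M : S → E) (s : S) {t : T} (f : s.1 ⟶ t) : M s ⟶ freeObj M t :=
  Sigma.ι (fun d : ArrowsFrom S t => M d.1) ⟨s, f⟩

variable {M : S → E}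

lemma free_hom_ext {t : T} {Z : E} {g h : freeObj M t ⟶ Z}
    (H : ∀ (s : S) (f : s.1 ⟶ t), freeι M s f ≫ g = freeι M s f ≫ h) : g = h :=
  Sigma.hom_ext _ _ fun d => H d.1 d.2

/-- Maps out of the values of a free diagram. -/
noncomputable def freeOut {t : T} {Z : E} (φ : ∀ s : S, (s.1 ⟶ t) → (M s ⟶ Z)) :
    freeObj M t ⟶ Z :=
  Sigma.desc fun d => φ d.1 d.2

@[simp]
lemma freeι_out {t : T} {Z : E} (φ : ∀ s : S, (s.1 ⟶ t) → (M s ⟶ Z)) (s : S) (f : s.1 ⟶ t) :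
    freeι M s f ≫ freeOut φ = φ s f :=
  Sigma.ι_desc _ _

@[simp]
lemma freeι_out_assoc {t : T} {Z Z' : E} (φ : ∀ s : S, (s.1 ⟶ t) → (M s ⟶ Z)) (s : S)
    (f : s.1 ⟶ t) (g : Z ⟶ Z') : freeι M s f ≫ freeOut φ ≫ g = φ s f ≫ g := by
  rw [← Category.assoc, freeι_out]

variable (M) in
/-- The free diagram on a family of objects. -/
noncomputable def freeDiagram : T ⥤ E where
  obj := freeObj M
  map f := freeOut fun s g => freeι M s (g ≫ f)
  map_id t := free_hom_ext fun s f => by simp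
  map_comp f g := free_hom_ext fun s h => by simp

/-- The inclusion of a summand of a free diagram. -/
noncomputable def freeIn (M : S → E) (s : S) {t : T} (f : s.1 ⟶ t) :
    M s ⟶ (freeDiagram M).obj t :=
  freeι M s f

lemma freeDiagram_hom_ext {t : T} {Z : E} {g h : (freeDiagram M).obj t ⟶ Z}
    (H : ∀ (s : S) (f : s.1 ⟶ t), freeIn M s f ≫ g = freeIn M s f ≫ h) : g = h :=
  free_hom_ext H

/-- Maps out of free diagrams. -/
noncomputable def freeDesc {X : T ⥤ E} (φ : ∀ s : S, M s ⟶ X.obj s.1) : freeDiagram M ⟶ X where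
  app t := freeOut fun s f => φ s ≫ X.map f
  naturality t t' f := free_hom_ext fun s g => by simp [freeDiagram]

lemma freeIn_desc {X : T ⥤ E} (φ : ∀ s : S, M s ⟶ X.obj s.1) (s : S) {t : T} (f : s.1 ⟶ t) :
    freeIn M s f ≫ (freeDesc φ).app t = φ s ≫ X.map f :=
  freeι_out (fun s f => φ s ≫ X.map f) s f

/-- The functoriality of free diagrams. -/
noncomputable def freeMap {M' : S → E} (φ : ∀ s : S, M s ⟶ M' s) :
    freeDiagram M ⟶ freeDiagram M' where
  app t := freeOut fun s f => φ s ≫ freeι M' s f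
  naturality t t' f := free_hom_ext fun s g => by simp [freeDiagram]

lemma freeIn_freeMap {M' : S → E} (φ : ∀ s : S, M s ⟶ M' s) (s : S) {t : T} (f : s.1 ⟶ t) :
    freeIn M s f ≫ (freeMap φ).app t = φ s ≫ freeIn M' s f :=
  freeι_out (fun s f => φ s ≫ freeι M' s f) s f

lemma llp_freeMap {R : MorphismProperty E} {M' : S → E} {φ : ∀ s : S, M s ⟶ M' s}
    (h : ∀ s, R.llp (φ s)) (t : T) : R.llp ((freeMap φ).app t) := by
  have : (freeMap φ).app t = Limits.Sigma.map (f := fun d : ArrowsFrom S t => M d.1)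
      (g := fun d : ArrowsFrom S t => M' d.1) fun d => φ d.1 :=
    free_hom_ext fun s f => (freeIn_freeMap φ s f).trans
      (Sigma.ι_map (f := fun d : ArrowsFrom S t => M d.1)
        (g := fun d : ArrowsFrom S t => M' d.1) (fun d => φ d.1) ⟨s, f⟩).symm
  rw [this]
  exact MorphismProperty.colimMap (W := R.llp)
    (X := Discrete.functor fun d : ArrowsFrom S t => M d.1)
    (Y := Discrete.functor fun d : ArrowsFrom S t => M' d.1) _ fun d => h d.as.1

lemma isIso_freeIn {s : S} (h : ∀ s' ∈ S, ∀ f : s' ⟶ s.1, Over.mk f = Over.mk (𝟙 s.1)) :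
    IsIso (freeIn M s (𝟙 s.1)) := by
  have key : ∀ (s' : S) (f : s'.1 ⟶ s.1), ∃ e : s' = s, f = eqToHom (congrArg Subtype.val e) := by
    rintro ⟨s', hs'⟩ f
    have h := h s' hs' f
    obtain rfl : s' = s.1 := congrArg (fun x : Over s.1 => x.left) h
    simp only [Over.mk] at h
    injection h with _ _ h
    exact ⟨rfl, h⟩
  refine ⟨freeOut fun s' f => eqToHom (by rw [(key s' f).1]),
    (freeι_out (M := M) _ s (𝟙 s.1)).trans (by simp), free_hom_ext fun s' f => ?_⟩
  refine (freeι_out_assoc (M := M) _ s' f _).trans ?_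
  obtain ⟨rfl, rfl⟩ := key s' f
  simp [freeIn, freeDiagram]

variable [HasPushouts E]

lemma exists_partial_factorization {R : MorphismProperty E} [R.RespectsIso]
    (hR : ∀ {X Y : E} (f : X ⟶ Y), ∃ (Z : E) (l : X ⟶ Z) (r : Z ⟶ Y), R.llp l ∧ R r ∧ l ≫ r = f)
    (S : Set T) (hS : ∀ s ∈ S, ∀ s' ∈ S, ∀ f : s' ⟶ s, Over.mk f = Over.mk (𝟙 s))
    {X Y : T ⥤ E} (p : X ⟶ Y) :
    ∃ (X' : T ⥤ E) (i : X ⟶ X') (q : X' ⟶ Y), i ≫ q = p ∧ (∀ t, R.llp (i.app t)) ∧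
      ∀ s ∈ S, R (q.app s) := by
  classical
  choose Z l r hl hr hlr using fun s : S => hR (p.app s.1)
  have sq : freeDesc (M := fun s : S => X.obj s.1) (X := X) (fun s => 𝟙 _) ≫ p =
      freeMap l ≫ freeDesc r := by
    ext t
    refine freeDiagram_hom_ext fun s f => ?_
    simp only [NatTrans.comp_app]
    rw [← Category.assoc, freeIn_desc, ← Category.assoc, freeIn_freeMap, Category.assoc,
      Category.assoc,
      freeIn_desc,
      ← Category.assoc (l s), hlr]
    simp
  let χ := freeDesc (M := fun s : S => X.obj s.1) (X := X) (fun s => 𝟙 _)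
  let q : pushout χ (freeMap l) ⟶ Y := pushout.desc p (freeDesc r) sq
  have po (t : T) : IsPushout (χ.app t) ((freeMap l).app t) ((pushout.inl χ (freeMap l)).app t)
      ((pushout.inr χ (freeMap l)).app t) :=
    (IsPushout.of_hasPushout χ (freeMap l)).map ((evaluation T E).obj t)
  refine ⟨_, pushout.inl _ _, q, pushout.inl_desc _ _ _, fun t => ?_, fun s hs => ?_⟩
  · exact MorphismProperty.of_isPushout (P := R.llp) (po t) (llp_freeMap hl t)
  · have h1 : IsIso (freeIn (fun s : S => X.obj s.1) ⟨s, hs⟩ (𝟙 s)) := isIso_freeIn (hS s hs)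
    have h2 : IsIso (freeIn Z ⟨s, hs⟩ (𝟙 s)) := isIso_freeIn (hS s hs)
    have h3 : IsIso (χ.app s) := by
      have : freeIn (fun s : S => X.obj s.1) ⟨s, hs⟩ (𝟙 s) ≫ χ.app s = 𝟙 (X.obj s) :=
        (freeIn_desc (M := fun s : S => X.obj s.1) (X := X) (fun s => 𝟙 _) ⟨s, hs⟩ (𝟙 s)).trans
          (by simp)
      have h4 : IsIso (freeIn (fun s : S => X.obj s.1) ⟨s, hs⟩ (𝟙 s) ≫ χ.app s) := by
        rw [this]; infer_instance
      exact IsIso.of_isIso_comp_left (freeIn (fun s : S => X.obj s.1) ⟨s, hs⟩ (𝟙 s)) _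
    have h5 : IsIso ((pushout.inr χ (freeMap l)).app s) :=
      MorphismProperty.of_isPushout (P := MorphismProperty.isomorphisms E) (po s).flip h3
    have h6 : freeIn Z ⟨s, hs⟩ (𝟙 s) ≫ (pushout.inr _ (freeMap l)).app s ≫ q.app s = r ⟨s, hs⟩ := by
      rw [← NatTrans.comp_app, pushout.inr_desc, freeIn_desc]
      simp
    have h7 := hr ⟨s, hs⟩
    rw [← h6, R.cancel_left_of_respectsIso, R.cancel_left_of_respectsIso] at h7
    exact h7

/-- Factorizations of maps of diagrams of the shape of a direct category. -/
theorem exists_direct_factorization {R : MorphismProperty E} [R.RespectsIso]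
    (hR : ∀ {X Y : E} (f : X ⟶ Y), ∃ (Z : E) (l : X ⟶ Z) (r : Z ⟶ Y), R.llp l ∧ R r ∧ l ≫ r = f)
    (rk : T → ℕ) (rk_le : ∀ {s t : T}, (s ⟶ t) → rk s ≤ rk t)
    (rk_eq : ∀ {s t : T} (f : s ⟶ t), rk s = rk t → Over.mk f = Over.mk (𝟙 t))
    {X Y : T ⥤ E} (p : X ⟶ Y) :
    ∃ (Z : T ⥤ E) (i : X ⟶ Z) (q : Z ⟶ Y), i ≫ q = p ∧ (∀ t, R.llp (i.app t)) ∧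
      ∀ t, R (q.app t) := by
  have step (n : ℕ) (A : Over Y) : ∃ (A' : Over Y) (i : A ⟶ A'), (∀ t, R.llp (i.left.app t)) ∧
      ∀ t, rk t = n → R (A'.hom.app t) := by
    obtain ⟨X', i, q, h, h1, h2⟩ := exists_partial_factorization (R := R) hR {t | rk t = n}
      (fun s hs s' hs' f => rk_eq f (hs'.trans hs.symm)) A.hom
    exact ⟨Over.mk q, Over.homMk i h, h1, h2⟩
  choose N ν h1 h2 using step
  let A : ℕ → Over Y := fun n => Nat.rec (Over.mk p) (fun n A => N n A) n
  let F : ℕ ⥤ Over Y := Functor.ofSequence (X := A) fun n => ν n (A n)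
  have hF : ∀ {m n : ℕ} (f : m ⟶ n) (t : T), R.llp ((F.map f).left.app t) := by
    intro m n f t
    obtain ⟨k, rfl⟩ := Nat.exists_eq_add_of_le (leOfHom f)
    induction k with
    | zero =>
      obtain rfl : f = 𝟙 _ := Subsingleton.elim _ _
      simpa using R.llp.id_mem _
    | succ k ih =>
      obtain rfl : f = homOfLE (Nat.le_add_right m k) ≫ homOfLE (Nat.le_add_right (m + k) 1) :=
        Subsingleton.elim _ _
      rw [F.map_comp, Functor.ofSequence_map_homOfLE_succ]
      exact R.llp.comp_mem _ _ (ih _) (h1 _ _ _)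
  let Z : T ⥤ E :=
    { obj := fun t => (F.obj (rk t + 1)).left.obj t
      map := fun {s t} f => (F.obj (rk s + 1)).left.map f ≫
        (F.map (homOfLE (Nat.succ_le_succ (rk_le f)))).left.app t
      map_id := fun t => by
        have : homOfLE (Nat.succ_le_succ (rk_le (𝟙 t))) = 𝟙 (rk t + 1) := Subsingleton.elim _ _
        rw [this]
        simp
      map_comp := fun {r s t} f g => by
        have : homOfLE (Nat.succ_le_succ (rk_le (f ≫ g))) =
            homOfLE (Nat.succ_le_succ (rk_le f)) ≫ homOfLE (Nat.succ_le_succ (rk_le g)) :=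
          Subsingleton.elim _ _
        rw [this, F.map_comp, Over.comp_left, NatTrans.comp_app, Functor.map_comp]
        simp only [Category.assoc, NatTrans.naturality_assoc] }
  refine ⟨Z, { app := fun t => (F.map (homOfLE (Nat.zero_le (rk t + 1)))).left.app t
               naturality := fun s t f => ?_ },
    { app := fun t => (F.obj (rk t + 1)).hom.app t
      naturality := fun s t f => ?_ }, ?_, fun t => hF _ t,
    fun t => h2 _ _ t rfl⟩
  · have : homOfLE (Nat.zero_le (rk t + 1)) =
        homOfLE (Nat.zero_le (rk s + 1)) ≫ homOfLE (Nat.succ_le_succ (rk_le f)) :=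
      Subsingleton.elim _ _
    have e : (F.map (homOfLE (Nat.zero_le (rk t + 1)))).left.app t =
        (F.map (homOfLE (Nat.zero_le (rk s + 1)))).left.app t ≫
          (F.map (homOfLE (Nat.succ_le_succ (rk_le f)))).left.app t := by
      rw [this, F.map_comp, Over.comp_left, NatTrans.comp_app]
    have := (F.map (homOfLE (Nat.zero_le (rk s + 1)))).left.naturality f
    exact (congrArg (_ ≫ ·) e).trans ((Category.assoc _ _ _).symm.trans
      ((congrArg (· ≫ _) this).trans (Category.assoc _ _ _)))
  · have h := congrArg (fun α => NatTrans.app α t)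
      (Over.w (F.map (homOfLE (Nat.succ_le_succ (rk_le f)))))
    dsimp only [NatTrans.comp_app] at h
    have h' := (F.obj (rk s + 1)).hom.naturality f
    exact (Category.assoc _ _ _).trans ((congrArg (_ ≫ ·) h).trans h')
  · ext t
    have h := Over.w (F.map (homOfLE (Nat.zero_le (rk t + 1))))
    exact NatTrans.congr_app h t

end Reedy

section Direct

universe a b a' b' c d

lemma over_mk_cases {T : Type a} [Category.{b} T] {s s' t : T} {f : s ⟶ t} {g : s' ⟶ t}
    (h : Over.mk f = Over.mk g) : s = s' ∧ HEq f g := by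
  obtain rfl : s = s' := congrArg (fun x : Over t => x.left) h
  simp only [Over.mk] at h
  injection h with _ _ h
  exact ⟨rfl, heq_of_eq h⟩

/-- A direct category with finite slices. -/
structure IsDirect (T : Type a) [Category.{b} T] : Prop where
  finite_over : ∀ t : T, Finite (Over t)
  exists_rank : ∃ rk : T → ℕ, (∀ {s t : T}, (s ⟶ t) → rk s ≤ rk t) ∧
    ∀ {s t : T} (f : s ⟶ t), rk s = rk t → Over.mk f = Over.mk (𝟙 t)

namespace IsDirect

theorem exists_factorization {T : Type a} [Category.{b} T] (hT : IsDirect T)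
    {E : Type c} [Category.{d} E] [HasFiniteCoproducts E] [HasPushouts E]
    {R : MorphismProperty E} [R.RespectsIso]
    (hR : ∀ {X Y : E} (f : X ⟶ Y), ∃ (Z : E) (l : X ⟶ Z) (r : Z ⟶ Y), R.llp l ∧ R r ∧ l ≫ r = f)
    {X Y : T ⥤ E} (p : X ⟶ Y) :
    ∃ (Z : T ⥤ E) (i : X ⟶ Z) (q : Z ⟶ Y), i ≫ q = p ∧ (∀ t, R.llp (i.app t)) ∧
      ∀ t, R (q.app t) := by
  have := hT.finite_over
  obtain ⟨rk, h1, h2⟩ := hT.exists_rank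
  exact exists_direct_factorization hR rk h1 h2 p

lemma over_mk_prod {T : Type a} [Category.{b} T] {T' : Type a'} [Category.{b'} T']
    {s s' t : T × T'} {f : s ⟶ t} {g : s' ⟶ t} (h1 : Over.mk f.1 = Over.mk g.1)
    (h2 : Over.mk f.2 = Over.mk g.2) : Over.mk f = Over.mk g := by
  obtain ⟨s1, s2⟩ := s
  obtain ⟨s1', s2'⟩ := s'
  obtain ⟨f1, f2⟩ := f
  obtain ⟨g1, g2⟩ := g
  obtain ⟨rfl, h1⟩ := over_mk_cases h1
  obtain ⟨rfl, h2⟩ := over_mk_cases h2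
  obtain rfl := eq_of_heq h1
  obtain rfl := eq_of_heq h2
  rfl

lemma prod {T : Type a} [Category.{b} T] {T' : Type a'} [Category.{b'} T'] (h : IsDirect T)
    (h' : IsDirect T') : IsDirect (T × T') where
  finite_over t := by
    have := h.finite_over t.1
    have := h'.finite_over t.2
    refine Finite.of_injective (β := Over t.1 × Over t.2)
      (fun x => (Over.mk x.hom.1, Over.mk x.hom.2)) fun x y hxy => ?_
    rw [Prod.ext_iff] at hxy
    exact over_mk_prod (f := x.hom) (g := y.hom) hxy.1 hxy.2
  exists_rank := by
    obtain ⟨rk, h1, h2⟩ := h.exists_rank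
    obtain ⟨rk', h1', h2'⟩ := h'.exists_rank
    refine ⟨fun t => rk t.1 + rk' t.2, fun f => add_le_add (h1 f.1) (h1' f.2), fun {s t} f e => ?_⟩
    have e1 := h1 f.1
    have e2 := h1' f.2
    dsimp only at e
    exact over_mk_prod (g := 𝟙 t) (h2 f.1 (by omega)) (h2' f.2 (by omega))

lemma of_finite (Q : Type a) [PartialOrder Q] [Finite Q] : IsDirect Q where
  finite_over q := Finite.of_injective (fun x : Over q => x.left) fun x y h => by
    obtain ⟨x, ⟨⟨⟩⟩, f⟩ := x
    obtain ⟨y, ⟨⟨⟩⟩, g⟩ := y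
    obtain rfl : x = y := h
    obtain rfl : f = g := Subsingleton.elim (α := x ⟶ q) _ _
    rfl
  exists_rank := by
    refine ⟨fun q => (Set.Iio q).ncard, fun f =>
      Set.ncard_le_ncard (Set.Iio_subset_Iio (leOfHom f)) (Set.toFinite _), fun {s t} f h => ?_⟩
    obtain rfl | hst := (leOfHom f).eq_or_lt
    · obtain rfl : f = 𝟙 _ := Subsingleton.elim _ _
      rfl
    · exact absurd h (Set.ncard_lt_ncard (Set.Iio_ssubset_Iio hst) (Set.toFinite _)).ne

lemma of_equal {B : Type a} [Category.{b} B] {σ σ' τ : Str.{w} B} {f : σ ⟶ τ} {g : σ' ⟶ τ}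
    (h : Set.range (Str.Hom.emb f) = Set.range (Str.Hom.emb g)) : Over.mk f = Over.mk g := by
  obtain ⟨m, σ⟩ := σ
  obtain ⟨m', σ'⟩ := σ'
  obtain ⟨e, he⟩ := f
  obtain ⟨e', he'⟩ := g
  dsimp only at h
  have : m + 1 = m' + 1 := by
    have := congrArg Set.ncard h
    simpa [← Set.image_univ, Set.ncard_image_of_injective _ e.injective,
      Set.ncard_image_of_injective _ e'.injective] using this
  obtain rfl : m = m' := by omega
  obtain rfl := OrderEmbedding.range_inj.1 h
  dsimp only at he he'
  obtain rfl := he.trans he'.symm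
  rfl

lemma str (B : Type a) [Category.{b} B] : IsDirect (Str.{w} B) where
  finite_over τ := Finite.of_injective
    (fun x : Over τ => Set.range (Str.Hom.emb x.hom)) fun x y h => of_equal h
  exists_rank := by
    refine ⟨Str.n, fun {s t} f => ?_, fun {s t} f h => of_equal ?_⟩
    · have := Fintype.card_le_of_injective _ (Str.Hom.emb f).injective
      simpa using this
    · have h1 : Function.Surjective (Str.Hom.emb f) :=
        ((Fintype.bijective_iff_injective_and_card _).2
          ⟨(Str.Hom.emb f).injective, by simp [h]⟩).2
      rw [h1.range_eq]
      exact (Set.range_id).symm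

end IsDirect

end Direct

section EssImage

lemma exists_lift_of_essImage {A B X : Type*} [Category A] [Category B] [Category X] (ι : A ⥤ B)
    [ι.Full] [ι.Faithful] (F : X ⥤ B) (h : ∀ x, ι.essImage (F.obj x)) :
    ∃ P : X ⥤ A, Nonempty (P ⋙ ι ≅ F) :=
  ⟨{ obj := fun x => (h x).witness
     map := fun f => ι.preimage ((h _).getIso.hom ≫ F.map f ≫ (h _).getIso.inv)
     map_id := fun x => ι.map_injective (by simp)
     map_comp := fun f g => ι.map_injective (by simp) },
    ⟨NatIso.ofComponents (fun x => (h x).getIso) (fun f => by simp)⟩⟩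

lemma exists_natTrans_of_comp {A B X : Type*} [Category A] [Category B] [Category X] (ι : A ⥤ B)
    [ι.Full] [ι.Faithful] {P P' : X ⥤ A} (α : P ⋙ ι ⟶ P' ⋙ ι) : Nonempty (P ⟶ P') :=
  ⟨{ app := fun x => ι.preimage (α.app x)
     naturality := fun x y f => ι.map_injective (by simpa using α.naturality f) }⟩

/-- A fully faithful functor induces a weak homotopy equivalence on nerves if strings
can be deformed into its essential image. -/
theorem isWeakHomotopyEquiv_of_deformation {A B : Type (max u v)} [Category.{v} A] [Category.{v} B]
    (ι : A ⥤ B) [ι.Full] [ι.Faithful] {ρ : Str.{v} B ⥤ B}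
    (h : Htpy (nerveMap (Str.lv.{v} B)) (nerveMap ρ)) (hρ : ∀ σ, ι.essImage (ρ.obj σ))
    {μ : Str.{v} A ⥤ B} (hμ : ∀ σ, ι.essImage (μ.obj σ))
    (α : μ ⟶ Str.map.{v, v} ι ⋙ ρ) (β : μ ⟶ Str.map.{v, v} ι ⋙ Str.lv B) :
    IsWeakHomotopyEquiv (nerveMap ι) := by
  obtain ⟨P, ⟨eP⟩⟩ := exists_lift_of_essImage ι ρ hρ
  obtain ⟨M, ⟨eM⟩⟩ := exists_lift_of_essImage ι μ hμ
  obtain ⟨γ⟩ : Nonempty (M ⟶ Str.map ι ⋙ P) := exists_natTrans_of_comp ι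
    (eM.hom ≫ α ≫ Functor.whiskerLeft (Str.map ι) eP.inv)
  obtain ⟨δ⟩ : Nonempty (M ⟶ Str.lv A) := exists_natTrans_of_comp ι
    (eM.hom ≫ β ≫ eqToHom (Str.map_lv ι))
  refine IsWeakHomotopyEquiv.two_of_six (f := nerveMap (Str.map.{v, v} ι)) (g := nerveMap P) ?_ ?_
  · exact (isWeakHomotopyEquiv_lv A).congr
      ((htpy_of_natTrans δ).symm.trans (htpy_of_natTrans γ))
  · exact (isWeakHomotopyEquiv_lv B).congr (h.trans (htpy_of_natTrans eP.inv))

end EssImage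

section Framed

universe a b

variable {R : Type u} [Category.{v} R]

/-- A family, indexed by `T`, of diagrams of shape `Q` and of weak equivalences between them,
framed by weak equivalences to `x` and from `y`. -/
structure Framed (ρ : RelCatStruct R) (x y : R) (T : Type a) [Category.{b} T]
    (Q : Type) [PartialOrder Q] (qx qy : Q) where
  /-- the diagram -/
  c : T × Q ⥤ R
  /-- the map to `x` -/
  l (t : T) : c.obj (t, qx) ⟶ x
  hl (t : T) : ρ.W (l t)
  /-- the map from `y` -/
  r (t : T) : y ⟶ c.obj (t, qy)
  hr (t : T) : ρ.W (r t)
  l_nat {s t : T} (f : s ⟶ t) : c.map (Prod.mkHom f (𝟙 qx)) ≫ l t = l s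
  r_nat {s t : T} (f : s ⟶ t) : r s ≫ c.map (Prod.mkHom f (𝟙 qy)) = r t
  hW {s t : T} (f : s ⟶ t) (q : Q) : ρ.W (c.map (Prod.mkHom f (𝟙 q)))

namespace Framed

variable {ρ : RelCatStruct R} {x y : R} {T : Type a} [Category.{b} T]
  {Q : Type} [PartialOrder Q] {qx qy : Q}

/-- A map of framed diagrams. -/
structure Hom (E E' : Framed ρ x y T Q qx qy) where
  /-- the underlying map of diagrams -/
  α : E.c ⟶ E'.c
  hα (p : T × Q) : ρ.W (α.app p)
  α_l (t : T) : α.app (t, qx) ≫ E'.l t = E.l t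
  α_r (t : T) : E.r t ≫ α.app (t, qy) = E'.r t

end Framed

/-- The two-out-of-three property, together with the condition that isomorphisms are
weak equivalences. -/
structure RelCatStruct.IsSaturated (ρ : RelCatStruct R) : Prop where
  of_precomp {a b c : R} (f : a ⟶ b) (g : b ⟶ c) : ρ.W f → ρ.W (f ≫ g) → ρ.W g
  of_postcomp {a b c : R} (f : a ⟶ b) (g : b ⟶ c) : ρ.W g → ρ.W (f ≫ g) → ρ.W f
  of_isIso {a b : R} (f : a ⟶ b) [IsIso f] : ρ.W f

/-- Pairs of weak factorization systems which allow to replace zigzags from `x` to `y` by zigzags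
of objects satisfying `cf`. -/
structure ReplacementSystem (ρ : RelCatStruct R) (x y : R) (cf : R → Prop) where
  /-- an initial object -/
  bot : R
  isInitial : IsInitial bot
  /-- a terminal object -/
  top : R
  isTerminal : IsTerminal top
  /-- the right class of the first factorization system -/
  R₁ : MorphismProperty R
  /-- the right class of the second factorization system -/
  R₂ : MorphismProperty R
  respectsIso₁ : R₁.RespectsIso
  respectsIso₂ : R₂.RespectsIso
  fact₁ {a b : R} (f : a ⟶ b) : ∃ (c : R) (i : a ⟶ c) (p : c ⟶ b), R₁.llp i ∧ R₁ p ∧ i ≫ p = f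
  fact₂ {a b : R} (f : a ⟶ b) : ∃ (c : R) (i : a ⟶ c) (p : c ⟶ b), R₂.llp i ∧ R₂ p ∧ i ≫ p = f
  W_of_R₁ {a b : R} (f : a ⟶ b) : R₁ f → ρ.W f
  W_of_llp_R₂ {a b : R} (f : a ⟶ b) : R₂.llp f → ρ.W f
  isIso_of_R₁ {a b : R} (f : a ⟶ b) (g : y ⟶ b) : R₁ f → ρ.W g → IsIso f
  isIso_of_llp_R₂ {a b : R} (f : a ⟶ b) (g : a ⟶ x) : R₂.llp f → ρ.W g → IsIso f
  cf_of_R₁ {a b : R} (f : a ⟶ b) : R₁.llp (isInitial.to a) → R₁ f → cf b → cf a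
  cf_of_llp_R₂ {a b : R} (f : a ⟶ b) : R₁.llp (isInitial.to a) → R₂.llp f →
    R₂ (isTerminal.from b) → cf b

variable {ρ : RelCatStruct R} {x y : R} {T : Type a} [Category.{b} T]
  {Q : Type} [PartialOrder Q] {qx qy : Q}

lemma Framed.Hom.W_iff (hρ : ρ.IsSaturated) {E E' : Framed ρ x y T Q qx qy} (φ : Hom E E')
    {p q : T × Q} (f : p ⟶ q) : ρ.W (E.c.map f) ↔ ρ.W (E'.c.map f) := by
  have h := φ.α.naturality f
  constructor
  · intro hf
    refine hρ.of_precomp (φ.α.app p) _ (φ.hα p) ?_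
    rw [← h]
    exact ρ.W_comp _ _ hf (φ.hα q)
  · intro hf
    refine hρ.of_postcomp _ (φ.α.app q) (φ.hα q) ?_
    rw [h]
    exact ρ.W_comp _ _ (φ.hα p) hf

theorem Framed.exists_replacement [HasFiniteCoproducts R] [HasPushouts R] (hρ : ρ.IsSaturated)
    {cf : R → Prop} (S : ReplacementSystem ρ x y cf) (hT : IsDirect T) [Finite Q]
    (E : Framed ρ x y T Q qx qy) :
    ∃ (E₁ E₂ : Framed ρ x y T Q qx qy) (_ : Hom E₁ E) (_ : Hom E₁ E₂),
      (∀ p, cf (E₂.c.obj p)) ∧ ∀ p, cf (E.c.obj p) → cf (E₁.c.obj p) := by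
  have hTQ : IsDirect (T × Q) := hT.prod (.of_finite Q)
  have := S.respectsIso₁
  have := S.respectsIso₂
  obtain ⟨c₁, i, α, -, hi, hα⟩ := hTQ.exists_factorization S.fact₁
    (X := (Functor.const _).obj S.bot) (Y := E.c)
    { app := fun p => S.isInitial.to _, naturality := fun _ _ _ => S.isInitial.hom_ext _ _ }
  obtain ⟨c₂, β, e, -, hβ, he⟩ := hTQ.exists_factorization S.fact₂
    (X := c₁) (Y := (Functor.const _).obj S.top)
    { app := fun p => S.isTerminal.from _, naturality := fun _ _ _ => S.isTerminal.hom_ext _ _ }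
  have hi (p) : S.R₁.llp (S.isInitial.to (c₁.obj p)) := by
    rw [S.isInitial.hom_ext (S.isInitial.to _) (i.app p)]
    exact hi p
  have he (p) : S.R₂ (S.isTerminal.from (c₂.obj p)) := by
    rw [S.isTerminal.hom_ext (S.isTerminal.from _) (e.app p)]
    exact he p
  have hαW (p) : ρ.W (α.app p) := S.W_of_R₁ _ (hα p)
  have hβW (p) : ρ.W (β.app p) := S.W_of_llp_R₂ _ (hβ p)
  have hα' (t : T) : IsIso (α.app (t, qy)) := S.isIso_of_R₁ _ (E.r t) (hα _) (E.hr t)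
  have hl' (t : T) : ρ.W (α.app (t, qx) ≫ E.l t) := ρ.W_comp _ _ (hαW _) (E.hl t)
  have hβ' (t : T) : IsIso (β.app (t, qx)) := S.isIso_of_llp_R₂ _ (α.app (t, qx) ≫ E.l t) (hβ _)
    (hl' t)
  have hr' (t : T) : ρ.W (E.r t ≫ inv (α.app (t, qy))) :=
    ρ.W_comp _ _ (E.hr t) (hρ.of_isIso _)
  let E₁ : Framed ρ x y T Q qx qy :=
    { c := c₁
      l := fun t => α.app (t, qx) ≫ E.l t
      hl := hl'
      r := fun t => E.r t ≫ inv (α.app (t, qy))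
      hr := hr'
      l_nat := fun f => by rw [α.naturality_assoc, E.l_nat]
      r_nat := fun {s t} f => by
        rw [← cancel_mono (α.app (t, qy)), Category.assoc, Category.assoc, α.naturality,
          IsIso.inv_hom_id_assoc, E.r_nat, Category.assoc, IsIso.inv_hom_id, Category.comp_id]
      hW := fun f q => by
        refine hρ.of_postcomp _ (α.app _) (hαW _) ?_
        rw [α.naturality]
        exact ρ.W_comp _ _ (hαW _) (E.hW f q) }
  let E₂ : Framed ρ x y T Q qx qy :=
    { c := c₂
      l := fun t => inv (β.app (t, qx)) ≫ E₁.l t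
      hl := fun t => ρ.W_comp _ _ (hρ.of_isIso _) (E₁.hl t)
      r := fun t => E₁.r t ≫ β.app (t, qy)
      hr := fun t => ρ.W_comp _ _ (E₁.hr t) (hβW _)
      l_nat := fun {s t} f => by
        rw [← cancel_epi (β.app (s, qx)), IsIso.hom_inv_id_assoc, ← β.naturality_assoc,
          IsIso.hom_inv_id_assoc]
        exact E₁.l_nat f
      r_nat := fun {s t} f => by
        rw [Category.assoc, ← β.naturality, ← Category.assoc]
        exact congrArg (· ≫ _) (E₁.r_nat f)
      hW := fun f q => by
        refine hρ.of_precomp (β.app _) _ (hβW _) ?_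
        rw [← β.naturality]
        exact ρ.W_comp _ _ (E₁.hW f q) (hβW _) }
  exact ⟨E₁, E₂, ⟨α, hαW, fun t => rfl, fun t => by simp [E₁]⟩,
    ⟨β, hβW, fun t => IsIso.hom_inv_id_assoc _ _, fun t => rfl⟩,
    fun p => S.cf_of_llp_R₂ _ (hi p) (hβ p) (he p), fun p => S.cf_of_R₁ _ (hi p) (hα p)⟩

end Framed

section Replacement

/-- A fully faithful functor induces a weak homotopy equivalence on nerves if strings can be
replaced by objects of its essential image. -/
theorem isWeakHomotopyEquiv_of_replacement {A B : Type (max u v)} [Category.{v} A] [Category.{v} B]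
    (ι : A ⥤ B) [ι.Full] [ι.Faithful] {P : B → Prop} (hP : ∀ b, P b → ι.essImage b)
    (hι : ∀ a, P (ι.obj a)) {F₁ F₂ : Str.{v} B ⥤ B} (φ : F₁ ⟶ Str.lv B) (ψ : F₁ ⟶ F₂)
    (h₂ : ∀ σ, P (F₂.obj σ)) (h₁ : ∀ σ, P ((Str.lv B).obj σ) → P (F₁.obj σ)) :
    IsWeakHomotopyEquiv (nerveMap ι) := by
  refine isWeakHomotopyEquiv_of_deformation ι
    ((htpy_of_natTrans φ).symm.trans (htpy_of_natTrans ψ))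
    (fun σ => hP _ (h₂ σ)) (μ := Str.map ι ⋙ F₁) (fun σ => hP _ (h₁ _ ?_))
    (Functor.whiskerLeft _ ψ) (Functor.whiskerLeft _ φ)
  have := Functor.congr_obj (Str.map_lv.{v, v} ι) σ
  dsimp only [Functor.comp_obj] at this
  rw [this]
  exact hι _

end Replacement

section Chain

variable {E : Type u} [Category.{v} E]

/-- The chain of `n` composable arrows with given objects and arrows. -/
noncomputable def chain {n : ℕ} (c : Fin (n + 1) → E)
    (arr : ∀ k : Fin n, c k.castSucc ⟶ c k.succ) : Fin (n + 1) ⥤ E :=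
  ComposableArrows.mkOfObjOfMapSucc c arr

lemma chain_map_succ {n : ℕ} (c : Fin (n + 1) → E)
    (arr : ∀ k : Fin n, c k.castSucc ⟶ c k.succ) (k : Fin n) (f : k.castSucc ⟶ k.succ) :
    (chain c arr).map f = arr k :=
  ComposableArrows.mkOfObjOfMapSucc_map_succ c arr k.1 k.2

lemma swap_uncurry_map_mkHom_id {Q T : Type*} [Category Q] [Category T] (F : Q ⥤ T ⥤ E)
    {s t : T} (f : s ⟶ t) (q : Q) :
    (CategoryTheory.Prod.swap _ _ ⋙ Functor.uncurry.obj F).map (Prod.mkHom f (𝟙 q)) =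
      (F.obj q).map f := by
  simp

lemma swap_uncurry_map_mkHom_id_left {Q T : Type*} [Category Q] [Category T] (F : Q ⥤ T ⥤ E)
    (t : T) {q q' : Q} (g : q ⟶ q') :
    (CategoryTheory.Prod.swap _ _ ⋙ Functor.uncurry.obj F).map (Prod.mkHom (𝟙 t) g) =
      (F.map g).app t := by
  simp

end Chain

section ZigZag

universe a b

variable {R : Type u} [Category.{v} R]

/-- The objectwise weak equivalences. -/
@[simps]
def RelCatStruct.functors (ρ : RelCatStruct R) (T : Type a) [Category.{b} T] :
    RelCatStruct (T ⥤ R) where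
  W _ _ f := ∀ t, ρ.W (f.app t)
  W_id _ _ := ρ.W_id _
  W_comp _ _ hf hg t := ρ.W_comp _ _ (hf t) (hg t)

variable {ρ : RelCatStruct R} {x y : R} {T : Type a} [Category.{b} T] {m : ℕ}

namespace ZigZag

/-- A family of zigzags, as a zigzag of functors. -/
@[simps]
def ofFunctor (F : T ⥤ ZigZag ρ x y m) :
    ZigZag (ρ.functors T) ((Functor.const T).obj x) ((Functor.const T).obj y) m where
  c k :=
    { obj := fun t => (F.obj t).c k
      map := fun f => (F.map f).u k
      map_id := fun t => by rw [F.map_id]; rfl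
      map_comp := fun f g => by rw [F.map_comp]; rfl }
  l :=
    { app := fun t => (F.obj t).l
      naturality := fun _ _ f => (F.map f).comm_l.trans (Category.comp_id _).symm }
  hl t := (F.obj t).hl
  arr k :=
    { app := fun t => (F.obj t).arr k
      naturality := fun _ _ f => (F.map f).comm_arr k }
  r :=
    { app := fun t => (F.obj t).r
      naturality := fun _ _ f => (Category.id_comp _).trans (F.map f).comm_r.symm }
  hr t := (F.obj t).hr

/-- The family of zigzags associated to a zigzag of functors. -/
@[simps]
def toFunctor
    (A : ZigZag (ρ.functors T) ((Functor.const T).obj x) ((Functor.const T).obj y) m)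
    (hA : ∀ k {s t : T} (f : s ⟶ t), ρ.W ((A.c k).map f)) : T ⥤ ZigZag ρ x y m where
  obj t :=
    { c := fun k => (A.c k).obj t
      l := A.l.app t
      hl := A.hl t
      arr := fun k => (A.arr k).app t
      r := A.r.app t
      hr := A.hr t }
  map f :=
    { u := fun k => (A.c k).map f
      hu := fun k => hA k f
      comm_l := (A.l.naturality f).trans (Category.comp_id _)
      comm_arr := fun k => (A.arr k).naturality f
      comm_r := (A.r.naturality f).symm.trans (Category.id_comp _) }
  map_id t := ZigZagHom.ext (funext fun k => (A.c k).map_id t)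
  map_comp f g := ZigZagHom.ext (funext fun k => (A.c k).map_comp f g)

/-- The map of families of zigzags associated to a map of zigzags of functors. -/
def toFunctorMap
    {A B : ZigZag (ρ.functors T) ((Functor.const T).obj x) ((Functor.const T).obj y) m}
    (φ : ZigZagHom A B) (hA : ∀ k {s t : T} (f : s ⟶ t), ρ.W ((A.c k).map f))
    (hB : ∀ k {s t : T} (f : s ⟶ t), ρ.W ((B.c k).map f)) : A.toFunctor hA ⟶ B.toFunctor hB where
  app t :=
    { u := fun k => (φ.u k).app t
      hu := fun k => φ.hu k t
      comm_l := congrArg (fun α => NatTrans.app α t) φ.comm_l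
      comm_arr := fun k => congrArg (fun α => NatTrans.app α t) (φ.comm_arr k)
      comm_r := congrArg (fun α => NatTrans.app α t) φ.comm_r }
  naturality _ _ f := ZigZagHom.ext (funext fun k => (φ.u k).naturality f)

/-- The framed diagram associated to a zigzag of functors. -/
noncomputable def toFramed
    (A : ZigZag (ρ.functors T) ((Functor.const T).obj x) ((Functor.const T).obj y) m)
    (hA : ∀ k {s t : T} (f : s ⟶ t), ρ.W ((A.c k).map f)) :
    Framed ρ x y T (Fin (m + 1)) 0 (Fin.last m) where
  c := CategoryTheory.Prod.swap _ _ ⋙ Functor.uncurry.obj (chain A.c A.arr)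
  l t := A.l.app t
  hl t := A.hl t
  r t := A.r.app t
  hr t := A.hr t
  l_nat f := by
    rw [swap_uncurry_map_mkHom_id]
    exact (A.l.naturality f).trans (Category.comp_id _)
  r_nat f := by
    rw [swap_uncurry_map_mkHom_id]
    exact (A.r.naturality f).symm.trans (Category.id_comp _)
  hW f q := by
    rw [swap_uncurry_map_mkHom_id]
    exact hA q f

/-- The zigzag of functors associated to a framed diagram. -/
@[simps]
def ofFramed (E : Framed ρ x y T (Fin (m + 1)) 0 (Fin.last m)) :
    ZigZag (ρ.functors T) ((Functor.const T).obj x) ((Functor.const T).obj y) m where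
  c k := (Functor.curry.obj E.c).flip.obj k
  l := { app := E.l, naturality := fun _ _ f => (E.l_nat f).trans (Category.comp_id _).symm }
  hl := E.hl
  arr k := (Functor.curry.obj E.c).flip.map (homOfLE k.castSucc_le_succ)
  r := { app := E.r, naturality := fun _ _ f => (Category.id_comp _).trans (E.r_nat f).symm }
  hr := E.hr

/-- The map of zigzags of functors associated to a map of framed diagrams. -/
def ofFramedMap {E E' : Framed ρ x y T (Fin (m + 1)) 0 (Fin.last m)} (φ : E.Hom E') :
    ZigZagHom (ofFramed E) (ofFramed E') where
  u k := { app := fun t => φ.α.app (t, k), naturality := fun _ _ f => φ.α.naturality _ }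
  hu k t := φ.hα (t, k)
  comm_l := by ext t; exact φ.α_l t
  comm_arr k := by ext t; exact (φ.α.naturality _).symm
  comm_r := by ext t; exact φ.α_r t

/-- The comparison between a zigzag of functors and the associated framed diagram. -/
noncomputable def ofFramedToFramed
    (A : ZigZag (ρ.functors T) ((Functor.const T).obj x) ((Functor.const T).obj y) m)
    (hA : ∀ k {s t : T} (f : s ⟶ t), ρ.W ((A.c k).map f)) :
    ZigZagHom (ofFramed (A.toFramed hA)) A where
  u k :=
    { app := fun t => 𝟙 ((A.c k).obj t)
      naturality := fun _ _ f => (Category.comp_id _).trans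
        ((swap_uncurry_map_mkHom_id (chain A.c A.arr) f k).trans (Category.id_comp _).symm) }
  hu _ _ := ρ.W_id _
  comm_l := by ext t; exact Category.id_comp _
  comm_arr k := by
    ext t
    refine (Category.id_comp _).trans (Eq.trans ?_ (Category.comp_id _).symm)
    exact ((swap_uncurry_map_mkHom_id_left (chain A.c A.arr) t _).trans
      (congrArg (fun α => NatTrans.app α t) (chain_map_succ A.c A.arr k _))).symm
  comm_r := by ext t; exact Category.comp_id _

lemma ofFramed_hA (E : Framed ρ x y T (Fin (m + 1)) 0 (Fin.last m)) (k : Fin (m + 1)) {s t : T}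
    (f : s ⟶ t) : ρ.W (((ofFramed E).c k).map f) := E.hW f k

theorem exists_replacement [HasFiniteCoproducts R] [HasPushouts R] (hρ : ρ.IsSaturated)
    {cf : R → Prop} (S : ReplacementSystem ρ x y cf) (hT : IsDirect T)
    (F : T ⥤ ZigZag ρ x y m) :
    ∃ (F₁ F₂ : T ⥤ ZigZag ρ x y m) (_ : F₁ ⟶ F) (_ : F₁ ⟶ F₂),
      (∀ t k, cf ((F₂.obj t).c k)) ∧
        ∀ t, (∀ k, cf ((F.obj t).c k)) → ∀ k, cf ((F₁.obj t).c k) := by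
  obtain ⟨E₁, E₂, φ, ψ, h₂, h₁⟩ := Framed.exists_replacement hρ S hT
    ((ofFunctor F).toFramed fun k _ _ f => (F.map f).hu k)
  exact ⟨(ofFramed E₁).toFunctor (ofFramed_hA E₁), (ofFramed E₂).toFunctor (ofFramed_hA E₂),
    toFunctorMap (ofFramedMap φ) (ofFramed_hA _) (ofFramed_hA _) ≫
      toFunctorMap (ofFramedToFramed _ _) (ofFramed_hA _) fun k _ _ f => (F.map f).hu k,
    toFunctorMap (ofFramedMap ψ) _ _, fun t k => h₂ (t, k), fun t h k => h₁ (t, k) (h k)⟩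

/-- The functor between categories of zigzags induced by a functor preserving
weak equivalences. -/
@[simps]
def map {R' : Type*} [Category R'] {ρ' : RelCatStruct R'} (Φ : R ⥤ R')
    (hΦ : ∀ {a b : R} (f : a ⟶ b), ρ.W f → ρ'.W (Φ.map f)) (x y : R) (m : ℕ) :
    ZigZag ρ x y m ⥤ ZigZag ρ' (Φ.obj x) (Φ.obj y) m where
  obj A :=
    { c := fun k => Φ.obj (A.c k)
      l := Φ.map A.l
      hl := hΦ _ A.hl
      arr := fun k => Φ.map (A.arr k)
      r := Φ.map A.r
      hr := hΦ _ A.hr }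
  map φ :=
    { u := fun k => Φ.map (φ.u k)
      hu := fun k => hΦ _ (φ.hu k)
      comm_l := by rw [← Φ.map_comp, φ.comm_l]
      comm_arr := fun k => by rw [← Φ.map_comp, φ.comm_arr, Φ.map_comp]
      comm_r := by rw [← Φ.map_comp, φ.comm_r] }
  map_id A := ZigZagHom.ext (funext fun k => Φ.map_id (A.c k))
  map_comp f g := ZigZagHom.ext (funext fun k => Φ.map_comp (f.u k) (g.u k))

section Map

variable {R' : Type u} [Category.{v} R'] {ρ' : RelCatStruct R'} (Φ : R ⥤ R')
    (hΦ : ∀ {a b : R} (f : a ⟶ b), ρ.W f → ρ'.W (Φ.map f))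

lemma map_faithful [Φ.Faithful] : (map (ρ' := ρ') Φ hΦ x y m).Faithful where
  map_injective h := ZigZagHom.ext (funext fun k => Φ.map_injective
    (congrFun (congrArg ZigZagHom.u h) k))

lemma map_full [Φ.Full] [Φ.Faithful] (hΦ' : ∀ {a b : R} (f : a ⟶ b), ρ'.W (Φ.map f) → ρ.W f) :
    (map (ρ' := ρ') Φ hΦ x y m).Full where
  map_surjective {A B} f := by
    have h k : ∃ g : A.c k ⟶ B.c k, Φ.map g = f.u k := Φ.map_surjective _
    choose g hg using h
    have hl : g 0 ≫ B.l = A.l := Φ.map_injective <| by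
      rw [Φ.map_comp, hg]
      exact f.comm_l
    have harr k : g k.castSucc ≫ B.arr k = A.arr k ≫ g k.succ := Φ.map_injective <| by
      rw [Φ.map_comp, Φ.map_comp, hg, hg]
      exact f.comm_arr k
    have hr : A.r ≫ g (Fin.last m) = B.r := Φ.map_injective <| by
      rw [Φ.map_comp, hg]
      exact f.comm_r
    exact ⟨⟨g, fun k => hΦ' _ ((hg k).symm ▸ f.hu k), hl, harr, hr⟩,
      ZigZagHom.ext (funext hg)⟩

lemma map_essImage [Φ.Full] [Φ.Faithful] (hρ' : ρ'.IsSaturated)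
    (hΦ' : ∀ {a b : R} (f : a ⟶ b), ρ'.W (Φ.map f) → ρ.W f)
    (A : ZigZag ρ' (Φ.obj x) (Φ.obj y) m) (hA : ∀ k, Φ.essImage (A.c k)) :
    (map (ρ' := ρ') Φ hΦ x y m).essImage A := by
  have h k : ∃ a, Nonempty (Φ.obj a ≅ A.c k) := hA k
  choose a e using h
  replace e k := (e k).some
  have hl : Φ.map (Φ.preimage ((e 0).hom ≫ A.l)) = (e 0).hom ≫ A.l := Φ.map_preimage _
  have harr k : Φ.map (Φ.preimage ((e k.castSucc).hom ≫ A.arr k ≫ (e k.succ).inv)) =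
    (e k.castSucc).hom ≫ A.arr k ≫ (e k.succ).inv := Φ.map_preimage _
  have hr : Φ.map (Φ.preimage (A.r ≫ (e (Fin.last m)).inv)) = A.r ≫ (e (Fin.last m)).inv :=
    Φ.map_preimage _
  let B : ZigZag ρ x y m :=
    { c := a
      l := Φ.preimage ((e 0).hom ≫ A.l)
      hl := hΦ' _ (by rw [hl]; exact ρ'.W_comp _ _ (hρ'.of_isIso _) A.hl)
      arr := fun k => Φ.preimage ((e k.castSucc).hom ≫ A.arr k ≫ (e k.succ).inv)
      r := Φ.preimage (A.r ≫ (e (Fin.last m)).inv)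
      hr := hΦ' _ (by rw [hr]; exact ρ'.W_comp _ _ A.hr (hρ'.of_isIso _)) }
  let f : ZigZagHom ((map (ρ' := ρ') Φ hΦ x y m).obj B) A :=
    { u := fun k => (e k).hom
      hu := fun k => hρ'.of_isIso (e k).hom
      comm_l := hl.symm
      comm_arr := fun k => by
        refine Eq.trans ?_ (congrArg (· ≫ (e k.succ).hom) (harr k)).symm
        simp
        rfl
      comm_r := (congrArg (· ≫ (e (Fin.last m)).hom) hr).trans (by simp) }
  let g : ZigZagHom A ((map (ρ' := ρ') Φ hΦ x y m).obj B) :=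
    { u := fun k => (e k).inv
      hu := fun k => hρ'.of_isIso (e k).inv
      comm_l := (congrArg ((e 0).inv ≫ ·) hl).trans (by simp)
      comm_arr := fun k => (congrArg ((e k.castSucc).inv ≫ ·) (harr k)).trans (by simp; rfl)
      comm_r := hr.symm }
  exact ⟨B, ⟨f, g, ZigZagHom.ext (funext fun k => (e k).hom_inv_id),
    ZigZagHom.ext (funext fun k => (e k).inv_hom_id)⟩⟩

theorem isWeakHomotopyEquiv_map [Φ.Full] [Φ.Faithful] [HasFiniteCoproducts R'] [HasPushouts R']
    (hρ' : ρ'.IsSaturated) (hΦ' : ∀ {a b : R} (f : a ⟶ b), ρ'.W (Φ.map f) → ρ.W f)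
    {cf : R' → Prop} (S : ReplacementSystem ρ' (Φ.obj x) (Φ.obj y) cf)
    (hcf : ∀ a, cf a → Φ.essImage a) (hcf' : ∀ a, cf (Φ.obj a)) :
    IsWeakHomotopyEquiv (nerveMap (map (ρ' := ρ') Φ hΦ x y m)) := by
  have := map_full (x := x) (y := y) (m := m) Φ hΦ hΦ'
  have := map_faithful (ρ' := ρ') (x := x) (y := y) (m := m) Φ hΦ
  obtain ⟨F₁, F₂, φ, ψ, h₂, h₁⟩ := exists_replacement hρ' S (IsDirect.str _)
    (Str.lv.{v} (ZigZag ρ' (Φ.obj x) (Φ.obj y) m))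
  exact isWeakHomotopyEquiv_of_replacement.{v, u} _ (P := fun A => ∀ k, cf (A.c k))
    (fun A hA => map_essImage Φ hΦ hρ' hΦ' A fun k => hcf _ (hA k)) (fun A k => hcf' _)
    φ ψ h₂ h₁

end Map

end ZigZag

end ZigZag

section Branch

/-- The shape of a pair of chains `c₀ → ⋯ → c_i` and `d₀ → ⋯ → d_j` with a map `d₀ → c_i`. -/
def Branch (i j : ℕ) : Type := Fin (i + 1) ⊕ Fin (j + 1)

variable {i j : ℕ}

instance : Finite (Branch i j) := inferInstanceAs (Finite (Fin (i + 1) ⊕ Fin (j + 1)))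

/-- The order relation on `Branch i j`. -/
def Branch.Le : Branch i j → Branch i j → Prop
  | Sum.inl a, Sum.inl b => a ≤ b
  | Sum.inr a, Sum.inr b => a ≤ b
  | Sum.inr a, Sum.inl b => a ≤ 0 ∧ Fin.last i ≤ b
  | Sum.inl _, Sum.inr _ => False

instance : PartialOrder (Branch i j) where
  le := Branch.Le
  le_refl := by rintro (a | a) <;> exact le_refl a
  le_trans := by
    rintro (a | a) (b | b) (c | c) h h' <;>
      first
        | exact h.elim | exact h'.elim | exact le_trans (α := Fin _) h h'
        | exact ⟨h.1, le_trans h.2 h'⟩ | exact ⟨le_trans h h'.1, h'.2⟩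
  le_antisymm := by
    rintro (a | a) (b | b) h h' <;>
      first
        | exact h.elim | exact h'.elim
        | exact congrArg Sum.inl (le_antisymm (α := Fin _) h h')
        | exact congrArg Sum.inr (le_antisymm (α := Fin _) h h')

/-- The element of `Branch i j` given by the `k`-th object of the first chain. -/
def Branch.c (k : Fin (i + 1)) : Branch i j := Sum.inl k

/-- The element of `Branch i j` given by the `k`-th object of the second chain. -/
def Branch.d (k : Fin (j + 1)) : Branch i j := Sum.inr k

lemma Branch.c_le {k l : Fin (i + 1)} (h : k ≤ l) : (Branch.c k : Branch i j) ≤ Branch.c l := h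

lemma Branch.d_le {k l : Fin (j + 1)} (h : k ≤ l) : (Branch.d k : Branch i j) ≤ Branch.d l := h

lemma Branch.mid_le : (Branch.d 0 : Branch i j) ≤ Branch.c (Fin.last i) := ⟨le_rfl, le_rfl⟩

variable {E : Type u} [Category.{v} E]

/-- The functor from `Branch i j` given by two chains and a map between them. -/
def branch (c : Fin (i + 1) ⥤ E) (d : Fin (j + 1) ⥤ E) (mid : d.obj 0 ⟶ c.obj (Fin.last i)) :
    Branch i j ⥤ E where
  obj
    | Sum.inl a => c.obj a
    | Sum.inr a => d.obj a
  map {a b} f := match a, b, leOfHom f with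
    | Sum.inl _, Sum.inl _, h => c.map (homOfLE h)
    | Sum.inr _, Sum.inr _, h => d.map (homOfLE h)
    | Sum.inr _, Sum.inl _, h => d.map (homOfLE h.1) ≫ mid ≫ c.map (homOfLE h.2)
    | Sum.inl _, Sum.inr _, h => h.elim
  map_id := by
    rintro (a | a)
    · exact c.map_id a
    · exact d.map_id a
  map_comp {a b e} f g := by
    have hf := leOfHom f
    have hg := leOfHom g
    rcases a with a | a <;> rcases b with b | b <;> rcases e with e | e <;>
      first
        | exact hf.elim | exact hg.elim
        | exact c.map_comp (homOfLE hf) (homOfLE hg)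
        | exact d.map_comp (homOfLE hf) (homOfLE hg)
        | skip
    · have h := c.map_comp (homOfLE hf.2) (homOfLE hg)
      have h' := congrArg (fun t => d.map (homOfLE hf.1) ≫ mid ≫ t) h
      simp only [← Category.assoc] at h' ⊢
      exact h'
    · have h := d.map_comp (homOfLE hf) (homOfLE hg.1)
      have h' := congrArg (fun t => t ≫ mid ≫ c.map (homOfLE hg.2)) h
      exact h'.trans (Category.assoc _ _ _)

lemma branch_map_mid (c : Fin (i + 1) ⥤ E) (d : Fin (j + 1) ⥤ E)
    (mid : d.obj 0 ⟶ c.obj (Fin.last i)) :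
    (branch c d mid).map (homOfLE Branch.mid_le) = mid := by
  have h1 : (branch c d mid).map (homOfLE Branch.mid_le) =
    d.map (𝟙 _) ≫ mid ≫ c.map (𝟙 _) := rfl
  rw [h1, d.map_id, c.map_id, Category.comp_id, Category.id_comp]

end Branch

section ZigZag'

universe a b

variable {R : Type u} [Category.{v} R] {ρ : RelCatStruct R} {x y : R} {T : Type a} [Category.{b} T]
  {i j : ℕ}

namespace ZigZag'

/-- A family of zigzags, as a zigzag of functors. -/
@[simps]
def ofFunctor (F : T ⥤ ZigZag' ρ x y i j) :
    ZigZag' (ρ.functors T) ((Functor.const T).obj x) ((Functor.const T).obj y) i j where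
  c k :=
    { obj := fun t => (F.obj t).c k
      map := fun f => (F.map f).uc k
      map_id := fun t => by rw [F.map_id]; rfl
      map_comp := fun f g => by rw [F.map_comp]; rfl }
  d k :=
    { obj := fun t => (F.obj t).d k
      map := fun f => (F.map f).ud k
      map_id := fun t => by rw [F.map_id]; rfl
      map_comp := fun f g => by rw [F.map_comp]; rfl }
  l :=
    { app := fun t => (F.obj t).l
      naturality := fun _ _ f => (F.map f).comm_l.trans (Category.comp_id _).symm }
  hl t := (F.obj t).hl
  arrc k :=
    { app := fun t => (F.obj t).arrc k
      naturality := fun _ _ f => (F.map f).comm_arrc k }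
  mid :=
    { app := fun t => (F.obj t).mid
      naturality := fun _ _ f => (F.map f).comm_mid }
  hmid t := (F.obj t).hmid
  arrd k :=
    { app := fun t => (F.obj t).arrd k
      naturality := fun _ _ f => (F.map f).comm_arrd k }
  r :=
    { app := fun t => (F.obj t).r
      naturality := fun _ _ f => (Category.id_comp _).trans (F.map f).comm_r.symm }
  hr t := (F.obj t).hr

/-- The condition that a zigzag of functors consists of functors sending all maps to
weak equivalences. -/
structure IsHomotopical
    (A : ZigZag' (ρ.functors T) ((Functor.const T).obj x) ((Functor.const T).obj y) i j) :
    Prop where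
  c (k) {s t : T} (f : s ⟶ t) : ρ.W ((A.c k).map f)
  d (k) {s t : T} (f : s ⟶ t) : ρ.W ((A.d k).map f)

lemma isHomotopical_ofFunctor (F : T ⥤ ZigZag' ρ x y i j) : (ofFunctor F).IsHomotopical where
  c k _ _ f := (F.map f).huc k
  d k _ _ f := (F.map f).hud k

/-- The family of zigzags associated to a zigzag of functors. -/
@[simps]
def toFunctor
    (A : ZigZag' (ρ.functors T) ((Functor.const T).obj x) ((Functor.const T).obj y) i j)
    (hA : A.IsHomotopical) : T ⥤ ZigZag' ρ x y i j where
  obj t :=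
    { c := fun k => (A.c k).obj t
      d := fun k => (A.d k).obj t
      l := A.l.app t
      hl := A.hl t
      arrc := fun k => (A.arrc k).app t
      mid := A.mid.app t
      hmid := A.hmid t
      arrd := fun k => (A.arrd k).app t
      r := A.r.app t
      hr := A.hr t }
  map f :=
    { uc := fun k => (A.c k).map f
      ud := fun k => (A.d k).map f
      huc := fun k => hA.c k f
      hud := fun k => hA.d k f
      comm_l := (A.l.naturality f).trans (Category.comp_id _)
      comm_arrc := fun k => (A.arrc k).naturality f
      comm_mid := A.mid.naturality f
      comm_arrd := fun k => (A.arrd k).naturality f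
      comm_r := (A.r.naturality f).symm.trans (Category.id_comp _) }
  map_id t := ZigZag'Hom.ext (funext fun k => (A.c k).map_id t) (funext fun k => (A.d k).map_id t)
  map_comp f g := ZigZag'Hom.ext (funext fun k => (A.c k).map_comp f g)
    (funext fun k => (A.d k).map_comp f g)

/-- The map of families of zigzags associated to a map of zigzags of functors. -/
def toFunctorMap
    {A B : ZigZag' (ρ.functors T) ((Functor.const T).obj x) ((Functor.const T).obj y) i j}
    (φ : ZigZag'Hom A B) (hA : A.IsHomotopical) (hB : B.IsHomotopical) :
    A.toFunctor hA ⟶ B.toFunctor hB where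
  app t :=
    { uc := fun k => (φ.uc k).app t
      ud := fun k => (φ.ud k).app t
      huc := fun k => φ.huc k t
      hud := fun k => φ.hud k t
      comm_l := congrArg (fun α => NatTrans.app α t) φ.comm_l
      comm_arrc := fun k => congrArg (fun α => NatTrans.app α t) (φ.comm_arrc k)
      comm_mid := congrArg (fun α => NatTrans.app α t) φ.comm_mid
      comm_arrd := fun k => congrArg (fun α => NatTrans.app α t) (φ.comm_arrd k)
      comm_r := congrArg (fun α => NatTrans.app α t) φ.comm_r }
  naturality _ _ f := ZigZag'Hom.ext (funext fun k => (φ.uc k).naturality f)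
    (funext fun k => (φ.ud k).naturality f)

/-- The framed diagram associated to a zigzag of functors. -/
noncomputable def toFramed
    (A : ZigZag' (ρ.functors T) ((Functor.const T).obj x) ((Functor.const T).obj y) i j)
    (hA : A.IsHomotopical) :
    Framed ρ x y T (Branch i j) (Branch.c 0) (Branch.d (Fin.last j)) where
  c := CategoryTheory.Prod.swap _ _ ⋙
    Functor.uncurry.obj (branch (chain A.c A.arrc) (chain A.d A.arrd) A.mid)
  l t := A.l.app t
  hl t := A.hl t
  r t := A.r.app t
  hr t := A.hr t
  l_nat f := by
    rw [swap_uncurry_map_mkHom_id]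
    exact (A.l.naturality f).trans (Category.comp_id _)
  r_nat f := by
    rw [swap_uncurry_map_mkHom_id]
    exact (A.r.naturality f).symm.trans (Category.id_comp _)
  hW f q := by
    rw [swap_uncurry_map_mkHom_id]
    rcases q with q | q
    · exact hA.c q f
    · exact hA.d q f

lemma toFramed_mid
    (A : ZigZag' (ρ.functors T) ((Functor.const T).obj x) ((Functor.const T).obj y) i j)
    (hA : A.IsHomotopical) (t : T) :
    (A.toFramed hA).c.map (Prod.mkHom (𝟙 t) (homOfLE Branch.mid_le)) = A.mid.app t :=
  (swap_uncurry_map_mkHom_id_left _ _ _).trans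
    (congrArg (fun α => NatTrans.app α t) (branch_map_mid _ _ _))

/-- The zigzag of functors associated to a framed diagram. -/
@[simps]
def ofFramed (E : Framed ρ x y T (Branch i j) (Branch.c 0) (Branch.d (Fin.last j)))
    (hE : ∀ t, ρ.W (E.c.map (Prod.mkHom (𝟙 t) (homOfLE Branch.mid_le)))) :
    ZigZag' (ρ.functors T) ((Functor.const T).obj x) ((Functor.const T).obj y) i j where
  c k := (Functor.curry.obj E.c).flip.obj (Branch.c k)
  d k := (Functor.curry.obj E.c).flip.obj (Branch.d k)
  l := { app := E.l, naturality := fun _ _ f => (E.l_nat f).trans (Category.comp_id _).symm }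
  hl := E.hl
  arrc k := (Functor.curry.obj E.c).flip.map (homOfLE (Branch.c_le k.castSucc_le_succ))
  mid := (Functor.curry.obj E.c).flip.map (homOfLE Branch.mid_le)
  hmid := hE
  arrd k := (Functor.curry.obj E.c).flip.map (homOfLE (Branch.d_le k.castSucc_le_succ))
  r := { app := E.r, naturality := fun _ _ f => (Category.id_comp _).trans (E.r_nat f).symm }
  hr := E.hr

lemma isHomotopical_ofFramed
    (E : Framed ρ x y T (Branch i j) (Branch.c 0) (Branch.d (Fin.last j)))
    (hE : ∀ t, ρ.W (E.c.map (Prod.mkHom (𝟙 t) (homOfLE Branch.mid_le)))) :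
    (ofFramed E hE).IsHomotopical where
  c k _ _ f := E.hW f (Branch.c k)
  d k _ _ f := E.hW f (Branch.d k)

/-- The map of zigzags of functors associated to a map of framed diagrams. -/
def ofFramedMap {E E' : Framed ρ x y T (Branch i j) (Branch.c 0) (Branch.d (Fin.last j))}
    (φ : E.Hom E') (hE : ∀ t, ρ.W (E.c.map (Prod.mkHom (𝟙 t) (homOfLE Branch.mid_le))))
    (hE' : ∀ t, ρ.W (E'.c.map (Prod.mkHom (𝟙 t) (homOfLE Branch.mid_le)))) :
    ZigZag'Hom (ofFramed E hE) (ofFramed E' hE') where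
  uc k :=
    { app := fun t => φ.α.app (t, Branch.c k), naturality := fun _ _ f => φ.α.naturality _ }
  ud k :=
    { app := fun t => φ.α.app (t, Branch.d k), naturality := fun _ _ f => φ.α.naturality _ }
  huc k t := φ.hα (t, Branch.c k)
  hud k t := φ.hα (t, Branch.d k)
  comm_l := by ext t; exact φ.α_l t
  comm_arrc k := by ext t; exact (φ.α.naturality _).symm
  comm_mid := by ext t; exact (φ.α.naturality _).symm
  comm_arrd k := by ext t; exact (φ.α.naturality _).symm
  comm_r := by ext t; exact φ.α_r t

/-- The comparison between a zigzag of functors and the associated framed diagram. -/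
noncomputable def ofFramedToFramed
    (A : ZigZag' (ρ.functors T) ((Functor.const T).obj x) ((Functor.const T).obj y) i j)
    (hA : A.IsHomotopical)
    (hE : ∀ t, ρ.W ((A.toFramed hA).c.map (Prod.mkHom (𝟙 t) (homOfLE Branch.mid_le)))) :
    ZigZag'Hom (ofFramed (A.toFramed hA) hE) A where
  uc k :=
    { app := fun t => 𝟙 ((A.c k).obj t)
      naturality := fun _ _ f => (Category.comp_id _).trans
        ((swap_uncurry_map_mkHom_id (branch (chain A.c A.arrc) (chain A.d A.arrd) A.mid) f
          (Branch.c k)).trans (Category.id_comp _).symm) }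
  ud k :=
    { app := fun t => 𝟙 ((A.d k).obj t)
      naturality := fun _ _ f => (Category.comp_id _).trans
        ((swap_uncurry_map_mkHom_id (branch (chain A.c A.arrc) (chain A.d A.arrd) A.mid) f
          (Branch.d k)).trans (Category.id_comp _).symm) }
  huc _ _ := ρ.W_id _
  hud _ _ := ρ.W_id _
  comm_l := by ext t; exact Category.id_comp _
  comm_arrc k := by
    ext t
    refine (Category.id_comp _).trans (Eq.trans ?_ (Category.comp_id _).symm)
    exact ((swap_uncurry_map_mkHom_id_left (branch (chain A.c A.arrc) (chain A.d A.arrd) A.mid) t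
      (homOfLE (Branch.c_le k.castSucc_le_succ))).trans
        (congrArg (fun α => NatTrans.app α t)
          (chain_map_succ A.c A.arrc k (homOfLE k.castSucc_le_succ)))).symm
  comm_mid := by
    ext t
    refine (Category.id_comp _).trans (Eq.trans ?_ (Category.comp_id _).symm)
    exact (toFramed_mid A hA t).symm
  comm_arrd k := by
    ext t
    refine (Category.id_comp _).trans (Eq.trans ?_ (Category.comp_id _).symm)
    exact ((swap_uncurry_map_mkHom_id_left (branch (chain A.c A.arrc) (chain A.d A.arrd) A.mid) t
      (homOfLE (Branch.d_le k.castSucc_le_succ))).trans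
        (congrArg (fun α => NatTrans.app α t)
          (chain_map_succ A.d A.arrd k (homOfLE k.castSucc_le_succ)))).symm
  comm_r := by ext t; exact Category.comp_id _

theorem exists_replacement [HasFiniteCoproducts R] [HasPushouts R] (hρ : ρ.IsSaturated)
    {cf : R → Prop} (S : ReplacementSystem ρ x y cf) (hT : IsDirect T)
    (F : T ⥤ ZigZag' ρ x y i j) :
    ∃ (F₁ F₂ : T ⥤ ZigZag' ρ x y i j) (_ : F₁ ⟶ F) (_ : F₁ ⟶ F₂),
      (∀ t, (∀ k, cf ((F₂.obj t).c k)) ∧ ∀ k, cf ((F₂.obj t).d k)) ∧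
        ∀ t, ((∀ k, cf ((F.obj t).c k)) ∧ ∀ k, cf ((F.obj t).d k)) →
          (∀ k, cf ((F₁.obj t).c k)) ∧ ∀ k, cf ((F₁.obj t).d k) := by
  obtain ⟨E₁, E₂, φ, ψ, h₂, h₁⟩ := Framed.exists_replacement hρ S hT
    ((ofFunctor F).toFramed (isHomotopical_ofFunctor F))
  have hE (t : T) : ρ.W (((ofFunctor F).toFramed (isHomotopical_ofFunctor F)).c.map
      (Prod.mkHom (𝟙 t) (homOfLE Branch.mid_le))) := by
    rw [toFramed_mid]
    exact (F.obj t).hmid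
  have hE₁ t := (φ.W_iff hρ _).2 (hE t)
  have hE₂ t := (ψ.W_iff hρ _).1 (hE₁ t)
  exact ⟨(ofFramed E₁ hE₁).toFunctor (isHomotopical_ofFramed _ _),
    (ofFramed E₂ hE₂).toFunctor (isHomotopical_ofFramed _ _),
    toFunctorMap (ofFramedMap φ hE₁ hE) (isHomotopical_ofFramed _ _) (isHomotopical_ofFramed _ _) ≫
      toFunctorMap (ofFramedToFramed _ _ hE) (isHomotopical_ofFramed _ _)
        (isHomotopical_ofFunctor F),
    toFunctorMap (ofFramedMap ψ hE₁ hE₂) _ _,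
    fun t => ⟨fun k => h₂ (t, Branch.c k), fun k => h₂ (t, Branch.d k)⟩,
    fun t h => ⟨fun k => h₁ (t, Branch.c k) (h.1 k), fun k => h₁ (t, Branch.d k) (h.2 k)⟩⟩

/-- The functor between categories of zigzags induced by a functor preserving
weak equivalences. -/
@[simps]
def map {R' : Type*} [Category R'] {ρ' : RelCatStruct R'} (Φ : R ⥤ R')
    (hΦ : ∀ {a b : R} (f : a ⟶ b), ρ.W f → ρ'.W (Φ.map f)) (x y : R) (i j : ℕ) :
    ZigZag' ρ x y i j ⥤ ZigZag' ρ' (Φ.obj x) (Φ.obj y) i j where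
  obj A :=
    { c := fun k => Φ.obj (A.c k)
      d := fun k => Φ.obj (A.d k)
      l := Φ.map A.l
      hl := hΦ _ A.hl
      arrc := fun k => Φ.map (A.arrc k)
      mid := Φ.map A.mid
      hmid := hΦ _ A.hmid
      arrd := fun k => Φ.map (A.arrd k)
      r := Φ.map A.r
      hr := hΦ _ A.hr }
  map φ :=
    { uc := fun k => Φ.map (φ.uc k)
      ud := fun k => Φ.map (φ.ud k)
      huc := fun k => hΦ _ (φ.huc k)
      hud := fun k => hΦ _ (φ.hud k)
      comm_l := by rw [← Φ.map_comp, φ.comm_l]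
      comm_arrc := fun k => by rw [← Φ.map_comp, φ.comm_arrc, Φ.map_comp]
      comm_mid := by rw [← Φ.map_comp, φ.comm_mid, Φ.map_comp]
      comm_arrd := fun k => by rw [← Φ.map_comp, φ.comm_arrd, Φ.map_comp]
      comm_r := by rw [← Φ.map_comp, φ.comm_r] }
  map_id A := ZigZag'Hom.ext (funext fun k => Φ.map_id (A.c k)) (funext fun k => Φ.map_id (A.d k))
  map_comp f g := ZigZag'Hom.ext (funext fun k => Φ.map_comp (f.uc k) (g.uc k))
    (funext fun k => Φ.map_comp (f.ud k) (g.ud k))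

section Map

variable {R' : Type u} [Category.{v} R'] {ρ' : RelCatStruct R'} (Φ : R ⥤ R')
    (hΦ : ∀ {a b : R} (f : a ⟶ b), ρ.W f → ρ'.W (Φ.map f))

lemma map_faithful [Φ.Faithful] : (map (ρ' := ρ') Φ hΦ x y i j).Faithful where
  map_injective h := ZigZag'Hom.ext
    (funext fun k => Φ.map_injective (congrFun (congrArg ZigZag'Hom.uc h) k))
    (funext fun k => Φ.map_injective (congrFun (congrArg ZigZag'Hom.ud h) k))

lemma map_full [Φ.Full] [Φ.Faithful] (hΦ' : ∀ {a b : R} (f : a ⟶ b), ρ'.W (Φ.map f) → ρ.W f) :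
    (map (ρ' := ρ') Φ hΦ x y i j).Full where
  map_surjective {A B} f := by
    have hc k : ∃ g : A.c k ⟶ B.c k, Φ.map g = f.uc k := Φ.map_surjective _
    have hd k : ∃ g : A.d k ⟶ B.d k, Φ.map g = f.ud k := Φ.map_surjective _
    choose g hg using hc
    choose g' hg' using hd
    have hl : g 0 ≫ B.l = A.l := Φ.map_injective <| by
      rw [Φ.map_comp, hg]
      exact f.comm_l
    have harrc k : g k.castSucc ≫ B.arrc k = A.arrc k ≫ g k.succ := Φ.map_injective <| by
      rw [Φ.map_comp, Φ.map_comp, hg, hg]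
      exact f.comm_arrc k
    have hmid : g' 0 ≫ B.mid = A.mid ≫ g (Fin.last i) := Φ.map_injective <| by
      rw [Φ.map_comp, Φ.map_comp, hg, hg']
      exact f.comm_mid
    have harrd k : g' k.castSucc ≫ B.arrd k = A.arrd k ≫ g' k.succ := Φ.map_injective <| by
      rw [Φ.map_comp, Φ.map_comp, hg', hg']
      exact f.comm_arrd k
    have hr : A.r ≫ g' (Fin.last j) = B.r := Φ.map_injective <| by
      rw [Φ.map_comp, hg']
      exact f.comm_r
    exact ⟨⟨g, g', fun k => hΦ' _ ((hg k).symm ▸ f.huc k),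
      fun k => hΦ' _ ((hg' k).symm ▸ f.hud k), hl, harrc, hmid, harrd, hr⟩,
      ZigZag'Hom.ext (funext hg) (funext hg')⟩

lemma map_essImage [Φ.Full] [Φ.Faithful] (hρ' : ρ'.IsSaturated)
    (hΦ' : ∀ {a b : R} (f : a ⟶ b), ρ'.W (Φ.map f) → ρ.W f)
    (A : ZigZag' ρ' (Φ.obj x) (Φ.obj y) i j) (hc : ∀ k, Φ.essImage (A.c k))
    (hd : ∀ k, Φ.essImage (A.d k)) :
    (map (ρ' := ρ') Φ hΦ x y i j).essImage A := by
  have h k : ∃ a, Nonempty (Φ.obj a ≅ A.c k) := hc k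
  have h' k : ∃ a, Nonempty (Φ.obj a ≅ A.d k) := hd k
  choose a e using h
  choose a' e' using h'
  replace e k := (e k).some
  replace e' k := (e' k).some
  have hl : Φ.map (Φ.preimage ((e 0).hom ≫ A.l)) = (e 0).hom ≫ A.l := Φ.map_preimage _
  have harrc k : Φ.map (Φ.preimage ((e k.castSucc).hom ≫ A.arrc k ≫ (e k.succ).inv)) =
    (e k.castSucc).hom ≫ A.arrc k ≫ (e k.succ).inv := Φ.map_preimage _
  have hmid : Φ.map (Φ.preimage ((e' 0).hom ≫ A.mid ≫ (e (Fin.last i)).inv)) =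
    (e' 0).hom ≫ A.mid ≫ (e (Fin.last i)).inv := Φ.map_preimage _
  have harrd k : Φ.map (Φ.preimage ((e' k.castSucc).hom ≫ A.arrd k ≫ (e' k.succ).inv)) =
    (e' k.castSucc).hom ≫ A.arrd k ≫ (e' k.succ).inv := Φ.map_preimage _
  have hr : Φ.map (Φ.preimage (A.r ≫ (e' (Fin.last j)).inv)) = A.r ≫ (e' (Fin.last j)).inv :=
    Φ.map_preimage _
  let B : ZigZag' ρ x y i j :=
    { c := a
      d := a'
      l := Φ.preimage ((e 0).hom ≫ A.l)
      hl := hΦ' _ (by rw [hl]; exact ρ'.W_comp _ _ (hρ'.of_isIso _) A.hl)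
      arrc := fun k => Φ.preimage ((e k.castSucc).hom ≫ A.arrc k ≫ (e k.succ).inv)
      mid := Φ.preimage ((e' 0).hom ≫ A.mid ≫ (e (Fin.last i)).inv)
      hmid := hΦ' _ (by
        rw [hmid]
        exact ρ'.W_comp _ _ (hρ'.of_isIso _) (ρ'.W_comp _ _ A.hmid (hρ'.of_isIso _)))
      arrd := fun k => Φ.preimage ((e' k.castSucc).hom ≫ A.arrd k ≫ (e' k.succ).inv)
      r := Φ.preimage (A.r ≫ (e' (Fin.last j)).inv)
      hr := hΦ' _ (by rw [hr]; exact ρ'.W_comp _ _ A.hr (hρ'.of_isIso _)) }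
  let f : ZigZag'Hom ((map (ρ' := ρ') Φ hΦ x y i j).obj B) A :=
    { uc := fun k => (e k).hom
      ud := fun k => (e' k).hom
      huc := fun k => hρ'.of_isIso (e k).hom
      hud := fun k => hρ'.of_isIso (e' k).hom
      comm_l := hl.symm
      comm_arrc := fun k => by
        refine Eq.trans ?_ (congrArg (· ≫ (e k.succ).hom) (harrc k)).symm
        simp
        rfl
      comm_mid := by
        refine Eq.trans ?_ (congrArg (· ≫ (e (Fin.last i)).hom) hmid).symm
        simp
        rfl
      comm_arrd := fun k => by
        refine Eq.trans ?_ (congrArg (· ≫ (e' k.succ).hom) (harrd k)).symm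
        simp
        rfl
      comm_r := (congrArg (· ≫ (e' (Fin.last j)).hom) hr).trans (by simp) }
  let g : ZigZag'Hom A ((map (ρ' := ρ') Φ hΦ x y i j).obj B) :=
    { uc := fun k => (e k).inv
      ud := fun k => (e' k).inv
      huc := fun k => hρ'.of_isIso (e k).inv
      hud := fun k => hρ'.of_isIso (e' k).inv
      comm_l := (congrArg ((e 0).inv ≫ ·) hl).trans (by simp)
      comm_arrc := fun k => (congrArg ((e k.castSucc).inv ≫ ·) (harrc k)).trans (by simp; rfl)
      comm_mid := (congrArg ((e' 0).inv ≫ ·) hmid).trans (by simp; rfl)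
      comm_arrd := fun k => (congrArg ((e' k.castSucc).inv ≫ ·) (harrd k)).trans (by simp; rfl)
      comm_r := hr.symm }
  exact ⟨B, ⟨f, g, ZigZag'Hom.ext (funext fun k => (e k).hom_inv_id)
      (funext fun k => (e' k).hom_inv_id),
    ZigZag'Hom.ext (funext fun k => (e k).inv_hom_id) (funext fun k => (e' k).inv_hom_id)⟩⟩

theorem isWeakHomotopyEquiv_map [Φ.Full] [Φ.Faithful] [HasFiniteCoproducts R'] [HasPushouts R']
    (hρ' : ρ'.IsSaturated) (hΦ' : ∀ {a b : R} (f : a ⟶ b), ρ'.W (Φ.map f) → ρ.W f)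
    {cf : R' → Prop} (S : ReplacementSystem ρ' (Φ.obj x) (Φ.obj y) cf)
    (hcf : ∀ a, cf a → Φ.essImage a) (hcf' : ∀ a, cf (Φ.obj a)) :
    IsWeakHomotopyEquiv (nerveMap (map (ρ' := ρ') Φ hΦ x y i j)) := by
  have := map_full (x := x) (y := y) (i := i) (j := j) Φ hΦ hΦ'
  have := map_faithful (ρ' := ρ') (x := x) (y := y) (i := i) (j := j) Φ hΦ
  obtain ⟨F₁, F₂, φ, ψ, h₂, h₁⟩ := exists_replacement hρ' S (IsDirect.str _)
    (Str.lv.{v} (ZigZag' ρ' (Φ.obj x) (Φ.obj y) i j))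
  exact isWeakHomotopyEquiv_of_replacement.{v, u} _
    (P := fun A => (∀ k, cf (A.c k)) ∧ ∀ k, cf (A.d k))
    (fun A hA => map_essImage Φ hΦ hρ' hΦ' A (fun k => hcf _ (hA.1 k)) fun k => hcf _ (hA.2 k))
    (fun A => ⟨fun k => hcf' _, fun k => hcf' _⟩) φ ψ h₂ h₁

end Map

end ZigZag'

end ZigZag'

section Insert

variable {R : Type u} [Category.{v} R] {ρ : RelCatStruct R} {x y : R} {i j : ℕ}

lemma fin_add_cases (k : Fin (i + j + 1)) :
    (∃ a : Fin (i + 1), k = ⟨a.1, by omega⟩) ∨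
      ∃ b : Fin (j + 1), b ≠ 0 ∧ k = ⟨i + b.1, by omega⟩ := by
  by_cases h : k.1 ≤ i
  · exact Or.inl ⟨⟨k.1, by omega⟩, rfl⟩
  · refine Or.inr ⟨⟨k.1 - i, by omega⟩, fun h' => ?_, Fin.ext ?_⟩
    · rw [Fin.ext_iff] at h'
      simp only [Fin.val_zero] at h'
      omega
    · simp only
      omega

lemma fin_add_cases_arrow (k : Fin (i + j)) :
    (∃ a : Fin i, k = ⟨a.1, by omega⟩) ∨ ∃ b : Fin j, k = ⟨i + b.1, by omega⟩ := by
  by_cases h : k.1 < i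
  · exact Or.inl ⟨⟨k.1, by omega⟩, rfl⟩
  · refine Or.inr ⟨⟨k.1 - i, by omega⟩, Fin.ext ?_⟩
    simp only
    omega

instance insertFunctor_faithful : (insertFunctor ρ x y i j).Faithful where
  map_injective h := by
    apply ZigZagHom.ext
    funext k
    obtain ⟨a, rfl⟩ | ⟨b, -, rfl⟩ := fin_add_cases k
    · exact congrFun (congrArg ZigZag'Hom.uc h) a
    · exact congrFun (congrArg ZigZag'Hom.ud h) b

instance insertFunctor_full : (insertFunctor ρ x y i j).Full where
  map_surjective {A B} f := by
    have hf : HEq (f.ud 0) (f.uc (Fin.last i)) :=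
      heq_of_eq ((Category.comp_id _).symm.trans (f.comm_mid.trans (Category.id_comp _)))
    have key (k : Fin (i + j + 1)) : ∃ u : A.c k ⟶ B.c k, ρ.W u ∧
        (∀ a : Fin (i + 1), k = ⟨a.1, by omega⟩ → HEq u (f.uc a)) ∧
        (∀ b : Fin (j + 1), k = ⟨i + b.1, by omega⟩ → HEq u (f.ud b)) := by
      obtain ⟨a, rfl⟩ | ⟨b, hb, rfl⟩ := fin_add_cases k
      · refine ⟨f.uc a, f.huc a, fun a' h => ?_, fun b h => ?_⟩
        · obtain rfl : a = a' := Fin.ext (Fin.mk.inj h)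
          rfl
        · have h : a.1 = i + b.1 := congrArg Fin.val h
          obtain rfl : b = 0 := Fin.ext (by simp only [Fin.val_zero]; omega)
          obtain rfl : a = Fin.last i := Fin.ext (by simp only [Fin.val_last]; omega)
          exact hf.symm
      · refine ⟨f.ud b, f.hud b, fun a h => absurd (Fin.ext ?_) hb, fun b' h => ?_⟩
        · have h : i + b.1 = a.1 := congrArg Fin.val h
          simp only [Fin.val_zero]
          omega
        · have h : i + b.1 = i + b'.1 := congrArg Fin.val h
          obtain rfl : b = b' := Fin.ext (by omega)
          rfl
    choose u hu h₁ h₂ using key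
    have h₁ a := eq_of_heq (h₁ _ a rfl)
    have h₂ b := eq_of_heq (h₂ _ b rfl)
    refine ⟨⟨u, hu, ?_, fun k => ?_, ?_⟩, ZigZag'Hom.ext (funext h₁) (funext h₂)⟩
    · exact (congrArg (· ≫ B.l) (h₁ 0)).trans f.comm_l
    · obtain ⟨a, rfl⟩ | ⟨b, rfl⟩ := fin_add_cases_arrow k
      · exact (congrArg (· ≫ B.arr _) (h₁ a.castSucc)).trans ((f.comm_arrc a).trans
          (congrArg (A.arr _ ≫ ·) (h₁ a.succ).symm))
      · exact (congrArg (· ≫ B.arr _) (h₂ b.castSucc)).trans ((f.comm_arrd b).trans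
          (congrArg (A.arr _ ≫ ·) (h₂ b.succ).symm))
    · exact (congrArg (A.r ≫ ·) (h₂ (Fin.last j))).trans f.comm_r

lemma inv_eq_of_hom_comp {X Y Z : R} (q : X ≅ Y) (p : X ≅ Z) (m : Y ⟶ Z)
    (h : q.hom ≫ m = p.hom) : q.inv = m ≫ p.inv := by
  rw [Iso.eq_comp_inv, ← h, Iso.inv_hom_id_assoc]

lemma val_lt_c (a : Fin (i + 1)) : a.1 < i + j + 1 := by omega

lemma val_lt_d (b : Fin (j + 1)) : i + b.1 < i + j + 1 := by omega

lemma insertFunctor_essImage (hρ : ρ.IsSaturated) (A : ZigZag' ρ x y i j) [IsIso A.mid] :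
    (insertFunctor ρ x y i j).essImage A := by
  have key (k : Fin (i + j + 1)) : ∃ (X : R)
      (p : ∀ a : Fin (i + 1), k = ⟨a.1, val_lt_c a⟩ → (X ≅ A.c a))
      (q : ∀ b : Fin (j + 1), k = ⟨i + b.1, val_lt_d b⟩ → (X ≅ A.d b)),
      ∀ h h', (q 0 h').hom ≫ A.mid = (p (Fin.last i) h).hom := by
    obtain ⟨a, rfl⟩ | ⟨b, hb, rfl⟩ := fin_add_cases k
    · have e₁ (a' : Fin (i + 1)) (h : (⟨a.1, val_lt_c a⟩ : Fin (i + j + 1)) = ⟨a'.1, val_lt_c a'⟩) :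
        a = a' := Fin.ext (Fin.mk.inj h)
      have e₂ (b : Fin (j + 1))
          (h : (⟨a.1, val_lt_c a⟩ : Fin (i + j + 1)) = ⟨i + b.1, val_lt_d b⟩) :
          a = Fin.last i ∧ 0 = b := by
        have h : a.1 = i + b.1 := congrArg Fin.val h
        exact ⟨Fin.ext (by simp only [Fin.val_last]; omega),
          Fin.ext (by simp only [Fin.val_zero]; omega)⟩
      exact ⟨A.c a, fun a' h => eqToIso (congrArg A.c (e₁ a' h)),
        fun b h => eqToIso (congrArg A.c (e₂ b h).1) ≪≫ (asIso A.mid).symm ≪≫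
          eqToIso (congrArg A.d (e₂ b h).2), fun h h' => by simp⟩
    · have e₁ (a : Fin (i + 1))
          (h : (⟨i + b.1, val_lt_d b⟩ : Fin (i + j + 1)) = ⟨a.1, val_lt_c a⟩) :
          False := by
        have h : i + b.1 = a.1 := congrArg Fin.val h
        exact hb (Fin.ext (by simp only [Fin.val_zero]; omega))
      have e₂ (b' : Fin (j + 1))
          (h : (⟨i + b.1, val_lt_d b⟩ : Fin (i + j + 1)) = ⟨i + b'.1, val_lt_d b'⟩) : b = b' := by
        have h : i + b.1 = i + b'.1 := congrArg Fin.val h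
        exact Fin.ext (by omega)
      exact ⟨A.d b, fun a h => (e₁ a h).elim, fun b' h => eqToIso (congrArg A.d (e₂ b' h)),
        fun h => (e₁ _ h).elim⟩
  choose X p q hpq using key
  let P (a : Fin (i + 1)) : X ⟨a.1, by omega⟩ ≅ A.c a := p _ a rfl
  let Q (b : Fin (j + 1)) : X ⟨i + b.1, by omega⟩ ≅ A.d b := q _ b rfl
  have hPQ : (Q 0).hom ≫ A.mid = (P (Fin.last i)).hom := hpq _ rfl rfl
  have key (k : Fin (i + j)) : ∃ g : X k.castSucc ⟶ X k.succ,
      (∀ a : Fin i, k = ⟨a.1, by omega⟩ →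
        HEq g ((P a.castSucc).hom ≫ A.arrc a ≫ (P a.succ).inv)) ∧
      (∀ b : Fin j, k = ⟨i + b.1, by omega⟩ →
        HEq g ((Q b.castSucc).hom ≫ A.arrd b ≫ (Q b.succ).inv)) := by
    obtain ⟨a, rfl⟩ | ⟨b, rfl⟩ := fin_add_cases_arrow k
    · refine ⟨(P a.castSucc).hom ≫ A.arrc a ≫ (P a.succ).inv, fun a' h => ?_, fun b h => ?_⟩
      · obtain rfl : a = a' := Fin.ext (Fin.mk.inj h)
        rfl
      · have h : a.1 = i + b.1 := congrArg Fin.val h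
        omega
    · refine ⟨(Q b.castSucc).hom ≫ A.arrd b ≫ (Q b.succ).inv, fun a h => ?_, fun b' h => ?_⟩
      · have h : i + b.1 = a.1 := congrArg Fin.val h
        omega
      · have h : i + b.1 = i + b'.1 := congrArg Fin.val h
        obtain rfl : b = b' := Fin.ext (by omega)
        rfl
  choose g hc hd using key
  have hc a := eq_of_heq (hc _ a rfl)
  have hd b := eq_of_heq (hd _ b rfl)
  let B : ZigZag ρ x y (i + j) :=
    { c := X
      l := (P 0).hom ≫ A.l
      hl := ρ.W_comp _ _ (hρ.of_isIso (P 0).hom) A.hl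
      arr := g
      r := A.r ≫ (Q (Fin.last j)).inv
      hr := ρ.W_comp _ _ A.hr (hρ.of_isIso (Q (Fin.last j)).inv) }
  let f : ZigZag'Hom ((insertFunctor ρ x y i j).obj B) A :=
    { uc := fun a => (P a).hom
      ud := fun b => (Q b).hom
      huc := fun a => hρ.of_isIso (P a).hom
      hud := fun b => hρ.of_isIso (Q b).hom
      comm_l := rfl
      comm_arrc := fun a => by
        refine Eq.trans ?_ (congrArg (· ≫ (P a.succ).hom) (hc a)).symm
        simp
        rfl
      comm_mid := hPQ.trans (Category.id_comp _).symm
      comm_arrd := fun b => by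
        refine Eq.trans ?_ (congrArg (· ≫ (Q b.succ).hom) (hd b)).symm
        simp
        rfl
      comm_r := by
        have : (A.r ≫ (Q (Fin.last j)).inv) ≫ (Q (Fin.last j)).hom = A.r := by simp
        exact this }
  let f' : ZigZag'Hom A ((insertFunctor ρ x y i j).obj B) :=
    { uc := fun a => (P a).inv
      ud := fun b => (Q b).inv
      huc := fun a => hρ.of_isIso (P a).inv
      hud := fun b => hρ.of_isIso (Q b).inv
      comm_l := (P 0).inv_hom_id_assoc _
      comm_arrc := fun a => by
        refine (congrArg ((P a.castSucc).inv ≫ ·) (hc a)).trans ?_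
        simp
        rfl
      comm_mid := by
        refine (Category.comp_id _).trans ?_
        exact inv_eq_of_hom_comp (Q 0) (P (Fin.last i)) A.mid hPQ
      comm_arrd := fun b => by
        refine (congrArg ((Q b.castSucc).inv ≫ ·) (hd b)).trans ?_
        simp
        rfl
      comm_r := rfl }
  exact ⟨B, ⟨f, f', ZigZag'Hom.ext (funext fun k => (P k).hom_inv_id)
      (funext fun k => (Q k).hom_inv_id),
    ZigZag'Hom.ext (funext fun k => (P k).inv_hom_id) (funext fun k => (Q k).inv_hom_id)⟩⟩

end Insert

section Straightening

universe v' u'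

variable {E : Type u} [Category.{v} E] {i j : ℕ}

lemma exists_maps_from_zero (d : Fin (j + 1) → E) (arr : ∀ k : Fin j, d k.castSucc ⟶ d k.succ) :
    ∃ t : ∀ k, d 0 ⟶ d k, t 0 = 𝟙 _ ∧ ∀ k : Fin j, t k.castSucc ≫ arr k = t k.succ :=
  ⟨fun k => (chain d arr).map (homOfLE (Fin.zero_le k)), (chain d arr).map_id 0, fun k =>
    (congrArg (_ ≫ ·) (chain_map_succ d arr k (homOfLE k.castSucc_le_succ)).symm).trans
      ((chain d arr).map_comp _ _).symm⟩

lemma exists_maps_to_last (c : Fin (i + 1) → E) (arr : ∀ k : Fin i, c k.castSucc ⟶ c k.succ) :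
    ∃ s : ∀ k, c k ⟶ c (Fin.last i), s (Fin.last i) = 𝟙 _ ∧
      ∀ k : Fin i, arr k ≫ s k.succ = s k.castSucc :=
  ⟨fun k => (chain c arr).map (homOfLE (Fin.le_last k)), (chain c arr).map_id _, fun k =>
    (congrArg (· ≫ _) (chain_map_succ c arr k (homOfLE k.castSucc_le_succ)).symm).trans
      ((chain c arr).map_comp _ _).symm⟩

/-- Any zigzag is connected to a zigzag whose middle map is an isomorphism. -/
theorem ZigZag'.exists_isIso_mid [HasPullbacks E] [HasPushouts E] {ρ : RelCatStruct E} {x y : E}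
    (hρ : ρ.IsSaturated) (U : ZigZag' ρ x y i j) {e : E} (ι : U.d 0 ⟶ e)
    (p : e ⟶ U.c (Fin.last i)) (fac : ι ≫ p = U.mid)
    (hι : ∀ {a b : E} (f : U.d 0 ⟶ a) (g : a ⟶ b) (h : e ⟶ b), IsPushout f ι g h → ρ.W g)
    (hp : ∀ {a b : E} (f : a ⟶ U.c (Fin.last i)) (g : b ⟶ a) (h : b ⟶ e),
      IsPullback g h f p → ρ.W g) :
    ∃ (A B : ZigZag' ρ x y i j) (_ : ZigZag'Hom U A) (_ : ZigZag'Hom B A), IsIso B.mid ∧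
      ∀ (E' : Type u') [Category.{v'} E'] (ρ' : RelCatStruct E') (_ : ρ'.IsSaturated) (Φ : E ⥤ E')
        (hΦ : ∀ {a b : E} (f : a ⟶ b), ρ.W f → ρ'.W (Φ.map f))
        [PreservesLimitsOfShape WalkingCospan Φ] [IsIso (Φ.map U.mid)],
        Nonempty (ZigZag'Hom ((map (ρ' := ρ') Φ hΦ x y i j).obj U)
          ((map (ρ' := ρ') Φ hΦ x y i j).obj B)) := by
  obtain ⟨t, ht₀, ht⟩ := exists_maps_from_zero U.d U.arrd
  obtain ⟨s, hs₀, hs⟩ := exists_maps_to_last U.c U.arrc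
  have hinl k : ρ.W (pushout.inl (t k) ι) := hι _ _ _ (IsPushout.of_hasPushout _ _)
  have hfst k : ρ.W (pullback.fst (s k) p) := hp _ _ _ (IsPullback.of_hasPullback _ _)
  have hw₀ : pushout.inl (t 0) ι = ι ≫ pushout.inr (t 0) ι := by
    rw [← pushout.condition, ht₀, Category.id_comp]
  have hw₁ : pullback.fst (s (Fin.last i)) p = pullback.snd (s (Fin.last i)) p ≫ p := by
    rw [← pullback.condition, hs₀, Category.comp_id]
  have : IsIso (pushout.inr (t 0) ι) :=
    ⟨pushout.desc ι (𝟙 _) (by rw [ht₀, Category.id_comp, Category.comp_id]), pushout.inr_desc _ _ _,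
    by
      apply pushout.hom_ext
      · rw [pushout.inl_desc_assoc, ← hw₀, Category.comp_id]
      · rw [pushout.inr_desc_assoc, Category.id_comp, Category.comp_id]⟩
  let q : e ⟶ pullback (s (Fin.last i)) p := pullback.lift p (𝟙 _) (by
    rw [hs₀, Category.comp_id, Category.id_comp])
  have hq₁ : q ≫ pullback.fst _ _ = p := pullback.lift_fst _ _ _
  have hq₂ : q ≫ pullback.snd _ _ = 𝟙 _ := pullback.lift_snd _ _ _
  have : IsIso q :=
    ⟨pullback.snd _ _, hq₂, by
      apply pullback.hom_ext
      · rw [Category.assoc, hq₁, ← hw₁, Category.id_comp]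
      · rw [Category.assoc, hq₂, Category.id_comp, Category.comp_id]⟩
  let mA : pushout (t 0) ι ⟶ U.c (Fin.last i) :=
    pushout.desc U.mid p (by rw [ht₀, Category.id_comp, fac])
  have hmA₁ : pushout.inl _ _ ≫ mA = U.mid := pushout.inl_desc _ _ _
  have hmA₂ : pushout.inr _ _ ≫ mA = p := pushout.inr_desc _ _ _
  let mB : pushout (t 0) ι ⟶ pullback (s (Fin.last i)) p := inv (pushout.inr (t 0) ι) ≫ q
  have hmB : mB ≫ pullback.fst _ _ = mA := by
    rw [Category.assoc, hq₁, IsIso.inv_comp_eq, hmA₂]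
  have hmB₂ : pushout.inl _ _ ≫ mB ≫ pullback.snd _ _ = ι := by
    rw [Category.assoc, hq₂, Category.comp_id, hw₀, Category.assoc, IsIso.hom_inv_id,
      Category.comp_id]
  let dA (k : Fin j) : pushout (t k.castSucc) ι ⟶ pushout (t k.succ) ι :=
    pushout.desc (U.arrd k ≫ pushout.inl _ _) (pushout.inr _ _) (by
      rw [← Category.assoc, ht, pushout.condition])
  have hdA (k : Fin j) : pushout.inl _ _ ≫ dA k = U.arrd k ≫ pushout.inl _ _ :=
    pushout.inl_desc _ _ _
  let cB (k : Fin i) : pullback (s k.castSucc) p ⟶ pullback (s k.succ) p :=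
    pullback.lift (pullback.fst _ _ ≫ U.arrc k) (pullback.snd _ _) (by
      rw [Category.assoc, hs, pullback.condition])
  have hcB (k : Fin i) : cB k ≫ pullback.fst _ _ = pullback.fst _ _ ≫ U.arrc k :=
    pullback.lift_fst _ _ _
  have hcB₂ (k : Fin i) : cB k ≫ pullback.snd _ _ = pullback.snd _ _ :=
    pullback.lift_snd _ _ _
  let A : ZigZag' ρ x y i j :=
    { c := U.c
      d := fun k => pushout (t k) ι
      l := U.l
      hl := U.hl
      arrc := U.arrc
      mid := mA
      hmid := hρ.of_precomp (pushout.inl (t 0) ι) mA (hinl 0) (hmA₁.symm ▸ U.hmid)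
      arrd := dA
      r := U.r ≫ pushout.inl _ _
      hr := ρ.W_comp _ _ U.hr (hinl _) }
  let B : ZigZag' ρ x y i j :=
    { c := fun k => pullback (s k) p
      d := fun k => pushout (t k) ι
      l := pullback.fst _ _ ≫ U.l
      hl := ρ.W_comp _ _ (hfst 0) U.hl
      arrc := cB
      mid := mB
      hmid := hρ.of_isIso mB
      arrd := dA
      r := U.r ≫ pushout.inl _ _
      hr := ρ.W_comp _ _ U.hr (hinl _) }
  let φ : ZigZag'Hom U A :=
    { uc := fun k => 𝟙 (U.c k)
      ud := fun k => pushout.inl (t k) ι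
      huc := fun k => ρ.W_id _
      hud := hinl
      comm_l := Category.id_comp _
      comm_arrc := fun k => (Category.id_comp _).trans (Category.comp_id _).symm
      comm_mid := hmA₁.trans (Category.comp_id _).symm
      comm_arrd := hdA
      comm_r := rfl }
  let ψ : ZigZag'Hom B A :=
    { uc := fun k => pullback.fst (s k) p
      ud := fun k => 𝟙 (pushout (t k) ι)
      huc := hfst
      hud := fun k => ρ.W_id _
      comm_l := rfl
      comm_arrc := fun k => (hcB k).symm
      comm_mid := (Category.id_comp _).trans hmB.symm
      comm_arrd := fun k => (Category.id_comp _).trans (Category.comp_id _).symm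
      comm_r := Category.comp_id _ }
  refine ⟨A, B, φ, ψ, inferInstanceAs (IsIso mB), fun E' _ ρ' hρ' Φ hΦ _ _ => ?_⟩
  have sq (k) : IsPullback (Φ.map (pullback.fst (s k) p)) (Φ.map (pullback.snd (s k) p))
    (Φ.map (s k)) (Φ.map p) := (IsPullback.of_hasPullback (s k) p).map Φ
  have hι : inv (Φ.map U.mid) ≫ Φ.map ι ≫ Φ.map p = 𝟙 _ := by
    rw [IsIso.inv_comp_eq, ← Φ.map_comp, fac, Category.comp_id]
  let lift (k) : Φ.obj (U.c k) ⟶ Φ.obj (pullback (s k) p) :=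
    (sq k).lift (𝟙 _) (Φ.map (s k) ≫ inv (Φ.map U.mid) ≫ Φ.map ι) (by simp [hι])
  have h₁ k : lift k ≫ Φ.map (pullback.fst _ _) = 𝟙 _ := (sq k).lift_fst _ _ _
  have h₂ k : lift k ≫ Φ.map (pullback.snd _ _) = Φ.map (s k) ≫ inv (Φ.map U.mid) ≫ Φ.map ι :=
    (sq k).lift_snd _ _ _
  have hlift k : ρ'.W (lift k) :=
    hρ'.of_postcomp _ _ (hΦ _ (hfst k)) (by rw [h₁]; exact ρ'.W_id _)
  exact ⟨
    { uc := lift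
      ud := fun k => Φ.map (pushout.inl (t k) ι)
      huc := hlift
      hud := fun k => hΦ _ (hinl k)
      comm_l := by
        refine (congrArg (lift 0 ≫ ·) (Φ.map_comp (pullback.fst _ _) U.l)).trans ?_
        rw [← Category.assoc, h₁]
        exact Category.id_comp _
      comm_arrc := fun k => by
        have : lift k.castSucc ≫ Φ.map (cB k) = Φ.map (U.arrc k) ≫ lift k.succ := by
          apply (sq _).hom_ext
          · rw [Category.assoc, Category.assoc, h₁, ← Φ.map_comp, hcB, Φ.map_comp,
              ← Category.assoc, h₁, Category.id_comp, Category.comp_id]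
          · rw [Category.assoc, Category.assoc, h₂, ← Φ.map_comp, hcB₂, h₂, ← hs, Φ.map_comp,
              Category.assoc]
        exact this
      comm_mid := by
        have : Φ.map (pushout.inl _ _) ≫ Φ.map mB = Φ.map U.mid ≫ lift (Fin.last i) := by
          apply (sq _).hom_ext
          · rw [Category.assoc, Category.assoc, h₁, ← Φ.map_comp, ← Φ.map_comp, hmB, hmA₁,
              Category.comp_id]
          · rw [Category.assoc, Category.assoc, h₂, ← Φ.map_comp, ← Φ.map_comp, hmB₂, hs₀,
              Φ.map_id, Category.id_comp, IsIso.hom_inv_id_assoc]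
        exact this
      comm_arrd := fun k => by
        have : Φ.map (pushout.inl _ _) ≫ Φ.map (dA k) =
            Φ.map (U.arrd k) ≫ Φ.map (pushout.inl _ _) := by
          rw [← Φ.map_comp, hdA, Φ.map_comp]
        exact this
      comm_r := (Φ.map_comp _ _).symm }⟩

end Straightening

section InsertEquiv

variable {R : Type u} [Category.{v} R] {ρ : RelCatStruct R} {x y : R} {i j : ℕ}

lemma RelCatStruct.IsSaturated.functors (hρ : ρ.IsSaturated) (T : Type*) [Category T] :
    (ρ.functors T).IsSaturated where
  of_precomp f g hf hfg t := hρ.of_precomp (f.app t) (g.app t) (hf t) (hfg t)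
  of_postcomp f g hg hfg t := hρ.of_postcomp (f.app t) (g.app t) (hg t) (hfg t)
  of_isIso f _ t := hρ.of_isIso (f.app t)

lemma ZigZag'.IsHomotopical.W_iff (hρ : ρ.IsSaturated) {T : Type*} [Category T] {a b : T ⥤ R}
    (f : a ⟶ b) (hf : ∀ t, ρ.W (f.app t)) {s t : T} (g : s ⟶ t) :
    ρ.W (a.map g) ↔ ρ.W (b.map g) := by
  have h := f.naturality g
  constructor
  · intro hg
    refine hρ.of_precomp (f.app s) _ (hf s) ?_
    rw [← h]
    exact ρ.W_comp _ _ hg (hf t)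
  · intro hg
    refine hρ.of_postcomp _ (f.app t) (hf t) ?_
    rw [h]
    exact ρ.W_comp _ _ (hf s) hg

lemma ZigZag'.isHomotopical_iff (hρ : ρ.IsSaturated) {T : Type*} [Category T]
    {A B : ZigZag' (ρ.functors T) ((Functor.const T).obj x) ((Functor.const T).obj y) i j}
    (φ : ZigZag'Hom A B) : A.IsHomotopical ↔ B.IsHomotopical :=
  ⟨fun h => ⟨fun k _ _ f => (IsHomotopical.W_iff hρ (φ.uc k) (φ.huc k) f).1 (h.c k f),
    fun k _ _ f => (IsHomotopical.W_iff hρ (φ.ud k) (φ.hud k) f).1 (h.d k f)⟩,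
  fun h => ⟨fun k _ _ f => (IsHomotopical.W_iff hρ (φ.uc k) (φ.huc k) f).2 (h.c k f),
    fun k _ _ f => (IsHomotopical.W_iff hρ (φ.ud k) (φ.hud k) f).2 (h.d k f)⟩⟩

/-- The identity-insertion functor is a weak equivalence in the presence of a suitable
weak factorization system. -/
theorem isWeakHomotopyEquiv_insertFunctor [HasFiniteCoproducts R] [HasPushouts R]
    [HasPullbacks R] (hρ : ρ.IsSaturated) (Fib : MorphismProperty R) [Fib.RespectsIso]
    (fact : ∀ {a b : R} (f : a ⟶ b), ∃ (c : R) (l : a ⟶ c) (r : c ⟶ b),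
      Fib.llp l ∧ Fib r ∧ l ≫ r = f)
    (hllp : ∀ {a b : R} (f : a ⟶ b), Fib.llp f → ρ.W f)
    (hpb : ∀ {a b c d : R} {f : a ⟶ b} {g : a ⟶ c} {h : b ⟶ d} {k : c ⟶ d},
      IsPullback f g h k → Fib k → ρ.W k → ρ.W f) :
    IsWeakHomotopyEquiv (nerveMap (insertFunctor ρ x y i j)) := by
  let F := Str.lv.{v} (ZigZag' ρ x y i j)
  let U := ZigZag'.ofFunctor F
  have hU : U.IsHomotopical := ZigZag'.isHomotopical_ofFunctor F
  obtain ⟨e, ι, p, fac, hι, hp⟩ := (IsDirect.str _).exists_factorization fact U.mid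
  have hpW t : ρ.W (p.app t) := by
    refine hρ.of_precomp (ι.app t) _ (hllp _ (hι t)) ?_
    rw [← NatTrans.comp_app, fac]
    exact U.hmid t
  obtain ⟨A, B, φ, ψ, hB, H⟩ :=
    ZigZag'.exists_isIso_mid.{max u v, max u v, max u v, max u v} (hρ.functors _) U ι p fac
    (fun f g h sq t => hllp _ <| by
      have := sq.map ((evaluation _ _).obj t)
      exact MorphismProperty.of_isPushout this (hι t))
    (fun f g h sq t => hpb (sq.map ((evaluation _ _).obj t)) (hp t) (hpW t))
  have hA' := (ZigZag'.isHomotopical_iff hρ φ).1 hU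
  have hB' := (ZigZag'.isHomotopical_iff hρ ψ).2 hA'
  let K := insertFunctor ρ x y i j
  have hK (σ) : IsIso ((F.obj ((Str.map K).obj σ)).mid) := by
    have key (X : ZigZag' ρ x y i j) (Y) (h : X = K.obj Y) : IsIso X.mid := by
      subst h
      exact inferInstanceAs (IsIso (𝟙 _))
    exact key _ _ (Functor.congr_obj (Str.map_lv.{v, v} K) σ)
  let Φ := (Functor.whiskeringLeft _ _ R).obj (Str.map.{v, v} K)
  have : IsIso (Φ.map U.mid) := by
    have hΦ σ : IsIso ((Φ.map U.mid).app σ) := hK σ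
    exact NatIso.isIso_of_isIso_app _
  obtain ⟨χ⟩ := H _ (ρ.functors _) (hρ.functors _) Φ fun f hf t => hf _
  have hmid (σ) : IsIso (B.mid.app σ) := inferInstance
  refine isWeakHomotopyEquiv_of_deformation.{v, u} K (ρ := B.toFunctor hB') (.trans
    (htpy_of_natTrans (ZigZag'.toFunctorMap φ hU hA'))
    (.symm (htpy_of_natTrans (ZigZag'.toFunctorMap ψ hB' hA')))) (fun σ => ?_)
    (μ := Str.map K ⋙ F) (fun σ => ?_) ?_ (𝟙 _)
  · have : IsIso ((B.toFunctor hB').obj σ).mid := hmid σ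
    exact insertFunctor_essImage hρ _
  · have : IsIso ((Str.map K ⋙ F).obj σ).mid := hK σ
    exact insertFunctor_essImage hρ _
  · exact ZigZag'.toFunctorMap χ ⟨fun k _ _ f => hU.c k _, fun k _ _ f => hU.d k _⟩
      ⟨fun k _ _ f => hB'.c k _, fun k _ _ f => hB'.d k _⟩

end InsertEquiv

section FullCollage

variable {C : Type u} {D : Type u} [Category.{v} C] [Category.{v} D]

/-- The collage of all objects of `C` and all objects of `D`. -/
abbrev FullCollage (G : D ⥤ C) : Type u := Collage G (fun _ => True) (fun _ => True)

namespace FullCollage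

/-- The inclusion of the first fiber. -/
def inl (G : D ⥤ C) : C ⥤ FullCollage G where
  obj c := Sum.inl ⟨c, trivial⟩
  map f := f
  map_id _ := rfl
  map_comp _ _ := rfl

/-- The inclusion of the second fiber. -/
def inr (G : D ⥤ C) : D ⥤ FullCollage G where
  obj d := Sum.inr ⟨d, trivial⟩
  map f := f
  map_id _ := rfl
  map_comp _ _ := rfl

variable {G : D ⥤ C}

lemma false_of_hom {c : C} {d : D} (f : (inr G).obj d ⟶ (inl G).obj c) : False := f.elim

instance : (inl G).Full := ⟨fun f => ⟨f, rfl⟩⟩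

instance : (inl G).Faithful := ⟨fun h => h⟩

instance : (inr G).Full := ⟨fun f => ⟨f, rfl⟩⟩

instance : (inr G).Faithful := ⟨fun h => h⟩

lemma essImage_cases (X : FullCollage G) : (inl G).essImage X ∨ (inr G).essImage X := by
  rcases X with X | X
  · exact Or.inl ⟨X.1, ⟨Iso.refl _⟩⟩
  · exact Or.inr ⟨X.1, ⟨Iso.refl _⟩⟩

/-- The right adjoint of `inl G`. -/
def toLeft (G : D ⥤ C) : FullCollage G ⥤ C where
  obj
    | Sum.inl c => c.1
    | Sum.inr d => G.obj d.1
  map {a b} f := match a, b, f with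
    | Sum.inl _, Sum.inl _, f => f
    | Sum.inl _, Sum.inr _, f => f
    | Sum.inr _, Sum.inr _, f => G.map f
    | Sum.inr _, Sum.inl _, f => f.elim
  map_id := by
    rintro (a | a)
    · rfl
    · exact G.map_id _
  map_comp {a b c} f g := by
    rcases a with a | a <;> rcases b with b | b <;> rcases c with c | c <;>
      first | rfl | exact f.elim | exact g.elim | exact G.map_comp _ _

/-- The adjunction between `inl G` and `toLeft G`. -/
def inlAdj (G : D ⥤ C) : inl G ⊣ toLeft G :=
  Adjunction.mkOfHomEquiv
    { homEquiv := fun c X => match X with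
        | Sum.inl _ => Equiv.refl _
        | Sum.inr _ => Equiv.refl _
      homEquiv_naturality_left_symm := fun {_ _ X} f g => by rcases X with X | X <;> rfl
      homEquiv_naturality_right := fun {_ X Y} f g => by
        rcases X with X | X <;> rcases Y with Y | Y <;> first | rfl | exact g.elim }

variable {F : C ⥤ D}

/-- The left adjoint of `inr G`. -/
def toRight (adj : F ⊣ G) : FullCollage G ⥤ D where
  obj
    | Sum.inl c => F.obj c.1
    | Sum.inr d => d.1
  map {a b} f := match a, b, f with
    | Sum.inl _, Sum.inl _, f => F.map f
    | Sum.inl c, Sum.inr d, f => (adj.homEquiv c.1 d.1).symm f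
    | Sum.inr _, Sum.inr _, f => f
    | Sum.inr _, Sum.inl _, f => f.elim
  map_id := by
    rintro (a | a)
    · exact F.map_id _
    · rfl
  map_comp {a b c} f g := by
    rcases a with a | a <;> rcases b with b | b <;> rcases c with c | c <;>
      first
        | rfl
        | exact f.elim
        | exact g.elim
        | exact F.map_comp _ _
        | exact adj.homEquiv_naturality_left_symm _ _
        | exact adj.homEquiv_naturality_right_symm _ _

/-- The adjunction between `toRight adj` and `inr G`. -/
def inrAdj (adj : F ⊣ G) : toRight adj ⊣ inr G :=
  Adjunction.mkOfHomEquiv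
    { homEquiv := fun X d => match X with
        | Sum.inl c => adj.homEquiv c.1 d
        | Sum.inr _ => Equiv.refl _
      homEquiv_naturality_left_symm := fun {X Y _} f g => by
        rcases X with X | X <;> rcases Y with Y | Y <;>
          first
            | rfl
            | exact f.elim
            | exact adj.homEquiv_naturality_left_symm _ _
            | exact adj.homEquiv_naturality_right_symm _ _
      homEquiv_naturality_right := fun {X _ _} f g => by
        rcases X with X | X
        · exact adj.homEquiv_naturality_right _ _
        · rfl }

lemma hasColimitsOfShape (adj : F ⊣ G) (J : Type*) [Category J] [HasColimitsOfShape J C]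
    [HasColimitsOfShape J D] : HasColimitsOfShape J (FullCollage G) where
  has_colimit K := by
    by_cases h : ∀ j, (inl G).essImage (K.obj j)
    · have := (inlAdj G).leftAdjoint_preservesColimits
      exact hasColimit_of_iso (Functor.essImage.liftFunctorCompIso K (inl G) h).symm
    · push Not at h
      obtain ⟨j₀, hj₀⟩ := h
      obtain ⟨d₀, ⟨e₀⟩⟩ := (essImage_cases _).resolve_left hj₀
      let c : Cocone K :=
        { pt := (inr G).obj (colimit (K ⋙ toRight adj))
          ι :=
            { app := fun j => (inrAdj adj).homEquiv _ _ (colimit.ι (K ⋙ toRight adj) j)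
              naturality := fun i j f => by
                rw [← (inrAdj adj).homEquiv_naturality_left]
                exact (congrArg _ (colimit.w (K ⋙ toRight adj) f)).trans
                  (Category.comp_id _).symm } }
      refine ⟨⟨c, IsColimit.ofExistsUnique fun s => ?_⟩⟩
      obtain ⟨a, ⟨e⟩⟩ | ⟨d, ⟨e⟩⟩ := essImage_cases s.pt
      · exact (false_of_hom (e₀.hom ≫ s.ι.app j₀ ≫ e.inv)).elim
      · let t : Cocone (K ⋙ toRight adj) :=
          { pt := d
            ι :=
              { app := fun j => ((inrAdj adj).homEquiv _ _).symm (s.ι.app j ≫ e.inv)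
                naturality := fun i j f => by
                  have := (inrAdj adj).homEquiv_naturality_left_symm (K.map f) (s.ι.app j ≫ e.inv)
                  rw [s.w_assoc] at this
                  exact this.symm.trans (Category.comp_id _).symm } }
        have hc (j) (m : colimit (K ⋙ toRight adj) ⟶ d) :
            c.ι.app j ≫ (inr G).map m = (inrAdj adj).homEquiv _ _
              (colimit.ι (K ⋙ toRight adj) j ≫ m) :=
          ((inrAdj adj).homEquiv_naturality_right _ _).symm
        have ht (j) : (inrAdj adj).homEquiv (K.obj j) d (t.ι.app j) = s.ι.app j ≫ e.inv :=
          Equiv.apply_symm_apply _ _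
        refine ⟨(inr G).map (colimit.desc _ t) ≫ e.hom, fun j => ?_, fun m hm => ?_⟩
        · rw [← Category.assoc, hc, colimit.ι_desc, ht, Category.assoc,
            e.inv_hom_id]
          exact Category.comp_id _
        · obtain ⟨m', hm'⟩ := (inr G).map_surjective (m ≫ e.inv)
          rw [← Iso.comp_inv_eq, ← hm']
          congr 1
          refine colimit.hom_ext fun j => ((inrAdj adj).homEquiv _ _).injective ?_
          rw [← hc, colimit.ι_desc, ht, hm', ← Category.assoc]
          exact congrArg (· ≫ e.inv) (hm j)

lemma hasLimitsOfShape (adj : F ⊣ G) (J : Type*) [Category J] [HasLimitsOfShape J C]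
    [HasLimitsOfShape J D] : HasLimitsOfShape J (FullCollage G) where
  has_limit K := by
    by_cases h : ∀ j, (inr G).essImage (K.obj j)
    · have := (inrAdj adj).rightAdjoint_preservesLimits
      exact hasLimit_of_iso (Functor.essImage.liftFunctorCompIso K (inr G) h)
    · push Not at h
      obtain ⟨j₀, hj₀⟩ := h
      obtain ⟨c₀, ⟨e₀⟩⟩ := (essImage_cases _).resolve_right hj₀
      let c : Cone K :=
        { pt := (inl G).obj (limit (K ⋙ toLeft G))
          π :=
            { app := fun j => ((inlAdj G).homEquiv _ _).symm (limit.π (K ⋙ toLeft G) j)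
              naturality := fun i j f => by
                rw [← (inlAdj G).homEquiv_naturality_right_symm]
                exact (Category.id_comp _).trans
                  (congrArg _ (limit.w (K ⋙ toLeft G) f).symm) } }
      refine ⟨⟨c, IsLimit.ofExistsUnique fun s => ?_⟩⟩
      obtain ⟨d, ⟨e⟩⟩ | ⟨a, ⟨e⟩⟩ := (essImage_cases s.pt).symm
      · exact (false_of_hom (e.hom ≫ s.π.app j₀ ≫ e₀.inv)).elim
      · let t : Cone (K ⋙ toLeft G) :=
          { pt := a
            π :=
              { app := fun j => (inlAdj G).homEquiv _ _ (e.hom ≫ s.π.app j)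
                naturality := fun i j f => by
                  have := (inlAdj G).homEquiv_naturality_right (e.hom ≫ s.π.app i) (K.map f)
                  rw [Category.assoc, s.w] at this
                  exact (Category.id_comp _).trans this } }
        have hc (j) (m : a ⟶ limit (K ⋙ toLeft G)) :
            (inl G).map m ≫ c.π.app j = ((inlAdj G).homEquiv _ _).symm
              (m ≫ limit.π (K ⋙ toLeft G) j) :=
          ((inlAdj G).homEquiv_naturality_left_symm _ _).symm
        have ht (j) : ((inlAdj G).homEquiv a (K.obj j)).symm (t.π.app j) = e.hom ≫ s.π.app j :=
          Equiv.symm_apply_apply _ _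
        refine ⟨e.inv ≫ (inl G).map (limit.lift _ t), fun j => ?_, fun m hm => ?_⟩
        · rw [Category.assoc, hc, limit.lift_π, ht, e.inv_hom_id_assoc]
        · obtain ⟨m', hm'⟩ := (inl G).map_surjective (e.hom ≫ m)
          rw [Iso.eq_inv_comp, ← hm']
          congr 1
          refine limit.hom_ext fun j => ((inlAdj G).homEquiv _ _).symm.injective ?_
          rw [← hc, limit.lift_π, ht, hm', Category.assoc]
          exact congrArg (e.hom ≫ ·) (hm j)

end FullCollage

end FullCollage

section ModelStructure

variable {C : Type u} [Category.{v} C]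

namespace ModelStructure

variable (M : ModelStructure C)

lemma isRetractOf_of_isIso {a b : C} (f : a ⟶ b) [IsIso f] : IsRetractOf f (𝟙 a) :=
  ⟨𝟙 a, 𝟙 a, inv f, f, by simp, by simp, by simp, by simp⟩

/-- The retract argument for the first factor. -/
lemma isRetractOf_left {a b c : C} {f : a ⟶ b} {i : a ⟶ c} {p : c ⟶ b} (fac : i ≫ p = f)
    [HasLiftingProperty f p] : IsRetractOf f i := by
  have sq : CommSq i f p (𝟙 b) := ⟨by simpa using fac⟩
  exact ⟨𝟙 a, 𝟙 a, sq.lift, p, by simp, by simp, by simp, by simpa using fac.symm⟩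

/-- The retract argument for the second factor. -/
lemma isRetractOf_right {a b c : C} {f : a ⟶ b} {i : a ⟶ c} {p : c ⟶ b} (fac : i ≫ p = f)
    [HasLiftingProperty i f] : IsRetractOf f p := by
  have sq : CommSq (𝟙 a) i f p := ⟨by simpa using fac.symm⟩
  exact ⟨i, sq.lift, 𝟙 b, 𝟙 b, by simp, by simp, by simpa using fac, by simp⟩

variable {M}

lemma W_of_isIso {a b : C} (f : a ⟶ b) [IsIso f] : M.W f :=
  M.W_retract (isRetractOf_of_isIso f) (M.W_id a)

lemma Cof_of_isIso {a b : C} (f : a ⟶ b) [IsIso f] : M.Cof f :=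
  M.Cof_retract (isRetractOf_of_isIso f) (M.Cof_id a)

lemma Fib_of_isIso {a b : C} (f : a ⟶ b) [IsIso f] : M.Fib f :=
  M.Fib_retract (isRetractOf_of_isIso f) (M.Fib_id a)

lemma Cof_of_llp {a b : C} {f : a ⟶ b}
    (h : ∀ {c d : C} (p : c ⟶ d), M.Fib p → M.W p → HasLiftingProperty f p) : M.Cof f := by
  obtain ⟨c, i, p, hi, hp, hp', fac⟩ := M.fact_cof_afib f
  have := h p hp hp'
  exact M.Cof_retract (isRetractOf_left fac) hi

lemma W_of_llp {a b : C} {f : a ⟶ b}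
    (h : ∀ {c d : C} (p : c ⟶ d), M.Fib p → HasLiftingProperty f p) : M.W f := by
  obtain ⟨c, i, p, _, hi, hp, fac⟩ := M.fact_acof_fib f
  have := h p hp
  exact M.W_retract (isRetractOf_left fac) hi

lemma Fib_of_rlp {a b : C} {f : a ⟶ b}
    (h : ∀ {c d : C} (i : c ⟶ d), M.Cof i → M.W i → HasLiftingProperty i f) : M.Fib f := by
  obtain ⟨c, i, p, hi, hi', hp, fac⟩ := M.fact_acof_fib f
  have := h i hi hi'
  exact M.Fib_retract (isRetractOf_right fac) hp

lemma W_of_rlp {a b : C} {f : a ⟶ b}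
    (h : ∀ {c d : C} (i : c ⟶ d), M.Cof i → HasLiftingProperty i f) : M.W f := by
  obtain ⟨c, i, p, hi, _, hp, fac⟩ := M.fact_cof_afib f
  have := h i hi
  exact M.W_retract (isRetractOf_right fac) hp

end ModelStructure

lemma Cofibrant.of_iso [HasInitial C] {M : ModelStructure C} {a b : C} (h : Cofibrant M a)
    (e : a ≅ b) : Cofibrant M b := by
  have : initial.to b = initial.to a ≫ e.hom := initial.hom_ext _ _
  rw [Cofibrant, this]
  exact M.Cof_comp _ _ h (ModelStructure.Cof_of_isIso _)

lemma Fibrant.of_iso [HasTerminal C] {M : ModelStructure C} {a b : C} (h : Fibrant M a)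
    (e : a ≅ b) : Fibrant M b := by
  have : terminal.from b = e.inv ≫ terminal.from a := terminal.hom_ext _ _
  rw [Fibrant, this]
  exact M.Fib_comp _ _ (ModelStructure.Fib_of_isIso _) h

end ModelStructure

namespace QuillenAdjunction

variable {C : Type u} {D : Type u} [Category.{v} C] [Category.{v} D]
  {MC : ModelStructure C} {MD : ModelStructure D} (Q : QuillenAdjunction MC MD)

lemma hasLiftingProperty_acof {a b : C} {c d : D} {i : a ⟶ b} {p : c ⟶ d} (hi : MC.Cof i)
    (hi' : MC.W i) (hp : MD.Fib p) : HasLiftingProperty i (Q.G.map p) :=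
  (Q.adj.hasLiftingProperty_iff i p).1
    (MD.lifting_acof_fib _ _ (Q.F_cof i hi) (Q.F_acof i hi hi') hp)

lemma hasLiftingProperty_cof {a b : C} {c d : D} {i : a ⟶ b} {p : c ⟶ d} (hi : MC.Cof i)
    (hp : MD.Fib p) (hp' : MD.W p) : HasLiftingProperty i (Q.G.map p) :=
  (Q.adj.hasLiftingProperty_iff i p).1 (MD.lifting_cof_afib _ _ (Q.F_cof i hi) hp hp')

end QuillenAdjunction

namespace FullCollage

section Lifting

variable {C : Type u} {D : Type u} [Category.{v} C] [Category.{v} D] {G : D ⥤ C} {F : C ⥤ D}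

lemma hasLiftingProperty_inl_iff {a b c d : C} (i : a ⟶ b) (p : c ⟶ d) :
    HasLiftingProperty ((inl G).map i) ((inl G).map p) ↔ HasLiftingProperty i p :=
  (inlAdj G).hasLiftingProperty_iff i ((inl G).map p)

lemma hasLiftingProperty_inl_inr_iff {a b : C} {c d : D} (i : a ⟶ b) (p : c ⟶ d) :
    HasLiftingProperty ((inl G).map i) ((inr G).map p) ↔ HasLiftingProperty i (G.map p) :=
  (inlAdj G).hasLiftingProperty_iff i ((inr G).map p)

lemma hasLiftingProperty_inr_iff (adj : F ⊣ G) {a b c d : D} (i : a ⟶ b) (p : c ⟶ d) :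
    HasLiftingProperty ((inr G).map i) ((inr G).map p) ↔ HasLiftingProperty i p :=
  ((inrAdj adj).hasLiftingProperty_iff ((inr G).map i) p).symm

lemma hasLiftingProperty_of_source {a : D} {b : FullCollage G} {c : C} {d : FullCollage G}
    (i : (inr G).obj a ⟶ b) (p : (inl G).obj c ⟶ d) : HasLiftingProperty i p :=
  ⟨fun {f} _ _ => (false_of_hom f).elim⟩

lemma hasLiftingProperty_of_target {a : FullCollage G} {b : D} {c : FullCollage G} {d : C}
    (i : a ⟶ (inr G).obj b) (p : c ⟶ (inl G).obj d) : HasLiftingProperty i p :=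
  ⟨fun {_ g} _ => (false_of_hom g).elim⟩

end Lifting

end FullCollage

namespace FullCollage

variable {C : Type u} {D : Type u} [Category.{v} C] [Category.{v} D]
  {MC : ModelStructure C} {MD : ModelStructure D} (Q : QuillenAdjunction MC MD)

/-- The relative category structure on the collage of all objects. -/
abbrev rel : RelCatStruct (FullCollage Q.G) := collageRel Q (fun _ => True) (fun _ => True)

lemma not_isIso_of_bridge {G : D ⥤ C} {c : C} {d : D} (f : (inl G).obj c ⟶ (inr G).obj d)
    [IsIso f] : False :=
  false_of_hom (inv f)

lemma isIso_inl {G : D ⥤ C} {a b : C} (f : a ⟶ b) [IsIso ((inl G).map f)] : IsIso f :=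
  isIso_of_reflects_iso f (inl G)

lemma isIso_inr {G : D ⥤ C} {a b : D} (f : a ⟶ b) [IsIso ((inr G).map f)] : IsIso f :=
  isIso_of_reflects_iso f (inr G)

lemma isSaturated : (rel Q).IsSaturated where
  of_precomp {a b c} f g hf hg := by
    rcases a with a | a <;> rcases b with b | b <;> rcases c with c | c <;>
      first
        | exact f.elim | exact g.elim | exact hf.elim | exact hg.elim
        | exact MC.W_of_precomp f g hf hg
        | exact MD.W_of_precomp f g hf hg
  of_postcomp {a b c} f g hf hg := by
    rcases a with a | a <;> rcases b with b | b <;> rcases c with c | c <;>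
      first
        | exact f.elim | exact g.elim | exact hf.elim | exact hg.elim
        | exact MC.W_of_postcomp f g hf hg
        | exact MD.W_of_postcomp f g hf hg
  of_isIso {a b} f hf := by
    rcases a with a | a <;> rcases b with b | b
    · have := @isIso_inl _ _ _ _ Q.G a.1 b.1 f hf
      exact ModelStructure.W_of_isIso (M := MC) (a := a.1) (b := b.1) f
    · exact (@not_isIso_of_bridge _ _ _ _ Q.G a.1 b.1 f hf).elim
    · exact f.elim
    · have := @isIso_inr _ _ _ _ Q.G a.1 b.1 f hf
      exact ModelStructure.W_of_isIso (M := MD) (a := a.1) (b := b.1) f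

/-- The cofibrations of `C` and the morphisms whose target is in `D`. -/
def cofLeft : MorphismProperty (FullCollage Q.G) := fun a b f => match a, b, f with
  | Sum.inl _, Sum.inl _, f => MC.Cof f
  | Sum.inl _, Sum.inr _, _ => True
  | Sum.inr _, Sum.inl _, _ => False
  | Sum.inr _, Sum.inr _, _ => True

/-- The acyclic cofibrations of `D`. -/
def acofRight : MorphismProperty (FullCollage Q.G) := fun a b f => match a, b, f with
  | Sum.inl _, Sum.inl _, _ => False
  | Sum.inl _, Sum.inr _, _ => False
  | Sum.inr _, Sum.inl _, _ => False
  | Sum.inr _, Sum.inr _, f => MD.Cof f ∧ MD.W f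

/-- The acyclic cofibrations of `C` and of `D`. -/
def acof : MorphismProperty (FullCollage Q.G) := fun a b f => match a, b, f with
  | Sum.inl _, Sum.inl _, f => MC.Cof f ∧ MC.W f
  | Sum.inl _, Sum.inr _, _ => False
  | Sum.inr _, Sum.inl _, _ => False
  | Sum.inr _, Sum.inr _, f => MD.Cof f ∧ MD.W f

variable {Q}

lemma cofLeft_of_target {a : FullCollage Q.G} {d : D} (f : a ⟶ (inr Q.G).obj d) :
    cofLeft Q f := by
  rcases a with a | a <;> trivial

lemma isIso_of_rlp_cofLeft {a : FullCollage Q.G} {d : D} (f : a ⟶ (inr Q.G).obj d)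
    (hf : (cofLeft Q).rlp f) : IsIso f := by
  have := hf f (cofLeft_of_target f)
  have sq : CommSq (𝟙 _) f f (𝟙 _) := ⟨by simp⟩
  exact ⟨sq.lift, sq.fac_left, sq.fac_right⟩

lemma rlp_cofLeft_inl_iff {a b : C} (f : a ⟶ b) :
    (cofLeft Q).rlp ((inl Q.G).map f) ↔ MC.Fib f ∧ MC.W f := by
  constructor
  · intro h
    have h' {c d : C} (i : c ⟶ d) (hi : MC.Cof i) : HasLiftingProperty i f :=
      (hasLiftingProperty_inl_iff (G := Q.G) _ _).1 (h ((inl Q.G).map i) hi)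
    exact ⟨ModelStructure.Fib_of_rlp fun i hi _ => h' i hi, ModelStructure.W_of_rlp h'⟩
  · rintro ⟨h, h'⟩ c d i hi
    rcases d with d | d
    · rcases c with c | c
      · exact (hasLiftingProperty_inl_iff (a := c.1) (b := d.1) i f).2
          (MC.lifting_cof_afib _ _ hi h h')
      · exact hi.elim
    · exact hasLiftingProperty_of_target (b := d.1) i _

lemma rlp_acofRight_inr_iff {a b : D} (f : a ⟶ b) :
    (acofRight Q).rlp ((inr Q.G).map f) ↔ MD.Fib f := by
  constructor
  · intro h
    exact ModelStructure.Fib_of_rlp fun i hi hi' =>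
      (hasLiftingProperty_inr_iff Q.adj _ _).1 (h ((inr Q.G).map i) ⟨hi, hi'⟩)
  · intro h c d i hi
    rcases c with c | c <;> rcases d with d | d <;> try exact hi.elim
    exact (hasLiftingProperty_inr_iff Q.adj (a := c.1) (b := d.1) i f).2
      (MD.lifting_acof_fib _ _ hi.1 hi.2 h)

lemma rlp_acofRight_of_source {a : C} {b : FullCollage Q.G} (f : (inl Q.G).obj a ⟶ b) :
    (acofRight Q).rlp f := by
  intro c d i hi
  rcases c with c | c
  · rcases d with d | d <;> exact hi.elim
  · exact hasLiftingProperty_of_source (a := c.1) i f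

lemma isIso_of_llp_rlp_acofRight {a : C} {b : FullCollage Q.G} (f : (inl Q.G).obj a ⟶ b)
    (hf : (acofRight Q).rlp.llp f) : IsIso f := by
  have := hf f (rlp_acofRight_of_source f)
  have sq : CommSq (𝟙 _) f f (𝟙 _) := ⟨by simp⟩
  exact ⟨sq.lift, sq.fac_left, sq.fac_right⟩

lemma rlp_acof_inl_iff {a b : C} (f : a ⟶ b) :
    (acof Q).rlp ((inl Q.G).map f) ↔ MC.Fib f := by
  constructor
  · intro h
    exact ModelStructure.Fib_of_rlp fun i hi hi' =>
      (hasLiftingProperty_inl_iff (G := Q.G) _ _).1 (h ((inl Q.G).map i) ⟨hi, hi'⟩)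
  · intro h c d i hi
    rcases c with c | c <;> rcases d with d | d <;> try exact hi.elim
    · exact (hasLiftingProperty_inl_iff (a := c.1) (b := d.1) i f).2
        (MC.lifting_acof_fib _ _ hi.1 hi.2 h)
    · exact hasLiftingProperty_of_source (a := c.1) i _

lemma rlp_acof_inr_iff {a b : D} (f : a ⟶ b) :
    (acof Q).rlp ((inr Q.G).map f) ↔ MD.Fib f := by
  constructor
  · intro h
    exact ModelStructure.Fib_of_rlp fun i hi hi' =>
      (hasLiftingProperty_inr_iff Q.adj _ _).1 (h ((inr Q.G).map i) ⟨hi, hi'⟩)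
  · intro h c d i hi
    rcases c with c | c <;> rcases d with d | d <;> try exact hi.elim
    · exact (hasLiftingProperty_inl_inr_iff (a := c.1) (b := d.1) i f).2
        (Q.hasLiftingProperty_acof hi.1 hi.2 h)
    · exact (hasLiftingProperty_inr_iff Q.adj (a := c.1) (b := d.1) i f).2
        (MD.lifting_acof_fib _ _ hi.1 hi.2 h)

lemma rlp_acof_bridge {a : C} {b : D} (f : (inl Q.G).obj a ⟶ (inr Q.G).obj b)
    (hf : MC.Fib ((toLeft Q.G).map f)) : (acof Q).rlp f := by
  intro c d i hi
  rcases c with c | c <;> rcases d with d | d <;> try exact hi.elim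
  · exact ((inlAdj Q.G).hasLiftingProperty_iff (A := c.1) (B := d.1) i f).2
      (MC.lifting_acof_fib _ _ hi.1 hi.2 hf)
  · exact hasLiftingProperty_of_source (a := c.1) i _

lemma exists_fact_acof {a b : FullCollage Q.G} (f : a ⟶ b) :
    ∃ (c : FullCollage Q.G) (i : a ⟶ c) (p : c ⟶ b),
      (acof Q).rlp.llp i ∧ (acof Q).rlp p ∧ i ≫ p = f := by
  rcases a with a | a <;> rcases b with b | b
  · obtain ⟨c, i, p, hi, hi', hp, fac⟩ := MC.fact_acof_fib (X := a.1) (Y := b.1) f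
    exact ⟨(inl Q.G).obj c, (inl Q.G).map i, (inl Q.G).map p,
      (acof Q).le_llp_rlp _ ⟨hi, hi'⟩, (rlp_acof_inl_iff p).2 hp, fac⟩
  · obtain ⟨c, i, p, hi, hi', hp, fac⟩ := MC.fact_acof_fib (X := a.1) (Y := Q.G.obj b.1) f
    exact ⟨(inl Q.G).obj c, (inl Q.G).map i, p,
      (acof Q).le_llp_rlp ((inl Q.G).map i) ⟨hi, hi'⟩,
      rlp_acof_bridge (a := c) (b := b.1) p hp, fac⟩
  · exact f.elim
  · obtain ⟨c, i, p, hi, hi', hp, fac⟩ := MD.fact_acof_fib (X := a.1) (Y := b.1) f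
    exact ⟨(inr Q.G).obj c, (inr Q.G).map i, (inr Q.G).map p,
      (acof Q).le_llp_rlp _ ⟨hi, hi'⟩, (rlp_acof_inr_iff p).2 hp, fac⟩

lemma W_of_llp_rlp_acof {a b : FullCollage Q.G} (f : a ⟶ b) (hf : (acof Q).rlp.llp f) :
    (rel Q).W f := by
  rcases a with a | a <;> rcases b with b | b
  · exact ModelStructure.W_of_llp (M := MC) (a := a.1) (b := b.1) (f := f) fun p hp =>
      (hasLiftingProperty_inl_iff (G := Q.G) (a := a.1) (b := b.1) f p).1
        (hf _ ((rlp_acof_inl_iff p).2 hp))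
  · obtain ⟨c, i, p, -, -, hp, fac⟩ := MC.fact_acof_fib (X := a.1) (Y := Q.G.obj b.1) f
    have := hf (X := (inl Q.G).obj c) (Y := (inr Q.G).obj b.1) p
      (rlp_acof_bridge (a := c) (b := b.1) p hp)
    have sq : CommSq ((inl Q.G).map i) f p (𝟙 ((inr Q.G).obj b.1)) :=
      ⟨fac.trans (Category.comp_id (X := (inl Q.G).obj a.1) (Y := (inr Q.G).obj b.1) f).symm⟩
    exact (false_of_hom (this.sq_hasLift sq).exists_lift.some.l).elim
  · exact f.elim
  · exact ModelStructure.W_of_llp (M := MD) (a := a.1) (b := b.1) (f := f) fun p hp =>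
      (hasLiftingProperty_inr_iff Q.adj (a := a.1) (b := b.1) f p).1
        (hf _ ((rlp_acof_inr_iff p).2 hp))

lemma W_of_isPullback [HasInitial D] {a b c d : FullCollage Q.G} {f : a ⟶ b} {g : a ⟶ c} {h : b ⟶ d}
    {k : c ⟶ d} (sq : IsPullback f g h k) (hk : (acof Q).rlp k) (hk' : (rel Q).W k) :
    (rel Q).W f := by
  have key (hf : ∀ {s t : C} (i : s ⟶ t), MC.Cof i → HasLiftingProperty ((inl Q.G).map i) k) :
      ∀ {s t : C} (i : s ⟶ t), MC.Cof i → HasLiftingProperty ((inl Q.G).map i) f :=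
    fun i hi => by
      have := hf i hi
      exact sq.flip.hasLiftingProperty _
  rcases c with c | c <;> rcases d with d | d <;> try exact hk'.elim
  · rcases b with b | b
    · rcases a with a | a
      · refine ModelStructure.W_of_rlp (M := MC) (a := a.1) (b := b.1) (f := f) fun i hi =>
          (hasLiftingProperty_inl_iff (G := Q.G) (c := a.1) (d := b.1) i f).1 (key ?_ i hi)
        exact fun i hi => (hasLiftingProperty_inl_iff (G := Q.G) (c := c.1) (d := d.1) i k).2
          (MC.lifting_cof_afib _ _ hi ((rlp_acof_inl_iff (a := c.1) (b := d.1) k).1 hk) hk')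
      · exact g.elim
    · exact h.elim
  · have hk := (rlp_acof_inr_iff (a := c.1) (b := d.1) k).1 hk
    have hl {s t : D} (i : s ⟶ t) (hi : MD.Cof i) : HasLiftingProperty ((inr Q.G).map i) k :=
      (hasLiftingProperty_inr_iff Q.adj (c := c.1) (d := d.1) i k).2
        (MD.lifting_cof_afib _ _ hi hk hk')
    rcases b with b | b
    · rcases a with a | a
      · refine ModelStructure.W_of_rlp (M := MC) (a := a.1) (b := b.1) (f := f) fun i hi =>
          (hasLiftingProperty_inl_iff (G := Q.G) (c := a.1) (d := b.1) i f).1 (key ?_ i hi)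
        exact fun i hi => (hasLiftingProperty_inl_inr_iff (c := c.1) (d := d.1) i k).2
          (Q.hasLiftingProperty_cof hi hk hk')
      · exact f.elim
    · rcases a with a | a
      · exact (false_of_hom (sq.lift ((inr Q.G).map (initial.to b.1))
          ((inr Q.G).map (initial.to c.1))
          (initial.hom_ext (initial.to b.1 ≫ (h : b.1 ⟶ d.1)) _))).elim
      · exact ModelStructure.W_of_rlp (M := MD) (a := a.1) (b := b.1) (f := f) fun i hi => by
          have := hl i hi
          have : HasLiftingProperty ((inr Q.G).map i) f := sq.flip.hasLiftingProperty _
          exact (hasLiftingProperty_inr_iff Q.adj (c := a.1) (d := b.1) i f).1 this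

end FullCollage

namespace FullCollage

variable {C : Type u} {D : Type u} [Category.{v} C] [Category.{v} D]
  {MC : ModelStructure C} {MD : ModelStructure D} (Q : QuillenAdjunction MC MD)

section Replacement

/-- The cofibrant objects of `C` and the fibrant objects of `D`. -/
def IsCF [HasInitial C] [HasTerminal D] : FullCollage Q.G → Prop
  | Sum.inl c => Cofibrant MC c.1
  | Sum.inr d => Fibrant MD d.1

/-- The initial object of `C` is initial in the collage. -/
noncomputable def isInitialInl [HasInitial C] (G : D ⥤ C) : IsInitial ((inl G).obj (⊥_ C)) :=
  have := (inlAdj G).leftAdjoint_preservesColimits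
  initialIsInitial.isInitialObj (inl G) _

/-- The terminal object of `D` is terminal in the collage. -/
noncomputable def isTerminalInr [HasTerminal D] : IsTerminal ((inr Q.G).obj (⊤_ D)) :=
  have := (inrAdj Q.adj).rightAdjoint_preservesLimits
  terminalIsTerminal.isTerminalObj (inr Q.G) _

variable {Q} in
lemma cofibrant_of_llp [HasInitial C] {a : C}
    (ha : (cofLeft Q).rlp.llp ((isInitialInl Q.G).to ((inl Q.G).obj a))) : Cofibrant MC a := by
  have : (isInitialInl Q.G).to ((inl Q.G).obj a) = (inl Q.G).map (initial.to a) :=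
    (isInitialInl Q.G).hom_ext _ _
  rw [this] at ha
  exact ModelStructure.Cof_of_llp fun p hp hp' =>
    (hasLiftingProperty_inl_iff (G := Q.G) (initial.to a) p).1
      (ha _ ((rlp_cofLeft_inl_iff p).2 ⟨hp, hp'⟩))

/-- Cofibrant replacement in `C` and fibrant replacement in `D`. -/
noncomputable def replacementSystem [HasInitial C] [HasTerminal D] (x : C) (y : D) :
    ReplacementSystem (rel Q) ((inl Q.G).obj x) ((inr Q.G).obj y) (IsCF Q) where
  bot := (inl Q.G).obj (⊥_ C)
  isInitial := isInitialInl Q.G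
  top := (inr Q.G).obj (⊤_ D)
  isTerminal := isTerminalInr Q
  R₁ := (cofLeft Q).rlp
  R₂ := (acofRight Q).rlp
  respectsIso₁ := inferInstance
  respectsIso₂ := inferInstance
  fact₁ {a b} f := by
    rcases b with b | b
    · rcases a with a | a
      · obtain ⟨c, i, p, hi, hp, hp', fac⟩ := MC.fact_cof_afib (X := a.1) (Y := b.1) f
        exact ⟨(inl Q.G).obj c, (inl Q.G).map i, (inl Q.G).map p,
          (cofLeft Q).le_llp_rlp _ hi, (rlp_cofLeft_inl_iff p).2 ⟨hp, hp'⟩, fac⟩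
      · exact f.elim
    · exact ⟨_, f, 𝟙 _, (cofLeft Q).le_llp_rlp _ (cofLeft_of_target (d := b.1) f),
        MorphismProperty.id_mem _ _, Category.comp_id _⟩
  fact₂ {a b} f := by
    rcases a with a | a
    · exact ⟨_, 𝟙 _, f, MorphismProperty.id_mem _ _, rlp_acofRight_of_source (a := a.1) f,
        Category.id_comp _⟩
    · rcases b with b | b
      · exact f.elim
      · obtain ⟨c, i, p, hi, hi', hp, fac⟩ := MD.fact_acof_fib (X := a.1) (Y := b.1) f
        exact ⟨(inr Q.G).obj c, (inr Q.G).map i, (inr Q.G).map p,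
          (acofRight Q).le_llp_rlp _ ⟨hi, hi'⟩, (rlp_acofRight_inr_iff p).2 hp, fac⟩
  W_of_R₁ {a b} f hf := by
    rcases b with b | b
    · rcases a with a | a
      · exact ((rlp_cofLeft_inl_iff (a := a.1) (b := b.1) f).1 hf).2
      · exact f.elim
    · exact @RelCatStruct.IsSaturated.of_isIso _ _ _ (isSaturated Q) _ _ f
        (isIso_of_rlp_cofLeft (d := b.1) f hf)
  W_of_llp_R₂ {a b} f hf := by
    rcases a with a | a
    · exact @RelCatStruct.IsSaturated.of_isIso _ _ _ (isSaturated Q) _ _ f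
        (isIso_of_llp_rlp_acofRight (a := a.1) f hf)
    · rcases b with b | b
      · exact f.elim
      · exact ModelStructure.W_of_llp (M := MD) (a := a.1) (b := b.1) (f := f) fun p hp =>
          (hasLiftingProperty_inr_iff Q.adj (a := a.1) (b := b.1) f p).1
            (hf _ ((rlp_acofRight_inr_iff p).2 hp))
  isIso_of_R₁ {a b} f g hf _ := by
    rcases b with b | b
    · exact g.elim
    · exact isIso_of_rlp_cofLeft (d := b.1) f hf
  isIso_of_llp_R₂ {a b} f g hf _ := by
    rcases a with a | a
    · exact isIso_of_llp_rlp_acofRight (a := a.1) f hf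
    · exact g.elim
  cf_of_R₁ {a b} f ha hf hb := by
    rcases a with a | a
    · exact cofibrant_of_llp (a := a.1) ha
    · rcases b with b | b
      · exact f.elim
      · have h := isIso_of_rlp_cofLeft (d := b.1) f hf
        have := @isIso_inr _ _ _ _ Q.G a.1 b.1 f h
        exact hb.of_iso (asIso (X := a.1) (Y := b.1) f).symm
  cf_of_llp_R₂ {a b} f ha hf hb := by
    rcases b with b | b
    · rcases a with a | a
      · have h := isIso_of_llp_rlp_acofRight (a := a.1) f hf
        have := @isIso_inl _ _ _ _ Q.G a.1 b.1 f h
        exact (cofibrant_of_llp (a := a.1) ha).of_iso (asIso (X := a.1) (Y := b.1) f)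
      · exact f.elim
    · have : (isTerminalInr Q).from (Sum.inr b) = (inr Q.G).map (terminal.from b.1) :=
        (isTerminalInr Q).hom_ext _ _
      rw [this] at hb
      exact (rlp_acofRight_inr_iff (Q := Q) (terminal.from b.1)).1 hb

end Replacement

section Inclusion

variable (PC : C → Prop) (PD : D → Prop)

/-- The inclusion of a collage of full subcategories. -/
def inclusion (G : D ⥤ C) : Collage G PC PD ⥤ FullCollage G where
  obj
    | Sum.inl c => Sum.inl ⟨c.1, trivial⟩
    | Sum.inr d => Sum.inr ⟨d.1, trivial⟩
  map {a b} f := match a, b, f with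
    | Sum.inl _, Sum.inl _, f => f
    | Sum.inl _, Sum.inr _, f => f
    | Sum.inr _, Sum.inr _, f => f
    | Sum.inr _, Sum.inl _, f => f.elim
  map_id := by rintro (a | a) <;> rfl
  map_comp {a b c} f g := by
    rcases a with a | a <;> rcases b with b | b <;> rcases c with c | c <;>
      first | rfl | exact f.elim | exact g.elim

instance (G : D ⥤ C) : (inclusion PC PD G).Full where
  map_surjective {a b} f := by
    rcases a with a | a <;> rcases b with b | b <;> first | exact ⟨f, rfl⟩ | exact f.elim

instance (G : D ⥤ C) : (inclusion PC PD G).Faithful where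
  map_injective {a b} f g h := by
    rcases a with a | a <;> rcases b with b | b <;> first | exact h | exact f.elim

lemma W_map_inclusion_iff {a b : Collage Q.G PC PD} (f : a ⟶ b) :
    (rel Q).W ((inclusion PC PD Q.G).map f) ↔ (collageRel Q PC PD).W f := by
  rcases a with a | a <;> rcases b with b | b <;> rfl

end Inclusion

end FullCollage

/-- The identity-insertion functors are compatible with the functors between categories of
zigzags induced by a relative functor. -/
def mapCompInsert {R R' : Type*} [Category R] [Category R'] {ρ : RelCatStruct R}
    {ρ' : RelCatStruct R'} (Φ : R ⥤ R') (hΦ : ∀ {a b : R} (f : a ⟶ b), ρ.W f → ρ'.W (Φ.map f))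
    (x y : R) (i j : ℕ) :
    ZigZag.map (ρ' := ρ') Φ hΦ x y (i + j) ⋙ insertFunctor ρ' (Φ.obj x) (Φ.obj y) i j ⟶
      insertFunctor ρ x y i j ⋙ ZigZag'.map Φ hΦ x y i j where
  app _ :=
    { uc _ := 𝟙 _
      ud _ := 𝟙 _
      huc _ := ρ'.W_id _
      hud _ := ρ'.W_id _
      comm_l := Category.id_comp _
      comm_arrc _ := (Category.id_comp _).trans (Category.comp_id _).symm
      comm_mid := congrArg (𝟙 _ ≫ ·) (Φ.map_id _)
      comm_arrd _ := (Category.id_comp _).trans (Category.comp_id _).symm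
      comm_r := Category.comp_id _ }
  naturality _ _ _ := ZigZag'Hom.ext
    (funext fun _ => (Category.comp_id _).trans (Category.id_comp _).symm)
    (funext fun _ => (Category.comp_id _).trans (Category.id_comp _).symm)

/-- for a Quillen adjunction `F : C ⇄ D : G`, a cofibrant `x ∈ C` and a
fibrant `y ∈ D`, the collage `(C^c+D^f)` with its weak equivalences admits a homotopical
three-arrow calculus with respect to `x` and `y`: for all `i, j ≥ 1` the
identity-insertion functor induces a weak homotopy equivalence
`N(Z_{i,j}((C^c+D^f);x,y)) → N(Z'_{i,j}((C^c+D^f);x,y))`. -/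
theorem statement4 {C : Type u} {D : Type u} [Category.{v} C] [Category.{v} D]
    [HasFiniteLimits C] [HasFiniteColimits C] [HasFiniteLimits D] [HasFiniteColimits D]
    {MC : ModelStructure C} {MD : ModelStructure D} (Q : QuillenAdjunction MC MD)
    (x : C) (hx : Cofibrant MC x) (y : D) (hy : Fibrant MD y)
    (i j : ℕ) (hi : 1 ≤ i) (hj : 1 ≤ j) :
    IsWeakHomotopyEquiv (@nerveMap _ _ (_) (_) (insertFunctor
      (collageRel Q (Cofibrant MC) (Fibrant MD))
      (Sum.inl ⟨x, hx⟩) (Sum.inr ⟨y, hy⟩) i j)) := by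
  have : HasFiniteCoproducts (FullCollage Q.G) :=
    ⟨fun _ => FullCollage.hasColimitsOfShape Q.adj _⟩
  have : HasPushouts (FullCollage Q.G) := FullCollage.hasColimitsOfShape Q.adj _
  have : HasPullbacks (FullCollage Q.G) := FullCollage.hasLimitsOfShape Q.adj _
  let Φ := FullCollage.inclusion (Cofibrant MC) (Fibrant MD) Q.G
  have hΦ {a b : Collage Q.G (Cofibrant MC) (Fibrant MD)} (f : a ⟶ b) :
      (collageRel Q _ _).W f → (FullCollage.rel Q).W (Φ.map f) :=
    (FullCollage.W_map_inclusion_iff Q _ _ f).2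
  have hΦ' {a b : Collage Q.G (Cofibrant MC) (Fibrant MD)} (f : a ⟶ b) :
      (FullCollage.rel Q).W (Φ.map f) → (collageRel Q _ _).W f :=
    (FullCollage.W_map_inclusion_iff Q _ _ f).1
  have hcf (a) (ha : FullCollage.IsCF Q a) : Φ.essImage a := by
    rcases a with a | a
    · exact ⟨Sum.inl ⟨a.1, ha⟩, ⟨Iso.refl _⟩⟩
    · exact ⟨Sum.inr ⟨a.1, ha⟩, ⟨Iso.refl _⟩⟩
  have hcf' (a) : FullCollage.IsCF Q (Φ.obj a) := by
    rcases a with a | a <;> exact a.2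
  let x' : Collage Q.G (Cofibrant MC) (Fibrant MD) := Sum.inl ⟨x, hx⟩
  let y' : Collage Q.G (Cofibrant MC) (Fibrant MD) := Sum.inr ⟨y, hy⟩
  let S : ReplacementSystem (FullCollage.rel Q) (Φ.obj x') (Φ.obj y') (FullCollage.IsCF Q) :=
    FullCollage.replacementSystem Q x y
  have h₁ := ZigZag.isWeakHomotopyEquiv_map (m := i + j) Φ hΦ (FullCollage.isSaturated Q) hΦ' S
    hcf hcf'
  have h₂ := ZigZag'.isWeakHomotopyEquiv_map (i := i) (j := j) Φ hΦ (FullCollage.isSaturated Q)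
    hΦ' S hcf hcf'
  have h₃ := isWeakHomotopyEquiv_insertFunctor (x := Φ.obj x') (y := Φ.obj y') (i := i) (j := j)
    (FullCollage.isSaturated Q) (FullCollage.acof Q).rlp FullCollage.exists_fact_acof
    FullCollage.W_of_llp_rlp_acof FullCollage.W_of_isPullback
  exact .of_postcomp h₂ ((h₁.comp h₃).congr (htpy_of_natTrans (mapCompInsert Φ hΦ x' y' i j)))

end Paper
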